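/- Let F : ℝ^n → ℝ^n be an everywhere defined real rational map whose Jacobian determinant vanishes nowhere on ℝ^n, and let A(F) be the set of points of the codomain at which F is not proper. Then the following are equivalent: (1) F is a bijection of ℝ^n onto ℝ^n with real analytic inverse; (2) A(F) = ∅; (3) A(F) ∩ F(ℝ^n) = ∅; (4) A(F) equals the topological boundary of F(ℝ^n). -/

import Mathlib

/-- `F : ℝⁿ → ℝⁿ` is an everywhere defined real rational map. -/
def IsEverywhereDefRatMap (n : ℕ) (F : (Fin n → ℝ) → (Fin n → ℝ)) : Prop :=
  ∀ i : Fin n, ∃ p q : MvPolynomial (Fin n) ℝ,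
    (∀ x : Fin n → ℝ, MvPolynomial.eval x q ≠ 0) ∧
    ∀ x : Fin n → ℝ, F x i = MvPolynomial.eval x p / MvPolynomial.eval x q

/-- `F` is proper at a point `y` of the codomain: `y` has a compact neighborhood with
compact inverse image under `F`. -/
def ProperAt (n : ℕ) (F : (Fin n → ℝ) → (Fin n → ℝ)) (y : Fin n → ℝ) : Prop :=
  ∃ K : Set (Fin n → ℝ), K ∈ nhds y ∧ IsCompact K ∧ IsCompact (F ⁻¹' K)

section partA1
open Set Filter Topology MeasureTheory

theorem sw_approx {ι : Type*} [Fintype ι] (f : (ι → ℝ) → ℝ) (hf : Continuous f)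
    (K : Set (ι → ℝ)) (hK : IsCompact K) (ε : ℝ) (hε : 0 < ε) :
    ∃ P : MvPolynomial ι ℝ, ∀ x ∈ K, |MvPolynomial.eval x P - f x| < ε := by
  let φ : MvPolynomial ι ℝ →ₐ[ℝ] C(ι → ℝ, ℝ) :=
    MvPolynomial.aeval (fun i => (⟨fun x => x i, continuous_apply i⟩ : C(ι → ℝ, ℝ)))
  have hφ : ∀ P x, φ P x = MvPolynomial.eval x P := by
    intro P x
    induction P using MvPolynomial.induction_on with
    | C a => simp [φ]
    | add p q hp hq => simp [hp, hq]
    | mul_X p i hp => simp only [map_mul, ContinuousMap.mul_apply, hp]; simp [φ]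
  have hsep : φ.range.SeparatesPoints := by
    intro x y hxy
    obtain ⟨i, hi⟩ := Function.ne_iff.mp hxy
    refine ⟨_, ⟨φ (MvPolynomial.X i), ⟨_, rfl⟩, rfl⟩, ?_⟩
    simpa [hφ] using hi
  obtain ⟨g, hg, h⟩ := ContinuousMap.exists_mem_subalgebra_near_continuous_of_isCompact_of_separatesPoints
    hsep ⟨f, hf⟩ hK hε
  obtain ⟨P, rfl⟩ := hg
  refine ⟨P, fun x hx => ?_⟩
  have := h x hx
  simpa [hφ, abs_sub_comm, Real.norm_eq_abs] using this

theorem det_pos_of_small {E : Type*} [NormedAddCommGroup E] [NormedSpace ℝ E] [FiniteDimensional ℝ E]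
    (A : E →L[ℝ] E) (h : ‖A‖ < 1) : 0 < (ContinuousLinearMap.id ℝ E + A).det := by
  have hne : ∀ r ∈ Icc (0:ℝ) 1, (ContinuousLinearMap.id ℝ E + r • A).det ≠ 0 := by
    intro r hr h0
    have := LinearMap.bot_lt_ker_of_det_eq_zero (f := ((ContinuousLinearMap.id ℝ E + r • A : E →L[ℝ] E) : E →ₗ[ℝ] E)) h0
    obtain ⟨v, hv, hv0⟩ := (Submodule.ne_bot_iff _).mp this.ne'
    have hv' : v + r • A v = 0 := by simpa using hv
    have h1 : ‖v‖ ≤ ‖A‖ * ‖v‖ := by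
      calc ‖v‖ = ‖r • A v‖ := by
            conv_lhs => rw [eq_neg_of_add_eq_zero_left hv', norm_neg]
        _ = |r| * ‖A v‖ := norm_smul _ _
        _ ≤ 1 * ‖A v‖ := by gcongr; rw [abs_le]; constructor <;> linarith [hr.1, hr.2]
        _ ≤ ‖A‖ * ‖v‖ := by rw [one_mul]; exact A.le_opNorm v
    have : 0 < ‖v‖ := norm_pos_iff.mpr hv0
    nlinarith
  have hc : Continuous fun r : ℝ => (ContinuousLinearMap.id ℝ E + r • A).det :=
    ContinuousLinearMap.continuous_det.comp (by fun_prop)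
  by_contra hneg
  push Not at hneg
  have := intermediate_value_Icc' (zero_le_one (α := ℝ)) hc.continuousOn
  obtain ⟨r, hr, h0⟩ := this (show (0:ℝ) ∈ _ from ⟨by simpa using hneg, by simp [ContinuousLinearMap.det]⟩)
  exact hne r hr h0

section deg
variable {ι : Type*} [Fintype ι] [DecidableEq ι]

theorem small_t (u : (ι → ℝ) → (ι → ℝ)) (hu : ContDiff ℝ 1 u) (R : ℝ)
    (h0 : ∀ x, R ≤ ‖x‖ → u x = 0) (P : (ι → ℝ) → ℝ) :
    ∃ t0 > (0:ℝ), ∀ t ∈ Ioo 0 t0, ∫ x in Metric.closedBall (0 : ι → ℝ) R,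
      P (x + t • u x) * (ContinuousLinearMap.id ℝ (ι → ℝ) + t • fderiv ℝ u x).det
      = ∫ x in Metric.closedBall (0 : ι → ℝ) R, P x := by
  have hcs : HasCompactSupport u := HasCompactSupport.intro (isCompact_closedBall 0 R)
    (fun x hx => h0 x (by simpa using (not_le.mp (by simpa using hx)).le))
  obtain ⟨C, hC⟩ := hu.lipschitzWith_of_hasCompactSupport hcs (by norm_num)
  refine ⟨1 / (2 * ((C:ℝ) + 1)), by positivity, fun t ht => ?_⟩
  have hC0 : (0:ℝ) ≤ C := C.2
  have htC : t * C < 1 / 2 := by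
    have := ht.2
    rw [lt_div_iff₀ (by positivity)] at this
    nlinarith [ht.1]
  set g : (ι → ℝ) → (ι → ℝ) := fun x => x + t • u x with hg
  have hder : ∀ x, HasFDerivAt g (ContinuousLinearMap.id ℝ (ι → ℝ) + t • fderiv ℝ u x) x := fun x =>
    (hasFDerivAt_id x).add (((hu.differentiable (by norm_num)) x).hasFDerivAt.const_smul t)
  have happ : ∀ x y, ‖g x - g y - (x - y)‖ ≤ (1/2) * ‖x - y‖ := by
    intro x y
    have : g x - g y - (x - y) = t • (u x - u y) := by simp only [hg, smul_sub]; abel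
    rw [this, norm_smul, Real.norm_of_nonneg ht.1.le]
    have := hC.norm_sub_le x y
    nlinarith [norm_nonneg (x - y), ht.1]
  have hinj : Function.Injective g := by
    intro x y hxy
    have := happ x y
    rw [hxy, sub_self, zero_sub, norm_neg] at this
    have h2 : ‖x - y‖ = 0 := by linarith [norm_nonneg (x - y)]
    exact sub_eq_zero.mp (norm_eq_zero.mp h2)
  have hap : ApproximatesLinearOn g ((ContinuousLinearEquiv.refl ℝ (ι → ℝ) : (ι → ℝ) →L[ℝ] (ι → ℝ))) univ (1/2) := by
    intro x _ y _
    simpa using happ x y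
  have hsurj : Function.Surjective g := by
    rcases subsingleton_or_nontrivial (ι → ℝ) with hs | hs
    · exact fun y => ⟨y, Subsingleton.elim _ _⟩
    apply hap.surjective
    right
    have : ‖(((ContinuousLinearEquiv.refl ℝ (ι → ℝ)).symm : (ι → ℝ) →L[ℝ] (ι → ℝ)))‖₊ = 1 := by
      ext; simp
    rw [this]; norm_num
  have hout : ∀ x, R ≤ ‖x‖ → g x = x := fun x hx => by simp [hg, h0 x hx]
  have himg : g '' Metric.closedBall 0 R = Metric.closedBall 0 R := by
    ext y
    simp only [mem_image, mem_closedBall_zero_iff]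
    constructor
    · rintro ⟨x, hx, rfl⟩
      by_contra hn
      push Not at hn
      have := hinj (hout (g x) hn.le)
      rw [this] at hn; linarith
    · intro hy
      obtain ⟨x, rfl⟩ := hsurj y
      refine ⟨x, ?_, rfl⟩
      by_contra hn
      push Not at hn
      rw [hout x hn.le] at hy; linarith
  have := integral_image_eq_integral_abs_det_fderiv_smul volume
    (Metric.isClosed_closedBall (x := (0 : ι → ℝ)) (ε := R)).measurableSet
    (fun x _ => (hder x).hasFDerivWithinAt) hinj.injOn P
  rw [himg] at this
  rw [this]
  refine integral_congr_ae (Eventually.of_forall fun x => ?_)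
  have hp : 0 < (ContinuousLinearMap.id ℝ (ι → ℝ) + t • fderiv ℝ u x).det := by
    apply det_pos_of_small
    rw [norm_smul, Real.norm_of_nonneg ht.1.le]
    have := norm_fderiv_le_of_lipschitz ℝ hC (x₀ := x)
    nlinarith [ht.1]
  simp only [abs_of_pos hp, smul_eq_mul]
  rw [mul_comm]

theorem poly_t (u : (ι → ℝ) → (ι → ℝ)) (hu : ContDiff ℝ 1 u) (R : ℝ) (P : MvPolynomial ι ℝ) :
    ∃ q : Polynomial ℝ, ∀ t : ℝ, ∫ x in Metric.closedBall (0 : ι → ℝ) R,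
      MvPolynomial.eval (x + t • u x) P * (ContinuousLinearMap.id ℝ (ι → ℝ) + t • fderiv ℝ u x).det
      = q.eval t := by
  let X := (ι → ℝ)
  let M : Matrix ι ι C(ι → ℝ, ℝ) := fun i j => ⟨fun x => fderiv ℝ u x (Pi.single j 1) i, by
    have := hu.continuous_fderiv (by norm_num)
    fun_prop⟩
  let Q : Polynomial C(ι → ℝ, ℝ) := MvPolynomial.aeval (fun i => Polynomial.C (⟨fun x => x i, continuous_apply i⟩ : C(ι → ℝ, ℝ))
      + Polynomial.X * Polynomial.C (⟨fun x => u x i, by have := hu.continuous; fun_prop⟩ : C(ι → ℝ, ℝ))) P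
    * (1 + (Polynomial.X : Polynomial C(ι → ℝ, ℝ)) • M.map Polynomial.C).det
  let ev : ℝ → (ι → ℝ) → (Polynomial C(ι → ℝ, ℝ) →+* ℝ) := fun t x =>
    Polynomial.eval₂RingHom ((ContinuousMap.evalAlgHom ℝ ℝ x : C(ι → ℝ, ℝ) →ₐ[ℝ] ℝ) : C(ι → ℝ, ℝ) →+* ℝ) t
  have hQ : ∀ t x, MvPolynomial.eval (x + t • u x) P * (ContinuousLinearMap.id ℝ (ι → ℝ) + t • fderiv ℝ u x).det
      = ev t x Q := by
    intro t x
    simp only [Q, map_mul]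
    congr 1
    · induction P using MvPolynomial.induction_on with
      | C a => simp [ev]
      | add p q hp hq => simp [hp, hq]
      | mul_X p i hp =>
        simp only [map_mul, hp]
        congr 1
        simp [ev]; ring
    · rw [RingHom.map_det, ContinuousLinearMap.det, ← LinearMap.det_toMatrix']
      congr 1
      ext i j
      simp only [LinearMap.toMatrix'_apply]
      by_cases hij : i = j
      · subst hij; simp [ev, M, Matrix.map_apply]; left; simp [Matrix.map]
      · simp [ev, M, hij]; left; simp [Matrix.map]
  have hev : ∀ t x, ev t x Q = ∑ k ∈ Q.support, Q.coeff k x * t ^ k := by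
    intro t x
    simp only [ev, Polynomial.coe_eval₂RingHom, Polynomial.eval₂_eq_sum, Polynomial.sum]
    rfl
  refine ⟨∑ k ∈ Q.support, Polynomial.C (∫ x in Metric.closedBall (0 : ι → ℝ) R, Q.coeff k x) * Polynomial.X ^ k, fun t => ?_⟩
  simp only [hQ, hev]
  rw [integral_finsetSum]
  · simp [Polynomial.eval_finsetSum, integral_mul_const]
  · intro k _
    apply ContinuousOn.integrableOn_compact (isCompact_closedBall _ _)
    have := (Q.coeff k).continuous
    fun_prop

theorem deg_poly (g : (ι → ℝ) → (ι → ℝ)) (hg : ContDiff ℝ 1 g) (R : ℝ)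
    (h0 : ∀ x, R ≤ ‖x‖ → g x = x) (P : MvPolynomial ι ℝ) :
    ∫ x in Metric.closedBall (0 : ι → ℝ) R, MvPolynomial.eval (g x) P * (fderiv ℝ g x).det
      = ∫ x in Metric.closedBall (0 : ι → ℝ) R, MvPolynomial.eval x P := by
  have hu : ContDiff ℝ 1 (fun x => g x - x) := hg.sub contDiff_id
  obtain ⟨q, hq⟩ := poly_t (fun x => g x - x) hu R P
  obtain ⟨t0, ht0, h⟩ := small_t (fun x => g x - x) hu R (fun x hx => by simp [h0 x hx])
    (fun x => MvPolynomial.eval x P)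
  have hqc : q = Polynomial.C (∫ x in Metric.closedBall (0 : ι → ℝ) R, MvPolynomial.eval x P) := by
    apply Polynomial.eq_of_infinite_eval_eq
    refine Set.Infinite.mono ?_ (Ioo_infinite ht0)
    intro t ht
    simp only [mem_ofPred_eq, Polynomial.eval_C]
    rw [← hq t, h t ht]
  have h1 := hq 1
  rw [hqc, Polynomial.eval_C] at h1
  rw [← h1]
  refine integral_congr_ae (Eventually.of_forall fun x => ?_)
  have : fderiv ℝ (fun x => g x - x) x = fderiv ℝ g x - ContinuousLinearMap.id ℝ _ := by
    rw [fderiv_fun_sub (hg.differentiable (by norm_num) x) differentiableAt_fun_id]; simp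
  simp [this]

theorem deg_cont (g : (ι → ℝ) → (ι → ℝ)) (hg : ContDiff ℝ 1 g) (R : ℝ)
    (h0 : ∀ x, R ≤ ‖x‖ → g x = x) (P : (ι → ℝ) → ℝ) (hP : Continuous P) :
    ∫ x in Metric.closedBall (0 : ι → ℝ) R, P (g x) * (fderiv ℝ g x).det
      = ∫ x in Metric.closedBall (0 : ι → ℝ) R, P x := by
  set B := Metric.closedBall (0 : ι → ℝ) R
  have hB : IsCompact B := isCompact_closedBall _ _
  have hfd : Continuous fun x => (fderiv ℝ g x).det :=
    ContinuousLinearMap.continuous_det.comp (hg.continuous_fderiv (by norm_num))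
  set c := ∫ x in B, |(fderiv ℝ g x).det|
  have hc : 0 ≤ c := integral_nonneg fun x => abs_nonneg _
  set v := (volume B).toReal
  have hv : 0 ≤ v := ENNReal.toReal_nonneg
  have hint : ∀ f : (ι → ℝ) → ℝ, Continuous f → IntegrableOn f B := fun f hf =>
    hf.continuousOn.integrableOn_compact hB
  have hgc := hg.continuous
  refine eq_of_forall_dist_le fun ε hε => ?_
  obtain ⟨p, hp⟩ := sw_approx P hP (B ∪ g '' B) (hB.union (hB.image hgc)) (ε / (c + v + 1)) (by positivity)
  set δ := ε / (c + v + 1)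
  have hpc : Continuous fun x => MvPolynomial.eval x p := MvPolynomial.continuous_eval p
  have h1 : ‖∫ x in B, (P (g x) * (fderiv ℝ g x).det - MvPolynomial.eval (g x) p * (fderiv ℝ g x).det)‖ ≤ δ * c := by
    rw [← integral_const_mul]
    refine norm_integral_le_of_norm_le (hint _ (by fun_prop)) ?_
    refine (ae_restrict_iff' hB.measurableSet).mpr (Eventually.of_forall fun x hx => ?_)
    rw [← sub_mul, norm_mul, Real.norm_eq_abs, Real.norm_eq_abs, abs_sub_comm]
    gcongr
    exact (hp _ (Or.inr ⟨x, hx, rfl⟩)).le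
  have h2 : ‖∫ x in B, (P x - MvPolynomial.eval x p)‖ ≤ δ * v := by
    have := norm_setIntegral_le_of_norm_le_const (f := fun x => P x - MvPolynomial.eval x p) (s := B) (μ := volume) (C := δ)
      hB.measure_lt_top (fun x hx => by
        rw [Real.norm_eq_abs, abs_sub_comm]; exact (hp _ (Or.inl hx)).le)
    simpa [Measure.real] using this
  rw [integral_sub (hint _ (by fun_prop)) (hint _ (by fun_prop))] at h1 h2
  rw [deg_poly g hg R h0 p] at h1
  rw [Real.dist_eq]
  rw [Real.norm_eq_abs] at h1 h2
  have : δ * (c + v + 1) = ε := by simp only [δ]; field_simp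
  have hδ : 0 < δ := by positivity
  rw [abs_le] at *
  constructor <;> nlinarith [h1.1, h1.2, h2.1, h2.2]
end deg
end partA1

section partA2
open Set Filter Topology MeasureTheory

section deg
variable {ι : Type*} [Fintype ι] [DecidableEq ι]

theorem local_W (g : (ι → ℝ) → (ι → ℝ)) (hg : ContDiff ℝ 1 g) (z : ι → ℝ)
    (hz : (fderiv ℝ g z).det ≠ 0) (O : Set (ι → ℝ)) (hO : O ∈ 𝓝 z) :
    ∃ W, IsOpen W ∧ z ∈ W ∧ W ⊆ O ∧ InjOn g W ∧
      (∀ x ∈ W, Real.sign (fderiv ℝ g x).det = Real.sign (fderiv ℝ g z).det) ∧ g '' W ∈ 𝓝 (g z) := by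
  have hs : HasStrictFDerivAt g (fderiv ℝ g z) z := hg.contDiffAt.hasStrictFDerivAt (by norm_num)
  set A := (fderiv ℝ g z).toContinuousLinearEquivOfDetNeZero hz with hA
  have hs' : HasStrictFDerivAt g (A : (ι → ℝ) →L[ℝ] (ι → ℝ)) z := by
    convert hs
    ext v; rfl
  have hfd : Continuous fun x => (fderiv ℝ g x).det :=
    ContinuousLinearMap.continuous_det.comp (hg.continuous_fderiv (by norm_num))
  have hsgn : ∀ᶠ x in 𝓝 z, Real.sign (fderiv ℝ g x).det = Real.sign (fderiv ℝ g z).det := by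
    rcases lt_or_gt_of_ne hz with h | h
    · filter_upwards [hfd.continuousAt.eventually (gt_mem_nhds h)] with x hx
      rw [Real.sign_of_neg hx, Real.sign_of_neg h]
    · filter_upwards [hfd.continuousAt.eventually (lt_mem_nhds h)] with x hx
      rw [Real.sign_of_pos hx, Real.sign_of_pos h]
  set e := hs'.toOpenPartialHomeomorph g
  have hsrc : e.source ∈ 𝓝 z := e.open_source.mem_nhds hs'.mem_toOpenPartialHomeomorph_source
  obtain ⟨W, hW, hWo, hzW⟩ := mem_nhds_iff.mp (inter_mem (inter_mem hsrc hO) hsgn)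
  refine ⟨W, hWo, hzW, fun x hx => (hW hx).1.2, e.injOn.mono (fun x hx => (hW hx).1.1),
    fun x hx => (hW hx).2, ?_⟩
  rw [← hs'.map_nhds_eq_of_equiv]
  exact image_mem_map (hWo.mem_nhds hzW)

theorem deg_sum (g : (ι → ℝ) → (ι → ℝ)) (hg : ContDiff ℝ 1 g) (R : ℝ) (hR : 0 < R)
    (h0 : ∀ x, R ≤ ‖x‖ → g x = x) (Z : Finset (ι → ℝ)) (hZ : ∀ x, g x = 0 ↔ x ∈ Z)
    (hd : ∀ z ∈ Z, (fderiv ℝ g z).det ≠ 0) :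
    ∑ z ∈ Z, Real.sign (fderiv ℝ g z).det = 1 := by
  obtain ⟨U, hU, hdisj⟩ := (Z.finite_toSet).t2_separation
  have hZB : ∀ z ∈ Z, ‖z‖ < R := by
    intro z hz
    by_contra h
    push Not at h
    have h1 := h0 z h
    rw [(hZ z).mpr hz] at h1
    rw [← h1, norm_zero] at h; linarith
  have hex : ∀ z : ι → ℝ, ∃ W, z ∈ Z → IsOpen W ∧ z ∈ W ∧ W ⊆ U z ∩ Metric.ball 0 R ∧ InjOn g W ∧
      (∀ x ∈ W, Real.sign (fderiv ℝ g x).det = Real.sign (fderiv ℝ g z).det) ∧ g '' W ∈ 𝓝 (0 : ι → ℝ) := by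
    intro z
    by_cases hz : z ∈ Z
    · obtain ⟨W, h⟩ := local_W g hg z (hd z hz) (U z ∩ Metric.ball 0 R)
        (inter_mem ((hU z).2.mem_nhds (hU z).1) (Metric.isOpen_ball.mem_nhds (by simpa using hZB z hz)))
      rw [(hZ z).mpr hz] at h
      exact ⟨W, fun _ => h⟩
    · exact ⟨∅, fun h => absurd h hz⟩
  choose W hW using hex
  set B := Metric.closedBall (0 : ι → ℝ) R
  have hgc := hg.continuous
  have hK : IsCompact (B \ ⋃ z ∈ Z, W z) := (isCompact_closedBall _ _).diff
    (isOpen_biUnion fun z hz => (hW z hz).1)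
  obtain ⟨δ1, hδ1, h1⟩ : ∃ δ > 0, ∀ x ∈ B \ ⋃ z ∈ Z, W z, δ ≤ ‖g x‖ := by
    rcases (B \ ⋃ z ∈ Z, W z).eq_empty_or_nonempty with he | hne
    · exact ⟨1, one_pos, by simp [he]⟩
    · obtain ⟨x, hx, hm⟩ := hK.exists_isMinOn hne hgc.norm.continuousOn
      refine ⟨‖g x‖, norm_pos_iff.mpr fun h => ?_, hm⟩
      have hxZ := (hZ x).mp h
      exact hx.2 (mem_biUnion hxZ (hW x hxZ).2.1)
  have h2 : ⋂ z ∈ Z, g '' W z ∈ 𝓝 (0 : ι → ℝ) :=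
    (Filter.biInter_finset_mem Z).mpr fun z hz => (hW z hz).2.2.2.2.2
  obtain ⟨δ2, hδ2, h2⟩ := Metric.mem_nhds_iff.mp h2
  set δ := min R (min δ1 δ2)
  have hδ : 0 < δ := by positivity
  set P : (ι → ℝ) → ℝ := fun y => max 0 (δ - ‖y‖)
  have hP : Continuous P := by fun_prop
  have hP0 : ∀ y, δ ≤ ‖y‖ → P y = 0 := fun y hy => max_eq_left (by linarith)
  have hPnn : ∀ y, 0 ≤ P y := fun y => le_max_left _ _
  have hcs : HasCompactSupport P := HasCompactSupport.intro (isCompact_closedBall (0 : ι → ℝ) δ)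
    (fun x hx => hP0 x (by simpa using (not_le.mp (by simpa using hx)).le))
  have hPpos : 0 < ∫ y, P y := by
    refine hP.integral_pos_of_hasCompactSupport_nonneg_nonzero hcs hPnn (x := 0) ?_
    simp [P, hδ.le, hδ.ne']
  have hsub : ∀ S : Set (ι → ℝ), Metric.ball 0 δ ⊆ S → ∫ y in S, P y = ∫ y, P y := by
    intro S hS
    refine setIntegral_eq_integral_of_forall_compl_eq_zero fun x hx => hP0 x ?_
    by_contra h
    exact hx (hS (by simpa using h))
  have key := deg_cont g hg R h0 P hP
  rw [hsub _ (fun x hx => ?_)] at key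
  swap
  · have : ‖x‖ < δ := by simpa using hx
    simpa [B] using (this.trans_le (min_le_left _ _)).le
  have hWB : (⋃ z ∈ Z, W z) ⊆ B := by
    intro x hx
    obtain ⟨z, hz, hx⟩ := mem_iUnion₂.mp hx
    exact Metric.ball_subset_closedBall ((hW z hz).2.2.1 hx).2
  rw [setIntegral_eq_of_subset_of_forall_sdiff_eq_zero (isCompact_closedBall _ _).measurableSet hWB
    (fun x hx => by rw [hP0 _ (le_trans (le_trans (min_le_right _ _) (min_le_left _ _)) (h1 x hx)), zero_mul])] at key
  have hfd : Continuous fun x => (fderiv ℝ g x).det :=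
    ContinuousLinearMap.continuous_det.comp (hg.continuous_fderiv (by norm_num))
  rw [integral_biUnion_finset Z (fun z hz => (hW z hz).1.measurableSet)
    (fun z hz z' hz' hne => (hdisj hz hz' hne).mono (fun x hx => ((hW z hz).2.2.1 hx).1) (fun x hx => ((hW z' hz').2.2.1 hx).1))
    (fun z hz => ((by fun_prop : Continuous fun x => P (g x) * (fderiv ℝ g x).det).continuousOn.integrableOn_compact
      (isCompact_closedBall 0 R)).mono_set (fun x hx => Metric.ball_subset_closedBall ((hW z hz).2.2.1 hx).2))] at key
  have hz : ∀ z ∈ Z, ∫ x in W z, P (g x) * (fderiv ℝ g x).det = Real.sign (fderiv ℝ g z).det * ∫ y, P y := by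
    intro z hz
    obtain ⟨hWo, hzW, hWs, hinj, hsg, him⟩ := hW z hz
    rw [← hsub (g '' W z) (fun y hy => by
      have hy' : ‖y‖ < δ := by simpa using hy
      have := h2 (show y ∈ Metric.ball 0 δ2 by simpa using hy'.trans_le ((min_le_right _ _).trans (min_le_right _ _)))
      exact (mem_iInter₂.mp this) z hz)]
    rw [integral_image_eq_integral_abs_det_fderiv_smul volume hWo.measurableSet
      (fun x _ => ((hg.differentiable (by norm_num)) x).hasFDerivAt.hasFDerivWithinAt) hinj, ← integral_const_mul]
    refine setIntegral_congr_fun hWo.measurableSet fun x hx => ?_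
    simp only [smul_eq_mul]
    rw [← hsg x hx]
    have : Real.sign (fderiv ℝ g x).det * |(fderiv ℝ g x).det| = (fderiv ℝ g x).det := by
      rcases lt_trichotomy (fderiv ℝ g x).det 0 with h | h | h
      · rw [Real.sign_of_neg h, abs_of_neg h]; ring
      · simp [h]
      · rw [Real.sign_of_pos h, abs_of_pos h]; ring
    rw [← mul_assoc, this, mul_comm]
  rw [Finset.sum_congr rfl hz, ← Finset.sum_mul] at key
  exact mul_right_cancel₀ hPpos.ne' (by rw [key, one_mul])

theorem deg_sum' (f : (ι → ℝ) → (ι → ℝ)) (hf : Continuous f) (R : ℝ) (hR : 0 < R)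
    (h0 : ∀ x, R ≤ ‖x‖ → f x = x) (Z : Finset (ι → ℝ)) (hZ : ∀ x, f x = 0 ↔ x ∈ Z)
    (hc : ∀ z ∈ Z, ContDiffAt ℝ 1 f z)
    (hd : ∀ z ∈ Z, (fderiv ℝ f z).det ≠ 0) :
    ∑ z ∈ Z, Real.sign (fderiv ℝ f z).det = 1 := by
  set O : Set (ι → ℝ) := {x | ContDiffAt ℝ 1 f x}
  have hO : IsOpen O := isOpen_iff_mem_nhds.mpr fun x hx => ContDiffAt.eventually hx (by norm_num)
  have hex : ∀ z : ι → ℝ, ∃ r, 0 < r ∧ (z ∈ Z → Metric.closedBall z r ⊆ O) := by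
    intro z
    by_cases hz : z ∈ Z
    · obtain ⟨r, hr, h⟩ := Metric.nhds_basis_closedBall.mem_iff.mp (hO.mem_nhds (hc z hz))
      exact ⟨r, hr, fun _ => h⟩
    · exact ⟨1, one_pos, fun h => absurd h hz⟩
  choose r hr hrO using hex
  set C : Set (ι → ℝ) := (⋃ z ∈ Z, Metric.closedBall z (r z)) ∪ {x | R + 1 ≤ ‖x‖}
  have hC : IsClosed C := (Z.finite_toSet.isClosed_biUnion fun z _ => Metric.isClosed_closedBall).union
    (isClosed_le continuous_const continuous_norm)
  have hCO : C ⊆ O := by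
    rintro x (hx | hx)
    · obtain ⟨z, hz, hx⟩ := mem_iUnion₂.mp hx
      exact hrO z hz hx
    · have hx' : R + 1 ≤ ‖x‖ := hx
      refine (contDiffAt_id (𝕜 := ℝ) (n := 1) (x := x)).congr_of_eventuallyEq ?_
      have : ∀ᶠ y in 𝓝 x, R < ‖y‖ := continuous_norm.continuousAt.eventually (lt_mem_nhds (by linarith))
      filter_upwards [this] with y hy
      exact h0 y hy.le
  have hZC : ∀ x, x ∉ C → f x ≠ 0 := fun x hx h => by
    have := (hZ x).mp h
    exact hx (Or.inl (mem_biUnion this (by simp [(hr x).le])))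
  classical
  let t : (ι → ℝ) → Set (ι → ℝ) := fun x => if x ∈ C then {f x} else Metric.ball (f x) ‖f x‖
  have ht : ∀ x, Convex ℝ (t x) := by
    intro x; simp only [t]; split_ifs
    · exact convex_singleton _
    · exact convex_ball _ _
  have hft : ∀ x, f x ∈ t x := by
    intro x; simp only [t]; split_ifs with h
    · rfl
    · simpa using hZC x h
  obtain ⟨g, hg⟩ := exists_contMDiffMap_forall_mem_convex_of_local (n := 1) (modelWithCornersSelf ℝ (ι → ℝ)) ht (by
    intro x
    by_cases hx : x ∈ O
    · refine ⟨O, hO.mem_nhds hx, f, ?_, fun y _ => hft y⟩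
      rw [contMDiffOn_iff_contDiffOn]
      exact fun y hy => ContDiffAt.contDiffWithinAt hy
    · have hxC : x ∉ C := fun h => hx (hCO h)
      have : ∀ᶠ y in 𝓝 x, ‖f x - f y‖ < ‖f y‖ := by
        have h1 : Continuous fun y => ‖f y‖ - ‖f x - f y‖ := by fun_prop
        have := (h1.continuousAt (x := x)).eventually (lt_mem_nhds (show (0:ℝ) < _ by simpa using hZC x hxC))
        filter_upwards [this] with y hy; linarith
      refine ⟨_, inter_mem (hC.isOpen_compl.mem_nhds hxC) this, fun _ => f x, contMDiffOn_const, ?_⟩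
      rintro y ⟨hyC, hy⟩
      have : y ∉ C := hyC
      simp only [t, this, if_false, mem_ball_iff_norm]
      exact hy)
  have hgd : ContDiff ℝ 1 g := by have := g.contMDiff; rwa [contMDiff_iff_contDiff] at this
  have hgC : ∀ x ∈ C, g x = f x := fun x hx => by have := hg x; simpa [t, hx] using this
  have hgz : ∀ x, g x = 0 ↔ x ∈ Z := by
    intro x
    by_cases hx : x ∈ C
    · rw [hgC x hx, hZ]
    · rw [← hZ]
      refine iff_of_false (fun h => ?_) (hZC x hx)
      have := hg x
      simp [t, hx, h] at this
  have hfd : ∀ z ∈ Z, fderiv ℝ g z = fderiv ℝ f z := by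
    intro z hz
    apply Filter.EventuallyEq.fderiv_eq
    filter_upwards [Metric.closedBall_mem_nhds z (hr z)] with y hy
    exact hgC y (Or.inl (mem_biUnion hz hy))
  have := deg_sum g hgd (R + 1) (by linarith) (fun x hx => by
    rw [hgC x (Or.inr hx), h0 x (by linarith)]) Z hgz (fun z hz => by rw [hfd z hz]; exact hd z hz)
  rw [← this]
  exact Finset.sum_congr rfl fun z hz => by rw [hfd z hz]

end deg

/-- homotopy of nonvanishing maps on a set -/
def Hpt {E : Type*} [NormedAddCommGroup E] (S : Set E) (v w : E → E) : Prop :=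
  ∃ H : ℝ × E → E, ContinuousOn H (univ ×ˢ S) ∧ (∀ t, ∀ x ∈ S, H (t, x) ≠ 0) ∧
    (∀ x ∈ S, H (0, x) = v x) ∧ ∀ x ∈ S, H (1, x) = w x

theorem Hpt.trans {E : Type*} [NormedAddCommGroup E] {S : Set E} {u v w : E → E}
    (h1 : Hpt S u v) (h2 : Hpt S v w) : Hpt S u w := by
  obtain ⟨H1, c1, n1, a1, b1⟩ := h1
  obtain ⟨H2, c2, n2, a2, b2⟩ := h2
  refine ⟨fun p => if p.1 ≤ 1/2 then H1 (2 * p.1, p.2) else H2 (2 * p.1 - 1, p.2), ?_, ?_, ?_, ?_⟩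
  · refine ContinuousOn.if ?_ ?_ ?_
    · rintro ⟨t, x⟩ ⟨⟨_, hx⟩, ht⟩
      have : t = 1/2 := by
        have := frontier_le_subset_eq (continuous_fst (X := ℝ) (Y := E)) continuous_const ht
        simpa using this
      subst this
      have hx' : x ∈ S := hx
      norm_num
      rw [b1 x hx', a2 x hx']
    · refine (c1.comp (f := fun p : ℝ × E => (2 * p.1, p.2)) (by fun_prop) ?_)
      rintro p ⟨⟨_, hp⟩, _⟩; exact ⟨trivial, hp⟩
    · refine (c2.comp (f := fun p : ℝ × E => (2 * p.1 - 1, p.2)) (by fun_prop) ?_)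
      rintro p ⟨⟨_, hp⟩, _⟩; exact ⟨trivial, hp⟩
  · intro t x hx
    dsimp only
    split_ifs
    · exact n1 _ x hx
    · exact n2 _ x hx
  · intro x hx; simp [a1 x hx]
  · intro x hx; norm_num; exact b2 x hx

theorem Hpt.of_Icc {E : Type*} [NormedAddCommGroup E] {S : Set E} {v w : E → E} (H : ℝ → E → E)
    (hc : ContinuousOn (fun p : ℝ × E => H p.1 p.2) (Icc 0 1 ×ˢ S))
    (hn : ∀ t ∈ Icc (0:ℝ) 1, ∀ x ∈ S, H t x ≠ 0)
    (h0 : ∀ x ∈ S, H 0 x = v x) (h1 : ∀ x ∈ S, H 1 x = w x) : Hpt S v w := by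
  have hcl : ∀ t : ℝ, max 0 (min 1 t) ∈ Icc (0:ℝ) 1 := fun t => ⟨by simp, by simp⟩
  refine ⟨fun p => H (max 0 (min 1 p.1)) p.2, ?_, fun t x hx => hn _ (hcl t) x hx, ?_, ?_⟩
  · refine hc.comp (f := fun p : ℝ × E => (max 0 (min 1 p.1), p.2)) (by fun_prop) ?_
    rintro p ⟨_, hp⟩; exact ⟨hcl _, hp⟩
  · intro x hx; simpa using h0 x hx
  · intro x hx; simpa using h1 x hx

theorem Hpt.symm {E : Type*} [NormedAddCommGroup E] {S : Set E} {v w : E → E}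
    (h : Hpt S v w) : Hpt S w v := by
  obtain ⟨H, c, n, a, b⟩ := h
  refine ⟨fun p => H (1 - p.1, p.2), c.comp (f := fun p : ℝ × E => (1 - p.1, p.2)) (by fun_prop) ?_,
    fun t x hx => n _ x hx, fun x hx => by simpa using b x hx, fun x hx => by simpa using a x hx⟩
  rintro p ⟨_, hp⟩; exact ⟨trivial, hp⟩

/-- main degree statement -/
theorem deg_ball {ι : Type*} [Fintype ι] [DecidableEq ι] (f : (ι → ℝ) → (ι → ℝ)) (u : ι → ℝ) (R : ℝ)
    (hR : 0 < R) (hf : ContinuousOn f (Metric.closedBall u R))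
    (hH : Hpt (Metric.sphere u R) f (fun s => s - u))
    (Z : Finset (ι → ℝ)) (hZ : ∀ x ∈ Metric.closedBall u R, f x = 0 ↔ x ∈ Z)
    (hZB : ∀ z ∈ Z, z ∈ Metric.closedBall u R)
    (hc : ∀ z ∈ Z, ContDiffAt ℝ 1 f z) (hd : ∀ z ∈ Z, (fderiv ℝ f z).det ≠ 0) :
    ∑ z ∈ Z, Real.sign (fderiv ℝ f z).det = 1 := by
  obtain ⟨H, c, n, a, b⟩ := hH
  let F : (ι → ℝ) → (ι → ℝ) := fun x => if ‖x‖ ≤ R then f (u + x) else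
    (‖x‖ / R) • H (min 1 (‖x‖ / R - 1), u + (R / ‖x‖) • x)
  have hsph : ∀ x : ι → ℝ, R ≤ ‖x‖ → u + (R / ‖x‖) • x ∈ Metric.sphere u R := by
    intro x hx
    have : 0 < ‖x‖ := by linarith
    simp [norm_smul, abs_of_pos hR, this.ne']
  have hFc : Continuous F := by
    refine continuous_if_le continuous_norm continuous_const ?_ ?_ ?_
    · refine hf.comp (by fun_prop) fun x hx => ?_
      simpa using hx
    · have h1 : ContinuousOn (fun x : ι → ℝ => (R / ‖x‖) • x) {x | R ≤ ‖x‖} := by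
        refine ContinuousOn.smul (ContinuousOn.div continuousOn_const continuous_norm.continuousOn fun x hx => ?_) continuousOn_id
        have : R ≤ ‖x‖ := hx
        linarith
      refine ContinuousOn.smul (f := fun x : ι → ℝ => ‖x‖ / R) (by fun_prop) (c.comp (ContinuousOn.prodMk (f := fun x : ι → ℝ => min 1 (‖x‖ / R - 1)) (by fun_prop) (continuousOn_const.add h1)) ?_)
      exact fun x hx => ⟨trivial, hsph x hx⟩
    · intro x hx
      have hs := hsph x hx.ge
      rw [hx, div_self hR.ne'] at hs ⊢
      norm_num
      rw [one_smul] at hs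
      rw [a _ hs]
  have hnS : ∀ x ∈ Metric.sphere u R, x ∉ Z := fun x hx h => n 0 x hx
    (by rw [a x hx]; exact (hZ x (Metric.sphere_subset_closedBall hx)).mpr h)
  have hZb : ∀ z ∈ Z, ‖z - u‖ < R := fun z hz => by
    have := hZB z hz
    rw [mem_closedBall_iff_norm] at this
    refine lt_of_le_of_ne this fun h => hnS z ?_ hz
    simpa [mem_sphere_iff_norm] using h
  have hloc : ∀ z ∈ Z, F =ᶠ[𝓝 (z - u)] fun x => f (u + x) := by
    intro z hz
    have : ∀ᶠ y in 𝓝 (z - u), ‖y‖ < R := continuous_norm.continuousAt.eventually (gt_mem_nhds (hZb z hz))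
    filter_upwards [this] with y hy
    simp [F, hy.le]
  have hfd : ∀ z ∈ Z, fderiv ℝ F (z - u) = fderiv ℝ f z := by
    intro z hz
    rw [(hloc z hz).fderiv_eq]
    have := fderiv_comp_add_left (𝕜 := ℝ) (f := f) (x := z - u) u
    simpa using this
  have key := deg_sum' F hFc (2 * R) (by linarith) (fun x hx => ?_) (Z.image fun z => z - u) ?_ ?_ ?_
  · rw [Finset.sum_image (fun x _ y _ h => by simpa using h)] at key
    rw [← key]
    exact Finset.sum_congr rfl fun z hz => by rw [hfd z hz]
  · have hx0 : 0 < ‖x‖ := by linarith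
    have h1 : (1:ℝ) ≤ ‖x‖ / R - 1 := by
      rw [le_sub_iff_add_le, le_div_iff₀ hR]; linarith
    simp only [F, if_neg (show ¬ ‖x‖ ≤ R by linarith), min_eq_left h1]
    rw [b _ (hsph x (by linarith))]
    simp only [add_sub_cancel_left, smul_smul]
    field_simp
    simp
  · intro x
    simp only [Finset.mem_image]
    by_cases hx : ‖x‖ ≤ R
    · simp only [F, if_pos hx]
      rw [hZ (u + x) (by simpa using hx)]
      constructor
      · intro h; exact ⟨_, h, by simp⟩
      · rintro ⟨z, hz, rfl⟩; simpa using hz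
    · refine iff_of_false ?_ ?_
      · simp only [F, if_neg hx]
        refine smul_ne_zero ?_ (n _ _ (hsph x (by linarith)))
        have : 0 < ‖x‖ := by linarith
        positivity
      · rintro ⟨z, hz, rfl⟩
        exact hx (hZb z hz).le
  · intro x hx
    obtain ⟨z, hz, rfl⟩ := Finset.mem_image.mp hx
    refine ContDiffAt.congr_of_eventuallyEq ?_ (hloc z hz)
    have h1 : ContDiffAt ℝ 1 f (u + (z - u)) := by simpa using hc z hz
    exact h1.comp (z - u) (by fun_prop)
  · intro x hx
    obtain ⟨z, hz, rfl⟩ := Finset.mem_image.mp hx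
    rw [hfd z hz]; exact hd z hz
end partA2

section partB1
open Set Filter Topology MeasureTheory

section flow
variable {ι : Type*} [Fintype ι] [DecidableEq ι]

/-- the vector of partial derivatives -/
noncomputable def grad (e : (ι → ℝ) → ℝ) (s : ι → ℝ) : ι → ℝ := fun i => fderiv ℝ e s (Pi.single i 1)

theorem fderiv_eq_grad (e : (ι → ℝ) → ℝ) (s v : ι → ℝ) : fderiv ℝ e s v = ∑ i, grad e s i * v i := by
  conv_lhs => rw [pi_eq_sum_univ' v]
  simp [map_sum, grad, mul_comm]

theorem grad_contAt (e : (ι → ℝ) → ℝ) (s : ι → ℝ) (h : ContDiffAt ℝ 1 e s) : ContinuousAt (grad e) s := by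
  have := (h.fderiv_right (m := 0) (by norm_num)).continuousAt
  refine continuousAt_pi.mpr fun i => ?_
  unfold grad
  fun_prop

theorem step_local (e : (ι → ℝ) → ℝ) (s0 : ι → ℝ) (h : ContDiffAt ℝ 1 e s0) (hg : grad e s0 ≠ 0) :
    ∃ η > (0:ℝ), ∀ᶠ s in 𝓝 s0, ∀ t, 0 < t → t ≤ η → e (s - t • grad e s) < e s := by
  have hG0 : 0 < ∑ i, grad e s0 i * grad e s0 i := by
    obtain ⟨i, hi⟩ := Function.ne_iff.mp hg
    exact Finset.sum_pos' (fun i _ => mul_self_nonneg _) ⟨i, Finset.mem_univ _, mul_self_pos.mpr hi⟩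
  set G0 := ∑ i, grad e s0 i * grad e s0 i with hG
  set m := ‖grad e s0‖ + 1
  have hm : 0 < m := by positivity
  have hgc := grad_contAt e s0 h
  have hst := h.hasStrictFDerivAt (by norm_num)
  have hlo := hst.isLittleO.def (show 0 < G0 / (4 * m) by positivity)
  have hmap : ContinuousAt (fun p : (ι → ℝ) × ℝ => (p.1 - p.2 • grad e p.1, p.1)) (s0, 0) := by
    have : ContinuousAt (fun p : (ι → ℝ) × ℝ => grad e p.1) (s0, 0) :=
      ContinuousAt.comp (f := Prod.fst) (x := (s0, (0:ℝ))) hgc continuousAt_fst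
    fun_prop
  have hmap' : Tendsto (fun p : (ι → ℝ) × ℝ => (p.1 - p.2 • grad e p.1, p.1)) (𝓝 (s0, 0)) (𝓝 (s0, s0)) := by
    have := hmap.tendsto; simpa using this
  have h1 := hmap'.eventually hlo
  have h2 : ∀ᶠ s in 𝓝 s0, ‖grad e s‖ < m ∧ G0 / 2 < ∑ i, grad e s0 i * grad e s i := by
    refine (hgc.norm.eventually (gt_mem_nhds (by simp [m]))).and ?_
    have : ContinuousAt (fun s => ∑ i, grad e s0 i * grad e s i) s0 := by
      have hp := continuousAt_pi.mp hgc
      refine tendsto_finsetSum _ fun i _ => ?_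
      exact (hp i).const_mul _
    exact this.eventually (lt_mem_nhds (by simp only [← hG]; linarith))
  rw [nhds_prod_eq] at h1
  obtain ⟨pa, hpa, pb, hpb, hp⟩ := Filter.eventually_prod_iff.mp h1
  obtain ⟨η, hη, hηb⟩ := Metric.nhds_basis_closedBall.mem_iff.mp hpb
  refine ⟨η, hη, ?_⟩
  filter_upwards [hpa, h2] with s hs hs2 t ht htη
  have h3 := hp hs (hηb (show t ∈ Metric.closedBall 0 η by simpa [abs_of_pos ht] using htη))
  dsimp only at h3
  have e1 : s - t • grad e s - s = -(t • grad e s) := by abel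
  rw [e1, map_neg, map_smul, fderiv_eq_grad, norm_neg, norm_smul, Real.norm_of_nonneg ht.le, smul_eq_mul, Real.norm_eq_abs] at h3
  have h4 := (abs_le.mp h3).2
  have h5 : G0 / (4 * m) * (t * ‖grad e s‖) ≤ t * G0 / 4 := by
    have : G0 / (4 * m) * (t * ‖grad e s‖) ≤ G0 / (4 * m) * (t * m) := by gcongr; exact hs2.1.le
    refine this.trans (le_of_eq ?_)
    field_simp
  nlinarith [mul_lt_mul_of_pos_left hs2.2 ht, mul_pos ht hG0]

theorem flow_hpt (e : (ι → ℝ) → ℝ) (he : Continuous e) (c0 c1 c2 : ℝ) (h01 : c0 < c1)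
    (hK : IsCompact {s | e s ≤ c2})
    (hreg : ∀ s, c0 ≤ e s → e s ≤ c2 → ContDiffAt ℝ 1 e s ∧ grad e s ≠ 0)
    (u : ι → ℝ) (r : ℝ) (hS : ∀ s ∈ Metric.sphere u r, c1 < e s ∧ e s ≤ c2)
    (hin : ∀ s, e s ≤ c1 → s ∈ Metric.ball u r) :
    Hpt (Metric.sphere u r) (grad e) (fun s => s - u) := by
  set K := {s | e s ≤ c2}
  have hKc : ∀ c, IsCompact ({s | c ≤ e s} ∩ K) := fun c => hK.inter_left (isClosed_le continuous_const he)
  obtain ⟨η, hη, hstep⟩ : ∃ η > (0:ℝ), ∀ s ∈ {s | c0 ≤ e s} ∩ K, ∀ t, 0 < t → t ≤ η → e (s - t • grad e s) < e s := by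
    refine (hKc c0).induction_on (p := fun A => ∃ η > (0:ℝ), ∀ s ∈ A, ∀ t, 0 < t → t ≤ η → e (s - t • grad e s) < e s)
      ⟨1, one_pos, by simp⟩ ?_ ?_ ?_
    · rintro A B hAB ⟨η, hη, h⟩; exact ⟨η, hη, fun s hs => h s (hAB hs)⟩
    · rintro A B ⟨η, hη, h⟩ ⟨η', hη', h'⟩
      refine ⟨min η η', lt_min hη hη', fun s hs t ht ht' => ?_⟩
      rcases hs with hs | hs
      · exact h s hs t ht (ht'.trans (min_le_left _ _))
      · exact h' s hs t ht (ht'.trans (min_le_right _ _))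
    · rintro s ⟨hs0, hs2⟩
      obtain ⟨hc, hg⟩ := hreg s hs0 hs2
      obtain ⟨η, hη, h⟩ := step_local e s hc hg
      exact ⟨_, mem_nhdsWithin_of_mem_nhds h, η, hη, fun s hs => hs⟩
  let ψ : (ι → ℝ) → ℝ := fun s => η * min 1 (max 0 ((e s - c0) / (c1 - c0)))
  have hψc : Continuous ψ := by fun_prop
  have hd : 0 < c1 - c0 := by linarith
  have hψ0 : ∀ s, e s ≤ c0 → ψ s = 0 := fun s hs => by
    simp only [ψ]
    rw [max_eq_left (div_nonpos_of_nonpos_of_nonneg (by linarith) hd.le)]; simp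
  have hψη : ∀ s, ψ s ≤ η := fun s => by
    have : min 1 (max 0 ((e s - c0) / (c1 - c0))) ≤ 1 := min_le_left _ _
    simp only [ψ]; nlinarith
  have hψp : ∀ s, c0 < e s → 0 < ψ s := fun s hs => by
    have : 0 < (e s - c0) / (c1 - c0) := div_pos (by linarith) hd
    have : 0 < min 1 (max 0 ((e s - c0) / (c1 - c0))) := lt_min one_pos (lt_max_of_lt_right this)
    positivity
  let w : (ι → ℝ) → (ι → ℝ) := fun s => ψ s • grad e s
  have hw : ContinuousOn w K := by
    intro s hs
    apply ContinuousAt.continuousWithinAt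
    rcases lt_or_ge (e s) c0 with h | h
    · have : w =ᶠ[𝓝 s] fun _ => 0 := by
        filter_upwards [he.continuousAt.eventually (gt_mem_nhds h)] with y hy
        simp [w, hψ0 y hy.le]
      exact continuousAt_const.congr this.symm
    · exact hψc.continuousAt.smul (grad_contAt e s (hreg s h hs).1)
  have hlt : ∀ s ∈ K, ∀ t : ℝ, 0 < t → t ≤ 1 → c0 < e s → e (s - t • w s) < e s := by
    intro s hs t ht ht1 h
    simp only [w, smul_smul]
    refine hstep s ⟨h.le, hs⟩ _ (mul_pos ht (hψp s h)) ?_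
    nlinarith [hψη s, hψp s h]
  have hle : ∀ s ∈ K, ∀ t : ℝ, 0 ≤ t → t ≤ 1 → e (s - t • w s) ≤ e s := by
    intro s hs t ht ht1
    rcases le_or_gt (e s) c0 with h | h
    · simp [w, hψ0 s h]
    · rcases ht.eq_or_lt with h0 | h0
      · simp [← h0]
      · exact (hlt s hs t h0 ht1 h).le
  let g : (ι → ℝ) → (ι → ℝ) := fun s => s - w s
  have hg1 : ∀ s, g s = s - (1:ℝ) • w s := fun s => by simp [g]
  have hgK : MapsTo g K K := fun s hs => by
    have := hle s hs 1 zero_le_one le_rfl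
    rw [← hg1] at this
    exact this.trans hs
  have hgc : ContinuousOn g K := continuousOn_id.sub hw
  have hiK : ∀ i, MapsTo (g^[i]) K K := fun i => hgK.iterate i
  have hic : ∀ i, ContinuousOn (g^[i]) K := by
    intro i
    induction i with
    | zero => exact continuousOn_id
    | succ i ih => rw [Function.iterate_succ]; exact ih.comp hgc hgK
  obtain ⟨δ, hδ, hdec⟩ : ∃ δ > 0, ∀ s ∈ {s | c1 ≤ e s} ∩ K, e (g s) ≤ e s - δ := by
    rcases ({s | c1 ≤ e s} ∩ K).eq_empty_or_nonempty with h | h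
    · exact ⟨1, one_pos, by simp [h]⟩
    · obtain ⟨s, hs, hm⟩ := (hKc c1).exists_isMinOn h (f := fun s => e s - e (g s))
        (he.continuousOn.sub (he.comp_continuousOn (hgc.mono inter_subset_right)))
      refine ⟨e s - e (g s), ?_, fun y hy => ?_⟩
      · have := hlt s hs.2 1 one_pos le_rfl (h01.trans_le hs.1)
        rw [← hg1] at this; linarith
      · have := hm hy; dsimp at this; linarith
  have hdec' : ∀ i : ℕ, ∀ s ∈ K, e (g^[i] s) ≤ max c1 (c2 - i * δ) := by
    intro i
    induction i with
    | zero => intro s hs; simp; right; exact hs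
    | succ i ih =>
      intro s hs
      rw [Function.iterate_succ_apply']
      have h1 := ih s hs
      have hk := hiK i hs
      have h2 := hle _ hk 1 zero_le_one le_rfl
      rw [← hg1] at h2
      rcases le_or_gt c1 (e (g^[i] s)) with h | h
      · have h3 := hdec _ ⟨h, hk⟩
        push_cast
        rcases le_max_iff.mp h1 with h4 | h4
        · exact le_max_of_le_left (by linarith)
        · exact le_max_of_le_right (by linarith)
      · exact le_max_of_le_left (by linarith)
  obtain ⟨m, hm⟩ := exists_nat_gt ((c2 - c1) / δ)
  have hmfin : ∀ s ∈ K, e (g^[m+1] s) ≤ c1 := by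
    intro s hs
    refine (hdec' (m+1) s hs).trans (max_le le_rfl ?_)
    rw [div_lt_iff₀ hδ] at hm
    push_cast; nlinarith
  have hSK : Metric.sphere u r ⊆ K := fun s hs => (hS s hs).2
  have hnon : ∀ i, ∀ s ∈ K, e (g^[i] s) ≤ e s := by
    intro i
    induction i with
    | zero => intro s _; simp
    | succ i ih =>
      intro s hs
      rw [Function.iterate_succ_apply']
      have h2 := hle _ (hiK i hs) 1 zero_le_one le_rfl
      rw [← hg1] at h2
      exact h2.trans (ih s hs)
  have hsteps : ∀ i : ℕ, Hpt (Metric.sphere u r) (fun s => s - g^[1] s) (fun s => s - g^[i+1] s) := by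
    intro i
    induction i with
    | zero =>
      refine Hpt.of_Icc (fun _ s => s - g^[1] s) ?_ ?_ (fun _ _ => rfl) (fun _ _ => rfl)
      · refine continuousOn_snd.sub (((hic 1).mono hSK).comp continuousOn_snd fun p hp => hp.2)
      · intro t _ s hs h0
        have := hlt s (hSK hs) 1 one_pos le_rfl (h01.trans (hS s hs).1)
        rw [← hg1] at this
        rw [sub_eq_zero] at h0
        rw [Function.iterate_one] at h0
        rw [← h0] at this; exact lt_irrefl _ this
    | succ i ih =>
      refine ih.trans (Hpt.of_Icc (fun t s => s - (g^[i+1] s - t • w (g^[i+1] s))) ?_ ?_ ?_ ?_)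
      · have h1 : ContinuousOn (fun p : ℝ × (ι → ℝ) => g^[i+1] p.2) (Icc 0 1 ×ˢ Metric.sphere u r) :=
          ((hic (i+1)).mono hSK).comp continuousOn_snd fun p hp => hp.2
        have h2 : ContinuousOn (fun p : ℝ × (ι → ℝ) => w (g^[i+1] p.2)) (Icc 0 1 ×ˢ Metric.sphere u r) :=
          hw.comp h1 fun p hp => hiK (i+1) (hSK hp.2)
        exact continuousOn_snd.sub (h1.sub (continuousOn_fst.smul h2))
      · intro t ht s hs h0
        rw [sub_eq_zero] at h0
        have h1 := hle _ (hiK (i+1) (hSK hs)) t ht.1 ht.2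
        rw [← h0] at h1
        have h2 := hlt s (hSK hs) 1 one_pos le_rfl (h01.trans (hS s hs).1)
        rw [← hg1] at h2
        have h3 := hnon i (g s) (hgK (hSK hs))
        rw [← Function.iterate_succ_apply] at h3
        linarith
      · intro s _; simp
      · intro s _
        rw [Function.iterate_succ_apply' g (i+1)]; simp [g]
  have hfirst : Hpt (Metric.sphere u r) (grad e) (fun s => s - g^[1] s) := by
    have hgr : ContinuousOn (grad e) (Metric.sphere u r) := fun s hs =>
      (grad_contAt e s (hreg s (h01.trans (hS s hs).1).le (hS s hs).2).1).continuousWithinAt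
    refine Hpt.of_Icc (fun t s => ((1 - t) + t * ψ s) • grad e s) ?_ ?_ (fun s _ => by simp) (fun s _ => by simp [g, w])
    · have h1 : ContinuousOn (fun p : ℝ × (ι → ℝ) => grad e p.2) (Icc 0 1 ×ˢ Metric.sphere u r) :=
        hgr.comp continuousOn_snd fun p hp => hp.2
      have h2 : Continuous (fun p : ℝ × (ι → ℝ) => (1 - p.1) + p.1 * ψ p.2) := by fun_prop
      exact h2.continuousOn.smul h1
    · intro t ht s hs
      refine smul_ne_zero ?_ (hreg s (h01.trans (hS s hs).1).le (hS s hs).2).2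
      have := hψp s (h01.trans (hS s hs).1)
      rcases ht.2.eq_or_lt with h | h
      · rw [h]; simpa using this.ne'
      · have := mul_nonneg ht.1 this.le; intro h0; linarith
  refine (hfirst.trans (hsteps m)).trans ?_
  refine Hpt.of_Icc (fun t s => (s - u) - (1 - t) • (g^[m+1] s - u)) ?_ ?_ (fun s _ => by simp) (fun s _ => by simp)
  · have h1 : ContinuousOn (fun p : ℝ × (ι → ℝ) => g^[m+1] p.2) (Icc 0 1 ×ˢ Metric.sphere u r) :=
      ((hic (m+1)).mono hSK).comp continuousOn_snd fun p hp => hp.2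
    exact (continuousOn_snd.sub continuousOn_const).sub
      ((continuousOn_const.sub continuousOn_fst).smul (h1.sub continuousOn_const))
  · intro t ht s hs h0
    rw [sub_eq_zero] at h0
    have h1 := hin _ (hmfin s (hSK hs))
    rw [mem_ball_iff_norm] at h1
    rw [mem_sphere_iff_norm] at hs
    rw [h0, norm_smul, Real.norm_of_nonneg (by linarith [ht.2])] at hs
    nlinarith [norm_nonneg (g^[m+1] s - u), ht.1, ht.2]
end flow
end partB1

section partB2
open Set Filter Topology MeasureTheory

section gd
variable {ι : Type*} [Fintype ι] [DecidableEq ι]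

theorem coercive_compact (e : (ι → ℝ) → ℝ) (he : Continuous e) (hco : Tendsto e (cocompact _) atTop) (c : ℝ) :
    IsCompact {s | e s ≤ c} := by
  have h := hco.eventually (eventually_gt_atTop c)
  obtain ⟨K, hK, hKs⟩ := mem_cocompact.mp h
  refine hK.of_isClosed_subset (isClosed_le he continuous_const) fun s hs => ?_
  by_contra hn
  have := hKs hn
  simp only [mem_ofPred_eq] at this hs
  exact absurd hs (not_le.mpr this)

theorem flow_out (e : (ι → ℝ) → ℝ) (he : ContDiff ℝ 1 e) (hco : Tendsto e (cocompact _) atTop)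
    (u : ι → ℝ) (R0 : ℝ) (hg : ∀ s, R0 ≤ ‖s - u‖ → grad e s ≠ 0) :
    ∃ R > R0, 0 < R ∧ Hpt (Metric.sphere u R) (grad e) (fun s => s - u) := by
  have hcont := he.continuous
  obtain ⟨c0, hc0⟩ := (isCompact_closedBall u R0).exists_bound_of_continuousOn hcont.continuousOn
  have hK1 := coercive_compact e hcont hco (|c0| + 2)
  obtain ⟨R1, hR1⟩ := hK1.isBounded.subset_closedBall u
  let R := max (max R1 R0) 0 + 1
  have hRR1 : R1 < R := by have := le_max_left (max R1 R0) 0; have := le_max_left R1 R0; simp only [R]; linarith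
  have hRR0 : R0 < R := by have := le_max_left (max R1 R0) 0; have := le_max_right R1 R0; simp only [R]; linarith
  have hR : 0 < R := by have := le_max_right (max R1 R0) 0; simp only [R]; linarith
  obtain ⟨c2, hc2⟩ := (isCompact_sphere u R).exists_bound_of_continuousOn hcont.continuousOn
  refine ⟨R, hRR0, hR, flow_hpt e hcont (|c0| + 1) (|c0| + 2) c2 (by linarith) (coercive_compact e hcont hco _) ?_ u R ?_ ?_⟩
  · intro s h0 h2
    refine ⟨he.contDiffAt, hg s ?_⟩
    by_contra hn
    push Not at hn
    have := hc0 s (mem_closedBall_iff_norm.mpr hn.le)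
    rw [Real.norm_eq_abs] at this
    have := le_abs_self (e s)
    have := le_abs_self c0
    linarith
  · intro s hs
    refine ⟨?_, (le_abs_self _).trans (hc2 s hs)⟩
    by_contra hn
    push Not at hn
    have := hR1 hn
    rw [mem_closedBall_iff_norm] at this
    rw [mem_sphere_iff_norm] at hs
    linarith
  · intro s hs
    have := hR1 hs
    rw [mem_closedBall_iff_norm] at this
    rw [mem_ball_iff_norm]; linarith

theorem grad_contDiffAt (e : (ι → ℝ) → ℝ) (s : ι → ℝ) (h : ContDiffAt ℝ 2 e s) : ContDiffAt ℝ 1 (grad e) s := by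
  have := h.fderiv_right (m := 1) (by norm_num)
  refine contDiffAt_pi.mpr fun i => ?_
  unfold grad
  exact this.clm_apply contDiffAt_const

theorem GD1 (E : (ι → ℝ) → ℝ) (hE : ContDiff ℝ 2 E) (hco : Tendsto E (cocompact _) atTop)
    (Z : Finset (ι → ℝ)) (hZ : ∀ s, grad E s = 0 ↔ s ∈ Z)
    (hd : ∀ z ∈ Z, (fderiv ℝ (grad E) z).det ≠ 0) :
    ∑ z ∈ Z, Real.sign (fderiv ℝ (grad E) z).det = 1 := by
  obtain ⟨R0, hR0⟩ := Z.finite_toSet.isBounded.subset_closedBall 0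
  obtain ⟨R, hR, hRp, hH⟩ := flow_out E (hE.of_le (by norm_num)) hco 0 (R0 + 1) (fun s hs h0 => by
    have := hR0 ((hZ s).mp h0)
    rw [mem_closedBall_iff_norm] at this
    linarith)
  refine deg_ball (grad E) 0 R hRp (fun s _ => (grad_contAt E s (hE.contDiffAt.of_le (by norm_num))).continuousWithinAt) hH Z
    (fun s _ => hZ s) (fun z hz => Metric.closedBall_subset_closedBall (by linarith) (hR0 hz))
    (fun z _ => grad_contDiffAt E z hE.contDiffAt) hd

theorem grad_congr {e f : (ι → ℝ) → ℝ} {s : ι → ℝ} (h : e =ᶠ[𝓝 s] f) : grad e s = grad f s := by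
  unfold grad; rw [h.fderiv_eq]

theorem flow_in (E : (ι → ℝ) → ℝ) (u : ι → ℝ) (ρ : ℝ) (hρ : 0 < ρ)
    (hE : ∀ s, s ≠ u → ContDiffAt ℝ 1 E s)
    (hu : Tendsto E (𝓝[≠] u) atTop) (hg : ∀ s, s ≠ u → ‖s - u‖ < ρ → grad E s ≠ 0) :
    ∃ r > 0, r < ρ ∧ Hpt (Metric.sphere u r) (grad E) (fun s => -(s - u)) := by
  have h1 := hu.eventually (eventually_gt_atTop 1)
  rw [eventually_nhdsWithin_iff, Metric.eventually_nhds_iff_ball] at h1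
  obtain ⟨ρ', hρ', h1⟩ := h1
  set q := min ρ ρ' / 2 with hq
  have hqp : 0 < q := by have := lt_min hρ hρ'; positivity
  have hqρ : q < ρ := by have := min_le_left ρ ρ'; have := lt_min hρ hρ'; linarith
  have hqρ' : q < ρ' := by have := min_le_right ρ ρ'; have := lt_min hρ hρ'; linarith
  have hE1 : ∀ s, s ≠ u → ‖s - u‖ ≤ q → 1 < E s := fun s hs hn =>
    h1 s (mem_ball_iff_norm.mpr (by linarith)) hs
  let χ : ContDiffBump u := ⟨q/2, q, by positivity, by linarith⟩
  let I : (ι → ℝ) → ℝ := fun s => if s = u then 0 else (E s)⁻¹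
  let e : (ι → ℝ) → ℝ := fun s => χ s * I s + (1 - χ s)
  have hIu : ContinuousAt I u := by
    have : Tendsto I (𝓝[≠] u) (𝓝 (I u)) := by
      have h2 := tendsto_inv_atTop_zero.comp hu
      simp only [I, if_true]
      refine h2.congr' ?_
      filter_upwards [self_mem_nhdsWithin] with s hs
      simp only [mem_compl_iff, mem_singleton_iff] at hs
      simp [hs]
    exact continuousAt_iff_punctured_nhds.mpr this
  have hIe : ∀ s, s ≠ u → I =ᶠ[𝓝 s] fun s => (E s)⁻¹ := fun s hs => by
    filter_upwards [isOpen_ne.mem_nhds hs] with y hy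
    have : y ≠ u := hy
    simp [I, this]
  have hIs : ∀ s, ‖s - u‖ ≤ q → ContinuousAt I s := fun s hs => by
    by_cases h : s = u
    · rw [h]; exact hIu
    · refine ContinuousAt.congr ?_ (hIe s h).symm
      exact (hE s h).continuousAt.inv₀ (by linarith [hE1 s h hs])
  have hχc : Continuous χ := χ.contDiff (n := 0) |>.continuous
  have hec : Continuous e := by
    rw [continuous_iff_continuousAt]
    intro s
    rcases le_or_gt (‖s - u‖) q with h | h
    · exact (hχc.continuousAt.mul (hIs s h)).add (continuousAt_const.sub hχc.continuousAt)
    · have : e =ᶠ[𝓝 s] fun _ => 1 := by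
        have : {y | q < ‖y - u‖} ∈ 𝓝 s := (isOpen_lt continuous_const (by fun_prop)).mem_nhds h
        filter_upwards [this] with y hy
        have : χ y = 0 := χ.zero_of_le_dist (by rw [dist_eq_norm]; exact le_of_lt hy)
        simp [e, this]
      exact continuousAt_const.congr this.symm
  have heI : ∀ s, ‖s - u‖ ≤ q/2 → e s = I s := fun s hs => by
    have : χ s = 1 := χ.one_of_mem_closedBall (mem_closedBall_iff_norm.mpr hs)
    simp [e, this]
  have hepos : ∀ s, s ≠ u → 0 < e s := by
    intro s hs
    have h0 := χ.nonneg (x := s)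
    have h1 := χ.le_one (x := s)
    rcases le_or_gt (‖s - u‖) q with h | h
    · have : 0 < I s := by simp [I, hs]; linarith [hE1 s hs h]
      rcases h1.eq_or_lt with h2 | h2
      · simp [e, h2, this]
      · have := mul_nonneg h0 this.le; simp only [e]; linarith
    · have : χ s = 0 := χ.zero_of_le_dist (by rw [dist_eq_norm]; exact h.le)
      simp [e, this]
  have hefar : ∀ s, q ≤ ‖s - u‖ → e s = 1 := fun s h => by
    have : χ s = 0 := χ.zero_of_le_dist (by rw [dist_eq_norm]; exact h)
    simp [e, this]
  have hmin : ∀ r > (0:ℝ), ∃ m > 0, ∀ s, r ≤ ‖s - u‖ → m < e s := by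
    intro r hr
    have hc : IsCompact (Metric.closedBall u q ∩ {s | r ≤ ‖s - u‖}) :=
      (isCompact_closedBall u q).inter_right (isClosed_le continuous_const (by fun_prop))
    rcases (Metric.closedBall u q ∩ {s | r ≤ ‖s - u‖}).eq_empty_or_nonempty with h | h
    · refine ⟨1/2, by norm_num, fun s hs => ?_⟩
      rw [hefar s]; norm_num
      by_contra hn
      push Not at hn
      have : s ∈ (∅ : Set (ι → ℝ)) := h ▸ ⟨mem_closedBall_iff_norm.mpr hn.le, hs⟩
      exact this
    · obtain ⟨s0, hs0, hm⟩ := hc.exists_isMinOn h hec.continuousOn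
      have hp : 0 < e s0 := hepos s0 (by rintro rfl; have := hs0.2; simp at this; linarith)
      refine ⟨min (e s0) 1 / 2, by have := lt_min hp one_pos; positivity, fun s hs => ?_⟩
      have := lt_min hp one_pos
      rcases le_or_gt (‖s - u‖) q with h | h
      · have h3 := hm ⟨mem_closedBall_iff_norm.mpr h, hs⟩
        have h4 := min_le_left (e s0) 1
        simp only [mem_ofPred_eq] at h3
        linarith
      · rw [hefar s h.le]; have := min_le_right (e s0) 1; linarith
  obtain ⟨c2, hc2, hc2'⟩ := hmin (q/2) (by positivity)
  have heu : e u = 0 := by rw [heI u (by simp; positivity)]; simp [I]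
  have hnear : ∀ᶠ s in 𝓝 u, e s < c2 := hec.continuousAt.eventually (gt_mem_nhds (by rw [heu]; exact hc2))
  obtain ⟨r', hr', hb⟩ := Metric.eventually_nhds_iff_ball.mp hnear
  set r := min r' (q/2) / 2 with hrdef
  have hrp : 0 < r := by have := lt_min hr' (half_pos hqp); positivity
  have hrr' : r < r' := by have := min_le_left r' (q/2); have := lt_min hr' (half_pos hqp); linarith
  have hrq : r < q/2 := by have := min_le_right r' (q/2); have := lt_min hr' (half_pos hqp); linarith
  obtain ⟨c1, hc1, hc1'⟩ := hmin r hrp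
  have hloc : ∀ s, s ≠ u → ‖s - u‖ < q/2 → e =ᶠ[𝓝 s] fun s => (E s)⁻¹ := fun s hs h => by
    have : {y | ‖y - u‖ < q/2} ∈ 𝓝 s := (isOpen_lt (by fun_prop) continuous_const).mem_nhds h
    filter_upwards [hIe s hs, this] with y h1 h2
    rw [heI y (le_of_lt h2), h1]
  have hgr : ∀ s, s ≠ u → ‖s - u‖ < q/2 → grad e s = -(E s ^ 2)⁻¹ • grad E s := fun s hs h => by
    rw [grad_congr (hloc s hs h)]
    ext i
    unfold grad
    have h3 := ((hE s hs).differentiableAt (by norm_num)).hasFDerivAt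
    have h4 := (hasDerivAt_inv (by linarith [hE1 s hs (by linarith)] : E s ≠ 0)).comp_hasFDerivAt s h3
    have h5 : (Inv.inv ∘ E) = fun s => (E s)⁻¹ := rfl
    rw [h5] at h4
    rw [h4.fderiv]; simp
  have hflow := flow_hpt e hec (c1/2) c1 c2 (by linarith) ?_ ?_ u r ?_ ?_
  · refine ⟨r, hrp, by linarith, ?_⟩
    obtain ⟨H, hc, hn, h0, h1⟩ := hflow
    have hneg : Hpt (Metric.sphere u r) (fun s => - grad e s) (fun s => -(s - u)) :=
      ⟨fun p => - H p, hc.neg, fun t x hx => neg_ne_zero.mpr (hn t x hx), fun x hx => by simp [h0 x hx], fun x hx => by simp [h1 x hx]⟩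
    refine Hpt.trans ?_ hneg
    have hsu : ∀ s ∈ Metric.sphere u r, s ≠ u ∧ ‖s - u‖ < q/2 := fun s hs => by
      rw [mem_sphere_iff_norm] at hs
      refine ⟨?_, by linarith⟩
      rintro rfl; simp at hs; linarith
    have hcE : ContinuousOn (fun p : ℝ × (ι → ℝ) => E p.2) (Icc 0 1 ×ˢ Metric.sphere u r) := by
      have : ContinuousOn E (Metric.sphere u r) := fun s hs => (hE s (hsu s hs).1).continuousAt.continuousWithinAt
      exact this.comp continuousOn_snd fun p hp => hp.2
    have hcg : ContinuousOn (fun p : ℝ × (ι → ℝ) => grad E p.2) (Icc 0 1 ×ˢ Metric.sphere u r) := by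
      have : ContinuousOn (grad E) (Metric.sphere u r) := fun s hs => (grad_contAt E s (hE s (hsu s hs).1)).continuousWithinAt
      exact this.comp continuousOn_snd fun p hp => hp.2
    have hEp : ∀ s ∈ Metric.sphere u r, 1 < E s := fun s hs => hE1 s (hsu s hs).1 (by linarith [(hsu s hs).2])
    refine Hpt.of_Icc (fun t s => ((1 - t) + t * (E s ^ 2)⁻¹) • grad E s) ?_ ?_ (fun s _ => by simp) ?_
    · refine ContinuousOn.smul (ContinuousOn.add (by fun_prop) (ContinuousOn.mul (by fun_prop) (ContinuousOn.inv₀ (hcE.pow 2) ?_))) hcg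
      intro p hp
      have := hEp _ hp.2
      exact (pow_pos (by linarith) 2).ne'
    · intro t ht s hs
      refine smul_ne_zero ?_ (hg s (hsu s hs).1 (by linarith [(hsu s hs).2]))
      have h2 : 0 < (E s ^ 2)⁻¹ := by have := hEp s hs; positivity
      rcases ht.2.eq_or_lt with h | h
      · rw [h]; simpa using h2.ne'
      · have := mul_nonneg ht.1 h2.le; intro h0; linarith
    · intro s hs
      rw [hgr s (hsu s hs).1 (hsu s hs).2]; simp
  · refine (isCompact_closedBall u q).of_isClosed_subset (isClosed_le hec continuous_const) fun s hs => ?_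
    by_contra hn
    rw [mem_closedBall_iff_norm] at hn
    have := hc2' s (by linarith)
    simp only [mem_ofPred_eq] at hs
    linarith
  · intro s h0 h2
    have hsu : s ≠ u := by rintro rfl; rw [heu] at h0; linarith
    have hsq : ‖s - u‖ < q/2 := by
      by_contra hn; push Not at hn; linarith [hc2' s hn]
    have hp := hE1 s hsu (by linarith)
    refine ⟨((hE s hsu).inv (by linarith)).congr_of_eventuallyEq (hloc s hsu hsq), ?_⟩
    rw [hgr s hsu hsq]
    exact smul_ne_zero (neg_ne_zero.mpr (by positivity)) (hg s hsu (by linarith))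
  · intro s hs
    rw [mem_sphere_iff_norm] at hs
    exact ⟨hc1' s hs.ge, (hb s (mem_ball_iff_norm.mpr (by linarith))).le⟩
  · intro s hs
    rw [mem_ball_iff_norm]
    by_contra hn; push Not at hn; linarith [hc1' s hn]

theorem GD2 (E : (ι → ℝ) → ℝ) (u : ι → ℝ) (hE : ∀ s, s ≠ u → ContDiffAt ℝ 2 E s)
    (hco : Tendsto E (cocompact _) atTop) (hu : Tendsto E (𝓝[≠] u) atTop)
    (Z : Finset (ι → ℝ)) (huZ : u ∉ Z) (hZ : ∀ s, s ≠ u → (grad E s = 0 ↔ s ∈ Z))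
    (hd : ∀ z ∈ Z, (fderiv ℝ (grad E) z).det ≠ 0) :
    Even Z.card := by
  obtain ⟨ρ, hρ, hρZ⟩ : ∃ ρ > (0:ℝ), ∀ z ∈ Z, ρ ≤ ‖z - u‖ := by
    have : (Z : Set (ι → ℝ))ᶜ ∈ 𝓝 u := Z.finite_toSet.isClosed.isOpen_compl.mem_nhds huZ
    obtain ⟨ρ, hρ, h⟩ := Metric.mem_nhds_iff.mp this
    refine ⟨ρ, hρ, fun z hz => ?_⟩
    by_contra hn
    exact h (mem_ball_iff_norm.mpr (not_le.mp hn)) hz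
  have hE1 : ∀ s, s ≠ u → ContDiffAt ℝ 1 E s := fun s hs => (hE s hs).of_le (by norm_num)
  obtain ⟨r, hr, hrρ, H, hHc, hHn, hH0, hH1⟩ := flow_in E u ρ hρ hE1 hu (fun s hs h h0 => by
    have := hρZ s ((hZ s hs).mp h0); linarith)
  -- outer
  obtain ⟨R, hRr, hRp, hZR, hout⟩ : ∃ R > r, 0 < R ∧ (∀ z ∈ Z, ‖z - u‖ < R) ∧
      Hpt (Metric.sphere u R) (grad E) (fun s => s - u) := by
    obtain ⟨R0, hR0⟩ := Z.finite_toSet.isBounded.subset_closedBall u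
    let χ : ContDiffBump u := ⟨r/2, r, by positivity, by linarith⟩
    let e : (ι → ℝ) → ℝ := fun s => (1 - χ s) * E s
    have hfar : ∀ s, r < ‖s - u‖ → e =ᶠ[𝓝 s] E := fun s hs => by
      have : {y | r < ‖y - u‖} ∈ 𝓝 s := (isOpen_lt continuous_const (by fun_prop)).mem_nhds hs
      filter_upwards [this] with y hy
      have : χ y = 0 := χ.zero_of_le_dist (by rw [dist_eq_norm]; exact le_of_lt hy)
      simp [e, this]
    have hec : ContDiff ℝ 1 e := by
      rw [contDiff_iff_contDiffAt]
      intro s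
      by_cases hs : s = u
      · have : e =ᶠ[𝓝 s] fun _ => 0 := by
          rw [hs]
          filter_upwards [Metric.ball_mem_nhds u (show 0 < r/2 by positivity)] with y hy
          have : χ y = 1 := χ.one_of_mem_closedBall (Metric.ball_subset_closedBall hy)
          simp [e, this]
        exact contDiffAt_const.congr_of_eventuallyEq this
      · exact (contDiffAt_const.sub χ.contDiffAt).mul (hE1 s hs)
    have heco : Tendsto e (cocompact _) atTop := by
      refine hco.congr' ?_
      have : (Metric.closedBall u r)ᶜ ∈ cocompact (ι → ℝ) := (isCompact_closedBall u r).compl_mem_cocompact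
      filter_upwards [this] with s hs
      have hs : r < ‖s - u‖ := by rw [mem_compl_iff, mem_closedBall_iff_norm] at hs; linarith
      exact (hfar s hs).eq_of_nhds.symm
    obtain ⟨R, hR, hRp, hh⟩ := flow_out e hec heco u (max R0 r + 1) (fun s hs h0 => by
      have h1 := le_max_left R0 r
      have h2 := le_max_right R0 r
      rw [grad_congr (hfar s (by linarith))] at h0
      have hsu : s ≠ u := by rintro rfl; simp at hs; linarith
      have := hR0 ((hZ s hsu).mp h0)
      rw [mem_closedBall_iff_norm] at this
      linarith)
    have h1 := le_max_left R0 r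
    have h2 := le_max_right R0 r
    refine ⟨R, by linarith, hRp, fun z hz => ?_, ?_⟩
    · have := hR0 hz
      rw [mem_closedBall_iff_norm] at this
      linarith
    · obtain ⟨H, hc, hn, h0, h1⟩ := hh
      refine ⟨H, hc, hn, fun s hs => ?_, h1⟩
      rw [h0 s hs]
      exact grad_congr (hfar s (by rw [mem_sphere_iff_norm] at hs; linarith))
  -- glue
  let φ : (ι → ℝ) → (ι → ℝ) := fun s => (‖s - u‖ / r) • H (min 1 (2 * (1 - ‖s - u‖ / r)), u + (r / ‖s - u‖) • (s - u))
  let f : (ι → ℝ) → (ι → ℝ) := fun s => if r ≤ ‖s - u‖ then grad E s else φ s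
  have hproj : ∀ s, s ≠ u → u + (r / ‖s - u‖) • (s - u) ∈ Metric.sphere u r := fun s hs => by
    have : 0 < ‖s - u‖ := norm_pos_iff.mpr (sub_ne_zero.mpr hs)
    simp [norm_smul, abs_of_pos hr, this.ne']
  have hφin : ∀ s, ‖s - u‖ ≤ r/2 → φ s = -(s - u) := fun s hs => by
    by_cases h : s = u
    · simp [φ, h]
    · have hp : 0 < ‖s - u‖ := norm_pos_iff.mpr (sub_ne_zero.mpr h)
      have h1 : ‖s - u‖ / r ≤ 1/2 := by rw [div_le_iff₀ hr]; linarith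
      simp only [φ]
      rw [min_eq_left (by linarith), hH1 _ (hproj s h)]
      show (‖s - u‖ / r) • (-(u + (r / ‖s - u‖) • (s - u) - u)) = _
      rw [add_sub_cancel_left, smul_neg, smul_smul]
      rw [show ‖s - u‖ / r * (r / ‖s - u‖) = 1 by field_simp]
      simp
  have hφs : ∀ s, ‖s - u‖ = r → φ s = grad E s := fun s hs => by
    have h : s ≠ u := by rintro rfl; simp at hs; linarith
    have h2 : u + (r / ‖s - u‖) • (s - u) = s := by rw [hs, div_self hr.ne']; simp
    simp only [φ]
    rw [h2, hs, div_self hr.ne']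
    simp [hH0 s (mem_sphere_iff_norm.mpr hs)]
  have hφn : ∀ s, s ≠ u → φ s ≠ 0 := fun s h => by
    have hp : 0 < ‖s - u‖ := norm_pos_iff.mpr (sub_ne_zero.mpr h)
    exact smul_ne_zero (by positivity) (hHn _ _ (hproj s h))
  have hφc : ContinuousOn φ (Metric.closedBall u r) := by
    intro s _
    by_cases h : s = u
    · have : φ =ᶠ[𝓝 s] fun s => -(s - u) := by
        rw [h]
        filter_upwards [Metric.ball_mem_nhds u (show 0 < r/2 by positivity)] with y hy
        exact hφin y (mem_ball_iff_norm.mp hy).le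
      have h2 : ContinuousAt (fun s => -(s - u)) s := by fun_prop
      exact (h2.congr this.symm).continuousWithinAt
    · have hp : ‖s - u‖ ≠ 0 := (norm_pos_iff.mpr (sub_ne_zero.mpr h)).ne'
      have : ContinuousOn φ {u}ᶜ := by
        have hpc : ContinuousOn (fun s => (min 1 (2 * (1 - ‖s - u‖ / r)), u + (r / ‖s - u‖) • (s - u))) {u}ᶜ := ?_
        · have h3 : ContinuousOn (fun s => ‖s - u‖ / r) {u}ᶜ := by fun_prop
          exact h3.smul (hHc.comp hpc fun y hy => ⟨mem_univ _, hproj y hy⟩)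
        have h4 : ContinuousOn (fun s => r / ‖s - u‖) {u}ᶜ := by
          refine ContinuousOn.div (by fun_prop) (by fun_prop) ?_
          intro y hy
          exact (norm_pos_iff.mpr (sub_ne_zero.mpr hy)).ne'
        have h5 : ContinuousOn (fun s => s - u) {u}ᶜ := by fun_prop
        have h6 : ContinuousOn (fun s => min 1 (2 * (1 - ‖s - u‖ / r))) {u}ᶜ := by fun_prop
        exact h6.prodMk (continuousOn_const.add (h4.smul h5))
      exact (this.continuousAt (isOpen_compl_singleton.mem_nhds h)).continuousWithinAt
  have hfin : ∀ s, ‖s - u‖ ≤ r → f s = φ s := fun s hs => by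
    rcases hs.eq_or_lt with h | h
    · simp [f, h, hφs s h]
    · simp [f, h]
  have hfc : Continuous f := by
    have h1 : ContinuousOn f (Metric.closedBall u r) := hφc.congr fun s hs => hfin s (mem_closedBall_iff_norm.mp hs)
    have h2 : ContinuousOn f {s | r ≤ ‖s - u‖} := by
      have : ContinuousOn (grad E) {s | r ≤ ‖s - u‖} := fun s hs => by
        have : s ≠ u := by rintro rfl; simp at hs; linarith
        exact (grad_contAt E s (hE1 s this)).continuousWithinAt
      exact this.congr fun s hs => by simp only [mem_ofPred_eq] at hs; simp [f, hs]
    have h3 := h1.union_of_isClosed h2 Metric.isClosed_closedBall (isClosed_le continuous_const (by fun_prop))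
    rw [← continuousOn_univ]
    convert h3 using 1
    symm
    rw [eq_univ_iff_forall]
    intro s
    rcases le_total (‖s - u‖) r with h | h
    · left; exact mem_closedBall_iff_norm.mpr h
    · right; exact h
  have hfout : ∀ s, r < ‖s - u‖ → f =ᶠ[𝓝 s] grad E := fun s hs => by
    have : {y | r < ‖y - u‖} ∈ 𝓝 s := (isOpen_lt continuous_const (by fun_prop)).mem_nhds hs
    filter_upwards [this] with y hy
    have hy : r < ‖y - u‖ := hy
    simp [f, hy.le]
  have hfu : f =ᶠ[𝓝 u] fun s => -(s - u) := by
    filter_upwards [Metric.ball_mem_nhds u (show 0 < r/2 by positivity)] with y hy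
    rw [mem_ball_iff_norm] at hy
    rw [hfin y (by linarith), hφin y hy.le]
  have hfZ : ∀ z ∈ Z, f =ᶠ[𝓝 z] grad E := fun z hz => hfout z (by linarith [hρZ z hz])
  have hfuD : fderiv ℝ f u = -(ContinuousLinearMap.id ℝ (ι → ℝ)) := by
    rw [hfu.fderiv_eq]
    have h1 : HasFDerivAt (fun s : ι → ℝ => -(s - u)) (-(ContinuousLinearMap.id ℝ (ι → ℝ))) u :=
      ((hasFDerivAt_id u).sub_const u).neg
    exact h1.fderiv
  have hdu : (fderiv ℝ f u).det ≠ 0 := by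
    rw [hfuD]
    have : (-(ContinuousLinearMap.id ℝ (ι → ℝ))).det = (-1)^(Fintype.card ι) := by
      have h1 : (-(ContinuousLinearMap.id ℝ (ι → ℝ))).det = LinearMap.det ((-1:ℝ) • (LinearMap.id : (ι → ℝ) →ₗ[ℝ] (ι → ℝ))) := by
        unfold ContinuousLinearMap.det; congr 1; ext; simp
      rw [h1, LinearMap.det_smul]; simp
    rw [this]
    exact pow_ne_zero _ (by norm_num)
  have key := deg_ball f u R hRp hfc.continuousOn ?_ (insert u Z) ?_ ?_ ?_ ?_
  · have hsg : ∀ z ∈ insert u Z, ∃ k : ℤ, Real.sign (fderiv ℝ f z).det = ((2 * k + 1 : ℤ) : ℝ) := by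
      intro z hz
      rcases Real.sign_apply_eq (fderiv ℝ f z).det with h | h | h
      · exact ⟨-1, by rw [h]; norm_num⟩
      · exfalso
        rw [Real.sign_eq_zero_iff] at h
        rw [Finset.mem_insert] at hz
        rcases hz with rfl | hz
        · exact hdu h
        · rw [(hfZ z hz).fderiv_eq] at h; exact hd z hz h
      · exact ⟨0, by rw [h]; norm_num⟩
    choose! k hk using hsg
    rw [Finset.sum_congr rfl hk, ← Int.cast_sum, Finset.sum_add_distrib] at key
    have key' : ∑ i ∈ insert u Z, 2 * k i + ∑ i ∈ insert u Z, (1:ℤ) = 1 := by exact_mod_cast key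
    rw [← Finset.mul_sum, Finset.sum_const, Finset.card_insert_of_notMem huZ] at key'
    rw [← Int.even_coe_nat]
    refine ⟨-∑ i ∈ insert u Z, k i, ?_⟩
    simp at key'
    linarith
  · obtain ⟨H', hc, hn, h0, h1⟩ := hout
    refine ⟨H', hc, hn, fun s hs => ?_, h1⟩
    rw [h0 s hs]
    rw [mem_sphere_iff_norm] at hs
    exact (hfout s (by linarith)).eq_of_nhds.symm
  · intro s _
    rw [Finset.mem_insert]
    by_cases h : s = u
    · simp [h, hfu.eq_of_nhds]
    · simp only [h, false_or]
      rcases le_or_gt (‖s - u‖) r with h1 | h1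
      · rw [hfin s h1]
        refine ⟨fun h0 => absurd h0 (hφn s h), fun hz => ?_⟩
        linarith [hρZ s hz]
      · rw [(hfout s h1).eq_of_nhds]; exact hZ s h
  · intro z hz
    rw [Finset.mem_insert] at hz
    rw [mem_closedBall_iff_norm]
    rcases hz with rfl | hz
    · simp [hRp.le]
    · exact (hZR z hz).le
  · intro z hz
    rw [Finset.mem_insert] at hz
    rcases hz with rfl | hz
    · have : ContDiffAt ℝ 1 (fun s => -(s - z)) z := by fun_prop
      exact this.congr_of_eventuallyEq hfu
    · exact (grad_contDiffAt E z (hE z (by rintro rfl; exact huZ hz))).congr_of_eventuallyEq (hfZ z hz)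
  · intro z hz
    rw [Finset.mem_insert] at hz
    rcases hz with rfl | hz
    · exact hdu
    · rw [(hfZ z hz).fderiv_eq]; exact hd z hz
end gd
end partB2

section partC1
open scoped TensorProduct

section real_etale

theorem fibre_parity (B : Type) [CommRing B] [Algebra ℝ B] [Algebra.EssFiniteType ℝ B] [Algebra.FormallyUnramified ℝ B] :
    Finite (B →ₐ[ℝ] ℝ) ∧ Nat.card (B →ₐ[ℝ] ℝ) ≡ Module.finrank ℝ B [MOD 2] := by
  classical
  obtain ⟨I, hI, Ai, hf, ha, e, hs⟩ := (Algebra.FormallyEtale.iff_exists_algEquiv_prod ℝ B).mp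
    (Algebra.FormallyEtale.of_formallyUnramified_of_field ℝ B)
  have hfin : Module.Finite ℝ B := Algebra.FormallyUnramified.finite_of_free ℝ B
  have hfini : ∀ i, Module.Finite ℝ (Ai i) := fun i =>
    .of_surjective ((LinearMap.proj i).comp e.toLinearMap) ((Function.surjective_eval i).comp e.surjective)
  letI := Fintype.ofFinite I
  let J := {i : I // Nonempty (Ai i ≃ₐ[ℝ] ℝ)}
  have hnoC : ∀ i, Nonempty (Ai i →ₐ[ℝ] ℝ) → Nonempty (Ai i ≃ₐ[ℝ] ℝ) := by
    rintro i ⟨g⟩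
    rcases Real.nonempty_algEquiv_or (Ai i) with h | ⟨⟨c⟩⟩
    · exact h
    · exfalso
      have h1 : (g (c.symm Complex.I)) * (g (c.symm Complex.I)) = -1 := by
        rw [← map_mul, ← map_mul, Complex.I_mul_I]; simp
      nlinarith [mul_self_nonneg (g (c.symm Complex.I))]
  let T : J → (B →ₐ[ℝ] ℝ) := fun i => (i.2.some.toAlgHom.comp (Pi.evalAlgHom ℝ Ai i.1)).comp e.toAlgHom
  have hT : ∀ (i : J) (b : B), T i b = i.2.some (e b i.1) := fun i b => rfl
  have hinj : Function.Injective T := by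
    intro i j hij
    by_contra hne
    have h1 := congrArg (fun f => f (e.symm (Pi.single i.1 1))) hij
    simp only [hT, AlgEquiv.apply_symm_apply, Pi.single_eq_same, map_one] at h1
    rw [Pi.single_eq_of_ne (fun h => hne (Subtype.ext h.symm)), map_zero] at h1
    exact one_ne_zero h1
  have hsurj : Function.Surjective T := by
    intro ψ
    let φ : (Π i, Ai i) →ₐ[ℝ] ℝ := ψ.comp e.symm.toAlgHom
    have hsum : ∑ i, φ (Pi.single i 1) = 1 := by
      rw [← map_sum, Finset.univ_sum_single (fun i => (1 : Ai i))]
      exact map_one φ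
    obtain ⟨i, hi⟩ : ∃ i, φ (Pi.single i 1) ≠ 0 := by
      by_contra h
      push Not at h
      simp [h] at hsum
    have hone : φ (Pi.single i 1) = 1 := by
      have : φ (Pi.single i 1) * φ (Pi.single i 1) = φ (Pi.single i 1) := by
        rw [← map_mul, ← Pi.single_mul, one_mul]
      exact mul_left_cancel₀ hi (by rw [this, mul_one])
    let g : Ai i →ₐ[ℝ] ℝ := AlgHom.ofLinearMap (φ.toLinearMap.comp (LinearMap.single ℝ Ai i)) hone (by
      intro x y
      simp only [LinearMap.comp_apply, LinearMap.single_apply, AlgHom.toLinearMap_apply]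
      rw [← map_mul, ← Pi.single_mul])
    have hJ := hnoC i ⟨g⟩
    refine ⟨⟨i, hJ⟩, ?_⟩
    ext b
    rw [hT]
    have h1 : ψ b = φ (e b) := by simp [φ]
    have h2 : φ (e b) = g (e b i) := by
      have : φ (e b) = φ (e b) * φ (Pi.single i 1) := by rw [hone, mul_one]
      rw [this, ← map_mul]
      show _ = φ (Pi.single i (e b i))
      congr 1
      ext j
      by_cases h : j = i
      · subst h; simp
      · simp [h]
    have h3 : g.comp hJ.some.symm.toAlgHom = AlgHom.id ℝ ℝ := Subsingleton.elim _ _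
    have h4 : g (hJ.some.symm (hJ.some (e b i))) = hJ.some (e b i) := congrArg (fun f => f (hJ.some (e b i))) h3
    rw [AlgEquiv.symm_apply_apply] at h4
    rw [h1, h2]
    exact h4.symm
  have eq := Equiv.ofBijective T ⟨hinj, hsurj⟩
  refine ⟨Finite.of_equiv _ eq, ?_⟩
  rw [← Nat.card_congr eq, e.toLinearEquiv.finrank_eq, Module.finrank_pi_fintype]
  have hr : ∀ i, Module.finrank ℝ (Ai i) ≡ (if Nonempty (Ai i ≃ₐ[ℝ] ℝ) then 1 else 0) [MOD 2] := by
    intro i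
    split_ifs with h
    · rw [h.some.toLinearEquiv.finrank_eq]; simp; rfl
    · rcases Real.nonempty_algEquiv_or (Ai i) with h' | ⟨⟨c⟩⟩
      · exact absurd h' h
      · rw [c.toLinearEquiv.finrank_eq, Complex.finrank_real_complex]; rfl
  have hsum : ∑ i, Module.finrank ℝ (Ai i) ≡ ∑ i, (if Nonempty (Ai i ≃ₐ[ℝ] ℝ) then 1 else 0) [MOD 2] := by
    induction (Finset.univ : Finset I) using Finset.induction_on with
    | empty => rfl
    | insert a s ha ih => rw [Finset.sum_insert ha, Finset.sum_insert ha]; exact (hr a).add ih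
  refine Nat.ModEq.symm (hsum.trans ?_)
  rw [Finset.sum_boole, Nat.card_eq_fintype_card, Fintype.card_subtype]
  rfl
end real_etale
end partC1

section partC2
open scoped TensorProduct

section gen
variable (R A : Type) [CommRing R] [IsDomain R] [CommRing A] [Algebra R A]
  [Algebra.FiniteType R A] [Algebra.FormallyUnramified R A]

/-- every element is algebraic -/
theorem gen_alg (a : A) : ∃ Q : Polynomial R, Q ≠ 0 ∧ Polynomial.aeval a Q = 0 := by
  have : Module.Finite (FractionRing R) (FractionRing R ⊗[R] A) :=
    Algebra.FormallyUnramified.finite_of_free _ _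
  have hint : IsAlgebraic (FractionRing R) ((1 : FractionRing R) ⊗ₜ[R] a) :=
    (Algebra.IsIntegral.isIntegral (R := FractionRing R) ((1 : FractionRing R) ⊗ₜ[R] a)).isAlgebraic
  have hR : IsAlgebraic R ((1 : FractionRing R) ⊗ₜ[R] a) :=
    (IsFractionRing.isAlgebraic_iff R (FractionRing R) (FractionRing R ⊗[R] A)).mpr hint
  obtain ⟨Q, hQ, h0⟩ := hR
  have h1 : (1 : FractionRing R) ⊗ₜ[R] a = (Algebra.TensorProduct.includeRight (R := R) (A := FractionRing R) : A →ₐ[R] _) a := rfl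
  rw [h1, Polynomial.aeval_algHom_apply] at h0
  have hloc : IsLocalizedModule (nonZeroDivisors R) ((TensorProduct.mk R (FractionRing R) A) 1) := inferInstance
  have h2 : (TensorProduct.mk R (FractionRing R) A 1) (Polynomial.aeval a Q) = 0 := h0
  obtain ⟨c, hc⟩ := (IsLocalizedModule.eq_zero_iff (nonZeroDivisors R) _).mp h2
  refine ⟨Polynomial.C c.1 * Q, mul_ne_zero (by simpa using nonZeroDivisors.ne_zero c.2) hQ, ?_⟩
  rw [map_mul, Polynomial.aeval_C, ← Algebra.smul_def]
  exact hc

theorem gen_finite : ∃ h : R, h ≠ 0 ∧ Module.Finite (Localization.Away h) (Localization.Away h ⊗[R] A) := by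
  classical
  obtain ⟨S, hS⟩ := ‹Algebra.FiniteType R A›.out
  choose Q hQ0 hQ using gen_alg R A
  refine ⟨∏ a ∈ S, (Q a).leadingCoeff, Finset.prod_ne_zero_iff.mpr fun a _ => Polynomial.leadingCoeff_ne_zero.mpr (hQ0 a), ?_⟩
  set h := ∏ a ∈ S, (Q a).leadingCoeff
  have hu : ∀ a ∈ S, IsUnit (algebraMap R (Localization.Away h) (Q a).leadingCoeff) := fun a ha => by
    have h1 : IsUnit (algebraMap R (Localization.Away h) h) := IsLocalization.Away.algebraMap_isUnit (S := Localization.Away h) h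
    have h2 : (Q a).leadingCoeff ∣ h := Finset.dvd_prod_of_mem (fun a => (Q a).leadingCoeff) ha
    exact isUnit_of_dvd_unit (map_dvd _ h2) h1
  have hint : ∀ a ∈ S, IsIntegral (Localization.Away h) ((1 : Localization.Away h) ⊗ₜ[R] a) := by
    intro a ha
    set P := (Q a).map (algebraMap R (Localization.Away h)) with hP
    have h1 : (1 : Localization.Away h) ⊗ₜ[R] a = (Algebra.TensorProduct.includeRight (R := R) (A := Localization.Away h) : A →ₐ[R] _) a := rfl
    have h0 : Polynomial.aeval ((1 : Localization.Away h) ⊗ₜ[R] a) P = 0 := by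
      rw [hP, Polynomial.aeval_map_algebraMap, h1, Polynomial.aeval_algHom_apply, hQ, map_zero]
    obtain ⟨v, hv⟩ := hu a ha
    by_cases hA : Nontrivial (Localization.Away h)
    · have hlc : P.leadingCoeff = v := by
        rw [hP, Polynomial.leadingCoeff_map_of_leadingCoeff_ne_zero]
        · exact hv.symm
        · rw [← hv]; exact v.ne_zero
      refine ⟨Polynomial.C ((v⁻¹ : (Localization.Away h)ˣ) : Localization.Away h) * P, ?_, ?_⟩
      · apply Polynomial.monic_C_mul_of_mul_leadingCoeff_eq_one
        rw [hlc]; simp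
      · rw [← Polynomial.aeval_def, map_mul, h0, mul_zero]
    · rw [not_nontrivial_iff_subsingleton] at hA
      exact ⟨1, Polynomial.monic_one, by
        have : Subsingleton (Localization.Away h ⊗[R] A) := Module.subsingleton (Localization.Away h) _
        exact Subsingleton.elim _ _⟩
  have hall : ∀ a : A, IsIntegral (Localization.Away h) ((1 : Localization.Away h) ⊗ₜ[R] a) := by
    intro a
    have ha : a ∈ Algebra.adjoin R (S : Set A) := by rw [hS]; trivial
    induction ha using Algebra.adjoin_induction with
    | mem x hx => exact hint x hx
    | algebraMap r =>
      have : (1 : Localization.Away h) ⊗ₜ[R] (algebraMap R A r) = algebraMap (Localization.Away h) _ (algebraMap R _ r) := by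
        rw [Algebra.TensorProduct.algebraMap_apply, Algebra.algebraMap_eq_smul_one r, TensorProduct.tmul_smul,
          TensorProduct.smul_tmul', Algebra.smul_def, mul_one]
        rfl
      rw [this]; exact isIntegral_algebraMap
    | add x y _ _ hx hy => rw [TensorProduct.tmul_add]; exact hx.add hy
    | mul x y _ _ hx hy =>
      have := hx.mul hy
      rwa [Algebra.TensorProduct.tmul_mul_tmul, one_mul] at this
  have : Algebra.IsIntegral (Localization.Away h) (Localization.Away h ⊗[R] A) := by
    constructor
    intro x
    induction x using TensorProduct.induction_on with
    | zero => exact isIntegral_zero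
    | tmul r a =>
      have : r ⊗ₜ[R] a = r • ((1 : Localization.Away h) ⊗ₜ[R] a) := by
        rw [TensorProduct.smul_tmul', smul_eq_mul, mul_one]
      rw [this]; exact (hall a).smul r
    | add x y hx hy => exact hx.add hy
  exact Algebra.IsIntegral.finite

theorem mod_free (R M : Type) [CommRing R] [IsDomain R] [IsNoetherianRing R] [AddCommGroup M] [Module R M] [Module.Finite R M] :
    ∃ r : R, r ≠ 0 ∧ ∃ D : ℕ, ∀ (k : Type) [Field k] [Algebra R k],
    algebraMap R k r ≠ 0 → Module.finrank k (k ⊗[R] M) = D := by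
  have : Module.FinitePresentation R M := Module.finitePresentation_of_finite _ _
  obtain ⟨r, hr, hfree, hrank⟩ := Module.FinitePresentation.exists_free_localizedModule_powers (R := R) (M := M)
    (nonZeroDivisors R) (LocalizedModule.mkLinearMap (nonZeroDivisors R) M) (FractionRing R)
  refine ⟨r, nonZeroDivisors.ne_zero hr, Module.finrank (FractionRing R) (LocalizedModule (nonZeroDivisors R) M), ?_⟩
  intro k _ _ hkr
  let g := IsLocalization.Away.lift (S := Localization (Submonoid.powers r)) r (g := algebraMap R k) (isUnit_iff_ne_zero.mpr hkr)
  letI : Algebra (Localization (Submonoid.powers r)) k := g.toAlgebra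
  have st2 : IsScalarTower R (Localization (Submonoid.powers r)) k := IsScalarTower.of_algebraMap_eq fun x => (IsLocalization.Away.lift_eq (S := Localization (Submonoid.powers r)) r (isUnit_iff_ne_zero.mpr hkr) x).symm
  have e2 : k ⊗[R] M ≃ₗ[k] k ⊗[Localization (Submonoid.powers r)] (Localization (Submonoid.powers r) ⊗[R] M) := (TensorProduct.AlgebraTensorModule.cancelBaseChange R (Localization (Submonoid.powers r)) k k M).symm
  have e3 : LocalizedModule.Away r M ≃ₗ[Localization (Submonoid.powers r)] (Localization (Submonoid.powers r) ⊗[R] M) := LocalizedModule.equivTensorProduct _ _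
  have : Module.Free (Localization (Submonoid.powers r)) (Localization (Submonoid.powers r) ⊗[R] M) := Module.Free.of_equiv e3
  have : IsDomain (Localization (Submonoid.powers r)) := IsLocalization.isDomain_localization (powers_le_nonZeroDivisors_of_noZeroDivisors (nonZeroDivisors.ne_zero hr))
  rw [e2.finrank_eq, Module.finrank_baseChange, ← e3.finrank_eq, hrank]

theorem gen_free [IsNoetherianRing R] : ∃ h : R, h ≠ 0 ∧ ∃ D : ℕ, ∀ (k : Type) [Field k] [Algebra R k],
    algebraMap R k h ≠ 0 → Module.finrank k (k ⊗[R] A) = D := by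
  obtain ⟨h1, hh1, hfin⟩ := gen_finite R A
  have hle : Submonoid.powers h1 ≤ nonZeroDivisors R := powers_le_nonZeroDivisors_of_noZeroDivisors hh1
  have : IsDomain (Localization.Away h1) := IsLocalization.isDomain_localization hle
  have : IsNoetherianRing (Localization.Away h1) := IsLocalization.isNoetherianRing (Submonoid.powers h1) (Localization.Away h1) inferInstance
  obtain ⟨r, hr, D, hD⟩ := mod_free (Localization.Away h1) (Localization.Away h1 ⊗[R] A)
  obtain ⟨⟨r0, c⟩, hrc⟩ := IsLocalization.surj (Submonoid.powers h1) r
  have hr0 : r0 ≠ 0 := by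
    rintro rfl
    simp only [map_zero] at hrc
    exact (mul_ne_zero hr (IsLocalization.map_units (Localization.Away h1) c).ne_zero) hrc
  refine ⟨h1 * r0, mul_ne_zero hh1 hr0, D, ?_⟩
  intro k _ _ hk
  rw [map_mul] at hk
  have hk1 := left_ne_zero_of_mul hk
  have hk0 := right_ne_zero_of_mul hk
  let g := IsLocalization.Away.lift (S := Localization.Away h1) h1 (g := algebraMap R k) (isUnit_iff_ne_zero.mpr hk1)
  letI : Algebra (Localization.Away h1) k := g.toAlgebra
  have st1 : IsScalarTower R (Localization.Away h1) k := IsScalarTower.of_algebraMap_eq fun x => (IsLocalization.Away.lift_eq h1 (isUnit_iff_ne_zero.mpr hk1) x).symm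
  have hkr : algebraMap (Localization.Away h1) k r ≠ 0 := by
    intro h0
    have := congrArg (algebraMap (Localization.Away h1) k) hrc
    rw [map_mul, h0, zero_mul, ← IsScalarTower.algebraMap_apply] at this
    exact hk0 this.symm
  have e1 : k ⊗[R] A ≃ₗ[k] k ⊗[Localization.Away h1] (Localization.Away h1 ⊗[R] A) := (TensorProduct.AlgebraTensorModule.cancelBaseChange R (Localization.Away h1) k k A).symm
  rw [e1.finrank_eq, hD k hkr]
end gen
end partC2

section partC3
open scoped TensorProduct
open Filter Topology

section pl

theorem alg_parity (R A : Type) [CommRing R] [IsDomain R] [IsNoetherianRing R] [CommRing A] [Algebra R A]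
    [Algebra.FiniteType R A] [Algebra.FormallyUnramified R A] :
    ∃ h : R, h ≠ 0 ∧ ∃ D : ℕ, ∀ φ : R →+* ℝ, φ h ≠ 0 →
      {ψ : A →+* ℝ | ψ.comp (algebraMap R A) = φ}.Finite ∧
      {ψ : A →+* ℝ | ψ.comp (algebraMap R A) = φ}.ncard ≡ D [MOD 2] := by
  obtain ⟨h, hh, D, hD⟩ := gen_free R A
  refine ⟨h, hh, D, fun φ hφ => ?_⟩
  let _ : Algebra R ℝ := φ.toAlgebra
  have hD' := hD ℝ hφ
  obtain ⟨hf, hc⟩ := fibre_parity (ℝ ⊗[R] A)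
  rw [hD'] at hc
  let T : (ℝ ⊗[R] A →ₐ[ℝ] ℝ) → {ψ : A →+* ℝ | ψ.comp (algebraMap R A) = φ} := fun f =>
    ⟨((f.restrictScalars R).comp (Algebra.TensorProduct.includeRight (R := R) (A := ℝ) : A →ₐ[R] _)).toRingHom, by
      ext r
      exact ((f.restrictScalars R).comp (Algebra.TensorProduct.includeRight (R := R) (A := ℝ) : A →ₐ[R] _)).commutes r⟩
  have hT : Function.Bijective T := by
    constructor
    · intro f g hfg
      apply Algebra.TensorProduct.ext
      · exact Subsingleton.elim _ _
      · ext a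
        have := congrArg (fun ψ => ψ.1 a) hfg
        exact this
    · rintro ⟨ψ, hψ⟩
      let ψ' : A →ₐ[R] ℝ := { ψ with commutes' := fun r => congrArg (fun g => g r) hψ }
      let L : ℝ ⊗[R] A →ₐ[ℝ] ℝ := Algebra.TensorProduct.lift (AlgHom.id ℝ ℝ) ψ' (fun _ _ => Commute.all _ _)
      refine ⟨L, ?_⟩
      ext a
      have h1 : L ((1:ℝ) ⊗ₜ[R] a) = ψ' a := (Algebra.TensorProduct.lift_tmul _ _ _ _ _).trans (one_mul _)
      exact h1
  let eq := Equiv.ofBijective T hT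
  refine ⟨?_, ?_⟩
  · haveI := Finite.of_equiv _ eq
    exact Set.toFinite _
  · rw [← Nat.card_coe_set_eq, ← Nat.card_congr eq]; exact hc

theorem deriv_aeval {R A ν : Type} [CommRing R] [CommRing A] [Algebra R A] [Fintype ν] (x : ν → A)
    (Q : MvPolynomial ν R) :
    KaehlerDifferential.D R A (MvPolynomial.aeval x Q) =
      ∑ j, MvPolynomial.aeval x (MvPolynomial.pderiv j Q) • KaehlerDifferential.D R A (x j) := by
  classical
  induction Q using MvPolynomial.induction_on with
  | C r => simp
  | add p q hp hq => simp [hp, hq, add_smul, Finset.sum_add_distrib]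
  | mul_X p n hp =>
    simp only [map_mul, MvPolynomial.aeval_X, Derivation.leibniz, hp, map_add, MvPolynomial.pderiv_X, smul_eq_mul,
      add_smul, Finset.sum_add_distrib, Finset.smul_sum, smul_smul]
    congr 1
    rw [Finset.sum_eq_single n]
    · simp
    · intro j _ hj; simp [hj]
    · simp

theorem unram {R A ν : Type} [CommRing R] [CommRing A] [Algebra R A] [Fintype ν] [DecidableEq ν] (x : ν → A) (w : A)
    (P : ν → MvPolynomial ν R) (hP : ∀ i, MvPolynomial.aeval x (P i) = 0)
    (hw : MvPolynomial.aeval x (Matrix.of fun i j => MvPolynomial.pderiv j (P i)).det * w = 1)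
    (hs : Function.Surjective (MvPolynomial.aeval (R := R) (fun o : Option ν => o.elim w x))) :
    Algebra.FormallyUnramified R A := by
  constructor
  have hx : ∀ k, KaehlerDifferential.D R A (x k) = 0 := by
    intro k
    set M : Matrix ν ν A := (Matrix.of fun i j => MvPolynomial.pderiv j (P i)).map (MvPolynomial.aeval x) with hM
    have h1 : ∀ i, ∑ j, M i j • KaehlerDifferential.D R A (x j) = 0 := by
      intro i
      have := deriv_aeval x (P i)
      rw [hP, map_zero] at this
      rw [this]; rfl
    have h2 : ∑ i, M.adjugate k i • ∑ j, M i j • KaehlerDifferential.D R A (x j) = M.det • KaehlerDifferential.D R A (x k) := by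
      simp only [Finset.smul_sum, smul_smul]
      rw [Finset.sum_comm]
      have h3 : ∀ j, ∑ i, M.adjugate k i * M i j = (M.adjugate * M) k j := fun j => rfl
      simp only [← Finset.sum_smul, h3, Matrix.adjugate_mul, Matrix.smul_apply, Matrix.one_apply]
      simp
    simp only [h1, smul_zero, Finset.sum_const_zero] at h2
    have h4 : M.det = MvPolynomial.aeval x (Matrix.of fun i j => MvPolynomial.pderiv j (P i)).det := by
      rw [hM, AlgHom.map_det]; rfl
    have h5 := congrArg (fun v => w • v) h2
    simp only [smul_zero, smul_smul] at h5
    rw [mul_comm, h4, hw, one_smul] at h5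
    exact h5.symm
  have hw0 : KaehlerDifferential.D R A w = 0 := by
    have h1 := congrArg (KaehlerDifferential.D R A) hw
    rw [Derivation.leibniz, deriv_aeval] at h1
    simp only [hx, smul_zero, Finset.sum_const_zero, add_zero, Derivation.map_one_eq_zero] at h1
    have h5 := congrArg (fun v => w • v) h1
    simp only [smul_zero, smul_smul] at h5
    rwa [mul_comm, hw, one_smul] at h5
  have hall : ∀ a, KaehlerDifferential.D R A a = 0 := by
    intro a
    obtain ⟨q, rfl⟩ := hs a
    rw [deriv_aeval]
    refine Finset.sum_eq_zero fun o _ => ?_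
    cases o <;> simp [hx, hw0]
  have hsp := KaehlerDifferential.span_range_derivation R A
  have hr : Set.range (KaehlerDifferential.D R A) ⊆ {0} := by
    rintro _ ⟨a, rfl⟩; exact hall a
  have h0 : Submodule.span A (Set.range (KaehlerDifferential.D R A)) ≤ ⊥ := Submodule.span_le.2 hr
  rw [hsp] at h0
  refine subsingleton_of_forall_eq 0 fun v => ?_
  exact h0 (Submodule.mem_top (x := v))
end pl
end partC3

section partC4
open scoped TensorProduct
open Filter Topology

section pl2
variable {ι ν : Type} [Fintype ι] [Fintype ν] [DecidableEq ι] [DecidableEq ν]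

theorem root_bound (Q : Polynomial (MvPolynomial ι ℝ)) (p : ι → ℝ)
    (hp : MvPolynomial.eval p Q.leadingCoeff ≠ 0) :
    ∃ C : ℝ, ∀ᶠ p' in 𝓝 p, ∀ t : ℝ, (Q.map (MvPolynomial.eval p')).eval t = 0 → |t| ≤ C := by
  set d := Q.natDegree with hd
  set B : (ι → ℝ) → ℝ := fun p' => 1 + (∑ i ∈ Finset.range d, |MvPolynomial.eval p' (Q.coeff i)|) /
    |MvPolynomial.eval p' Q.leadingCoeff| with hB
  have hlc : ContinuousAt (fun p' => MvPolynomial.eval p' Q.leadingCoeff) p :=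
    (MvPolynomial.continuous_eval _).continuousAt
  have hBc : ContinuousAt B p := by
    refine continuousAt_const.add (ContinuousAt.div ?_ hlc.abs (abs_ne_zero.2 hp))
    refine tendsto_finsetSum _ fun i _ => ?_
    exact ((MvPolynomial.continuous_eval (Q.coeff i)).continuousAt (x := p)).abs
  refine ⟨B p + 1, ?_⟩
  filter_upwards [hBc.eventually (gt_mem_nhds (lt_add_one (B p))), hlc.eventually_ne hp] with p' h1 h2 t ht
  refine le_trans ?_ h1.le
  by_contra hcon
  push Not at hcon
  have hS : 0 ≤ ∑ i ∈ Finset.range d, |MvPolynomial.eval p' (Q.coeff i)| := Finset.sum_nonneg fun i _ => abs_nonneg _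
  have hl : 0 < |MvPolynomial.eval p' Q.leadingCoeff| := abs_pos.2 h2
  have ht1 : 1 < |t| := lt_of_le_of_lt (by simp only [hB]; have := div_nonneg hS hl.le; linarith) hcon
  rw [Polynomial.eval_map, Polynomial.eval₂_eq_sum_range, Finset.sum_range_succ] at ht
  have e1 : |MvPolynomial.eval p' Q.leadingCoeff| * |t| ^ d ≤
      ∑ i ∈ Finset.range d, |MvPolynomial.eval p' (Q.coeff i)| * |t| ^ i := by
    have : MvPolynomial.eval p' Q.leadingCoeff * t ^ d = - ∑ i ∈ Finset.range d, MvPolynomial.eval p' (Q.coeff i) * t ^ i := by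
      rw [Polynomial.leadingCoeff]; linarith
    rw [← abs_pow, ← abs_mul, this, abs_neg]
    refine (Finset.abs_sum_le_sum_abs _ _).trans (le_of_eq ?_)
    simp [abs_mul, abs_pow]
  rcases Nat.eq_zero_or_pos d with h0 | h0
  · rw [h0] at e1; simp at e1; exact h2 e1
  · have e2 : ∑ i ∈ Finset.range d, |MvPolynomial.eval p' (Q.coeff i)| * |t| ^ i ≤
        (∑ i ∈ Finset.range d, |MvPolynomial.eval p' (Q.coeff i)|) * |t| ^ (d-1) := by
      rw [Finset.sum_mul]
      refine Finset.sum_le_sum fun i hi => mul_le_mul_of_nonneg_left ?_ (abs_nonneg _)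
      exact pow_le_pow_right₀ ht1.le (by have := Finset.mem_range.1 hi; omega)
    have e3 : |t| ^ d = |t| ^ (d-1) * |t| := by rw [← pow_succ]; congr 1; omega
    have hpp : 0 < |t| ^ (d-1) := by positivity
    have e4 : |MvPolynomial.eval p' Q.leadingCoeff| * |t| ≤ ∑ i ∈ Finset.range d, |MvPolynomial.eval p' (Q.coeff i)| := by
      have := e1.trans e2
      rw [e3] at this
      have h5 : (|MvPolynomial.eval p' Q.leadingCoeff| * |t|) * |t| ^ (d-1) ≤ (∑ i ∈ Finset.range d, |MvPolynomial.eval p' (Q.coeff i)|) * |t| ^ (d-1) := by linarith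
      exact le_of_mul_le_mul_right h5 hpp
    have e5 : |t| ≤ (∑ i ∈ Finset.range d, |MvPolynomial.eval p' (Q.coeff i)|) / |MvPolynomial.eval p' Q.leadingCoeff| := by
      rw [le_div_iff₀ hl]; linarith
    simp only [hB] at hcon
    linarith

noncomputable def ev2 (p : ι → ℝ) (x : ν → ℝ) : MvPolynomial ν (MvPolynomial ι ℝ) →+* ℝ :=
  MvPolynomial.eval₂Hom (MvPolynomial.eval p) x

theorem PL (P : ν → MvPolynomial ν (MvPolynomial ι ℝ)) :
    ∃ h : MvPolynomial ι ℝ, h ≠ 0 ∧ ∃ D : ℕ, ∀ p, MvPolynomial.eval p h ≠ 0 →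
      {x : ν → ℝ | (∀ i, ev2 p x (P i) = 0) ∧ ev2 p x (Matrix.of fun i j => MvPolynomial.pderiv j (P i)).det ≠ 0}.Finite ∧
      {x : ν → ℝ | (∀ i, ev2 p x (P i) = 0) ∧ ev2 p x (Matrix.of fun i j => MvPolynomial.pderiv j (P i)).det ≠ 0}.ncard ≡ D [MOD 2] ∧
      ∃ C : ℝ, ∀ᶠ p' in 𝓝 p, ∀ x : ν → ℝ, (∀ i, ev2 p' x (P i) = 0) →
        ev2 p' x (Matrix.of fun i j => MvPolynomial.pderiv j (P i)).det ≠ 0 →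
        (∀ i, |x i| ≤ C) ∧ |ev2 p' x (Matrix.of fun i j => MvPolynomial.pderiv j (P i)).det|⁻¹ ≤ C := by
  classical
  set J := (Matrix.of fun i j => MvPolynomial.pderiv j (P i)).det with hJ
  let rel : Option ν → MvPolynomial (Option ν) (MvPolynomial ι ℝ) := fun o => o.elim
    (MvPolynomial.rename some J * MvPolynomial.X none - 1) (fun i => MvPolynomial.rename some (P i))
  let I := Ideal.span (Set.range rel)
  let A := MvPolynomial (Option ν) (MvPolynomial ι ℝ) ⧸ I
  let q : MvPolynomial (Option ν) (MvPolynomial ι ℝ) →ₐ[MvPolynomial ι ℝ] A := Ideal.Quotient.mkₐ _ I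
  have hqs : Function.Surjective q := Ideal.Quotient.mkₐ_surjective _ _
  have hrel : ∀ o, q (rel o) = 0 := fun o =>
    Ideal.Quotient.eq_zero_iff_mem.2 (Ideal.subset_span ⟨o, rfl⟩)
  let x : ν → A := fun i => q (MvPolynomial.X (some i))
  let w : A := q (MvPolynomial.X none)
  have hxa : ∀ Q : MvPolynomial ν (MvPolynomial ι ℝ), MvPolynomial.aeval x Q = q (MvPolynomial.rename some Q) := by
    intro Q
    have : (MvPolynomial.aeval x) = q.comp (MvPolynomial.rename some) := by
      ext i; simp [x]
    rw [this]; rfl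
  have hPx : ∀ i, MvPolynomial.aeval x (P i) = 0 := fun i => by rw [hxa]; exact hrel (some i)
  have hw : MvPolynomial.aeval x J * w = 1 := by
    rw [hxa]
    have := hrel none
    simp only [rel, Option.elim, map_sub, map_mul, map_one] at this
    exact sub_eq_zero.1 this
  have hq' : MvPolynomial.aeval (R := MvPolynomial ι ℝ) (fun o : Option ν => o.elim w x) = q := by
    ext o
    cases o <;> simp [x, w]
  haveI : Algebra.FiniteType (MvPolynomial ι ℝ) A := Algebra.FiniteType.of_surjective q hqs
  haveI : Algebra.FormallyUnramified (MvPolynomial ι ℝ) A := unram x w P hPx hw (by rw [hq']; exact hqs)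
  obtain ⟨h0, hh0, D, hD⟩ := alg_parity (MvPolynomial ι ℝ) A
  choose Q hQ0 hQ using gen_alg (MvPolynomial ι ℝ) A
  -- correspondence
  have key : ∀ p, {y : ν → ℝ | (∀ i, ev2 p y (P i) = 0) ∧ ev2 p y J ≠ 0} =
      (fun (ψ : A →+* ℝ) i => ψ (x i)) '' {ψ : A →+* ℝ | ψ.comp (algebraMap (MvPolynomial ι ℝ) A) = MvPolynomial.eval p} ∧
      Set.InjOn (fun (ψ : A →+* ℝ) i => ψ (x i)) {ψ : A →+* ℝ | ψ.comp (algebraMap (MvPolynomial ι ℝ) A) = MvPolynomial.eval p} ∧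
      (∀ y : ν → ℝ, (∀ i, ev2 p y (P i) = 0) → ev2 p y J ≠ 0 → ∃ ψ : A →+* ℝ,
        ψ.comp (algebraMap (MvPolynomial ι ℝ) A) = MvPolynomial.eval p ∧ (∀ i, ψ (x i) = y i) ∧ ψ w = (ev2 p y J)⁻¹) := by
    intro p
    have k1 : ∀ ψ : A →+* ℝ, ψ.comp (algebraMap (MvPolynomial ι ℝ) A) = MvPolynomial.eval p →
        ∀ Q, ev2 p (fun i => ψ (x i)) Q = ψ (MvPolynomial.aeval x Q) := by
      intro ψ hψ Q
      have : ev2 p (fun i => ψ (x i)) = ψ.comp (MvPolynomial.aeval x).toRingHom := by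
        apply MvPolynomial.ringHom_ext
        · intro r
          have := congrArg (fun g => g r) hψ
          simp [ev2] at this ⊢
          exact this.symm
        · intro i; simp [ev2]
      rw [this]; rfl
    have k2 : ∀ ψ : A →+* ℝ, ψ.comp (algebraMap (MvPolynomial ι ℝ) A) = MvPolynomial.eval p →
        ev2 p (fun i => ψ (x i)) J * ψ w = 1 := by
      intro ψ hψ
      rw [k1 ψ hψ, ← map_mul, hw, map_one]
    have k3 : ∀ y : ν → ℝ, (∀ i, ev2 p y (P i) = 0) → ev2 p y J ≠ 0 → ∃ ψ : A →+* ℝ,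
        ψ.comp (algebraMap (MvPolynomial ι ℝ) A) = MvPolynomial.eval p ∧ (∀ i, ψ (x i) = y i) ∧ ψ w = (ev2 p y J)⁻¹ := by
      intro y hy hyJ
      let e : MvPolynomial (Option ν) (MvPolynomial ι ℝ) →+* ℝ :=
        MvPolynomial.eval₂Hom (MvPolynomial.eval p) (fun o => o.elim (ev2 p y J)⁻¹ y)
      have he : ∀ Q, e (MvPolynomial.rename some Q) = ev2 p y Q := by
        intro Q
        simp only [e, ev2, MvPolynomial.coe_eval₂Hom, MvPolynomial.eval₂_rename]
        rfl
      have hI : ∀ a ∈ I, e a = 0 := by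
        intro a ha
        have : I ≤ RingHom.ker e := by
          refine Ideal.span_le.2 ?_
          rintro _ ⟨o, rfl⟩
          rw [SetLike.mem_coe, RingHom.mem_ker]
          cases o with
          | none =>
            simp only [rel, Option.elim, map_sub, map_mul, he, map_one]
            simp [e, hyJ]
          | some i => simp only [rel, Option.elim, he]; exact hy i
        exact this ha
      refine ⟨Ideal.Quotient.lift I e hI, ?_, ?_, ?_⟩
      · ext r
        · show e (MvPolynomial.C (MvPolynomial.C r)) = _
          simp [e]
        · show e (MvPolynomial.C (MvPolynomial.X r)) = _
          simp [e]
      · intro i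
        show e (MvPolynomial.X (some i)) = _
        simp [e]
      · show e (MvPolynomial.X none) = _
        simp [e]
    refine ⟨?_, ?_, k3⟩
    · ext y
      constructor
      · rintro ⟨h1, h2⟩
        obtain ⟨ψ, a, b, c⟩ := k3 y h1 h2
        exact ⟨ψ, a, funext b⟩
      · rintro ⟨ψ, hψ, rfl⟩
        refine ⟨fun i => ?_, fun h => ?_⟩
        · show ev2 p (fun i => ψ (x i)) (P i) = 0
          rw [k1 ψ hψ, hPx, map_zero]
        · have := k2 ψ hψ
          rw [h] at this; simp at this
    · intro ψ hψ φ hφ hx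
      have hx' : ∀ i, ψ (x i) = φ (x i) := fun i => congrFun hx i
      have hw' : ψ w = φ w := by
        have a := k2 ψ hψ
        have b := k2 φ hφ
        have : (fun i => ψ (x i)) = fun i => φ (x i) := hx
        rw [← this] at b
        exact mul_left_cancel₀ (left_ne_zero_of_mul_eq_one a) (a.trans b.symm)
      have : ψ.comp q.toRingHom = φ.comp q.toRingHom := by
        apply MvPolynomial.ringHom_ext
        · intro r
          have a := congrArg (fun g => g r) (hψ.trans hφ.symm)
          exact a
        · intro o
          cases o with
          | none => exact hw'
          | some i => exact hx' i
      refine RingHom.ext fun a => ?_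
      obtain ⟨b, rfl⟩ := hqs a
      exact congrArg (fun g => g b) this
  refine ⟨h0 * ((Q w).leadingCoeff * ∏ i, (Q (x i)).leadingCoeff), ?_, D, fun p hp => ?_⟩
  · refine mul_ne_zero hh0 (mul_ne_zero (Polynomial.leadingCoeff_ne_zero.2 (hQ0 _)) ?_)
    exact Finset.prod_ne_zero_iff.2 fun i _ => Polynomial.leadingCoeff_ne_zero.2 (hQ0 _)
  rw [map_mul, map_mul, map_prod] at hp
  have hp0 := left_ne_zero_of_mul hp
  have hpw := left_ne_zero_of_mul (right_ne_zero_of_mul hp)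
  have hpx := Finset.prod_ne_zero_iff.1 (right_ne_zero_of_mul (right_ne_zero_of_mul hp))
  obtain ⟨f1, f2⟩ := hD _ hp0
  obtain ⟨g1, g2, -⟩ := key p
  refine ⟨by rw [g1]; exact f1.image _, by rw [g1, Set.ncard_image_of_injOn g2]; exact f2, ?_⟩
  obtain ⟨Cw, hCw⟩ := root_bound (Q w) p hpw
  have hroot : ∀ (p' : ι → ℝ) (ψ : A →+* ℝ), ψ.comp (algebraMap (MvPolynomial ι ℝ) A) = MvPolynomial.eval p' → ∀ a,
      ((Q a).map (MvPolynomial.eval p')).eval (ψ a) = 0 := by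
    intro p' ψ hψ a
    have := congrArg ψ (hQ a)
    rw [map_zero, Polynomial.aeval_def, Polynomial.hom_eval₂, hψ] at this
    rwa [Polynomial.eval_map]
  choose Cx hCx using fun i => root_bound (Q (x i)) p (hpx i (Finset.mem_univ i))
  refine ⟨|Cw| + ∑ i, |Cx i|, ?_⟩
  filter_upwards [hCw, eventually_all.2 hCx] with p' h1 h2 y hy hyJ
  obtain ⟨ψ, a, b, c⟩ := (key p').2.2 y hy hyJ
  have hsn : 0 ≤ ∑ i, |Cx i| := Finset.sum_nonneg fun i _ => abs_nonneg _
  refine ⟨fun i => ?_, ?_⟩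
  · have := h2 i _ (hroot p' ψ a (x i))
    rw [b i] at this
    have h3 := Finset.single_le_sum (f := fun i => |Cx i|) (fun i _ => abs_nonneg _) (Finset.mem_univ i)
    have h4 := le_abs_self (Cx i)
    have h5 := abs_nonneg Cw
    linarith
  · have := h1 _ (hroot p' ψ a w)
    rw [c, abs_inv] at this
    have h4 := le_abs_self Cw
    linarith
end pl2
end partC4

section partC5
open Filter Topology

section reg
variable {ι ν σ τ : Type} [Fintype ι] [Fintype ν] [DecidableEq ι] [DecidableEq ν] [Fintype σ] [DecidableEq σ]
  [Fintype τ] [DecidableEq τ]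

theorem eval2_hasFDerivAt {R : Type} [CommRing R] (f : R →+* ℝ) (Q : MvPolynomial σ R) (x : σ → ℝ) :
    HasFDerivAt (fun x : σ → ℝ => MvPolynomial.eval₂ f x Q)
      (∑ j, MvPolynomial.eval₂ f x (MvPolynomial.pderiv j Q) • (ContinuousLinearMap.proj j : (σ → ℝ) →L[ℝ] ℝ)) x := by
  induction Q using MvPolynomial.induction_on with
  | C r => simpa using hasFDerivAt_const (f r) x
  | add p q hp hq =>
    simp only [MvPolynomial.eval₂_add, map_add, add_smul, Finset.sum_add_distrib]
    exact hp.add hq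
  | mul_X p n hp =>
    have h1 : HasFDerivAt (fun x : σ → ℝ => x n) (ContinuousLinearMap.proj n : (σ → ℝ) →L[ℝ] ℝ) x := hasFDerivAt_apply n x
    have h2 := hp.mul h1
    simp only [MvPolynomial.eval₂_mul, MvPolynomial.eval₂_X]
    refine HasFDerivAt.congr_fderiv (f := fun x : σ → ℝ => MvPolynomial.eval₂ f x p * x n) h2 ?_
    ext v
    simp only [Derivation.leibniz, MvPolynomial.eval₂_add, smul_eq_mul, MvPolynomial.eval₂_mul, MvPolynomial.eval₂_X,
      add_smul, Finset.sum_add_distrib, ContinuousLinearMap.add_apply, ContinuousLinearMap.sum_apply, ContinuousLinearMap.smul_apply,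
      Finset.mul_sum, MvPolynomial.pderiv_X]
    congr 1
    · rw [Finset.sum_eq_single n]
      · simp
      · intro j _ hj; simp [hj]
      · simp
    · refine Finset.sum_congr rfl fun j _ => ?_
      simp; ring

def IsReg (f : (σ → ℝ) → ℝ) : Prop := ∃ P Q : MvPolynomial σ ℝ, (∀ x, MvPolynomial.eval x Q ≠ 0) ∧
  ∀ x, f x = MvPolynomial.eval x P / MvPolynomial.eval x Q

theorem IsReg.poly (P : MvPolynomial σ ℝ) : IsReg (fun x => MvPolynomial.eval x P) := ⟨P, 1, by simp, by simp⟩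
theorem IsReg.const (c : ℝ) : IsReg (fun _ : σ → ℝ => c) := ⟨.C c, 1, by simp, by simp⟩
theorem IsReg.coord (i : σ) : IsReg (fun x : σ → ℝ => x i) := ⟨.X i, 1, by simp, by simp⟩
theorem IsReg.add {f g : (σ → ℝ) → ℝ} (hf : IsReg f) (hg : IsReg g) : IsReg (fun x => f x + g x) := by
  obtain ⟨P, Q, h1, h2⟩ := hf
  obtain ⟨P', Q', h1', h2'⟩ := hg
  refine ⟨P * Q' + Q * P', Q * Q', fun x => by simp [h1, h1'], fun x => ?_⟩
  simp only [h2, h2', map_add, map_mul]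
  rw [div_add_div _ _ (h1 x) (h1' x)]
theorem IsReg.mul {f g : (σ → ℝ) → ℝ} (hf : IsReg f) (hg : IsReg g) : IsReg (fun x => f x * g x) := by
  obtain ⟨P, Q, h1, h2⟩ := hf
  obtain ⟨P', Q', h1', h2'⟩ := hg
  refine ⟨P * P', Q * Q', fun x => by simp [h1, h1'], fun x => ?_⟩
  simp only [h2, h2', map_mul]
  rw [div_mul_div_comm]
theorem IsReg.neg {f : (σ → ℝ) → ℝ} (hf : IsReg f) : IsReg (fun x => - f x) := by
  simpa using (IsReg.const (-1)).mul hf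
theorem IsReg.sub {f g : (σ → ℝ) → ℝ} (hf : IsReg f) (hg : IsReg g) : IsReg (fun x => f x - g x) := by
  simpa [sub_eq_add_neg] using hf.add hg.neg
theorem IsReg.inv {f : (σ → ℝ) → ℝ} (hf : IsReg f) (h0 : ∀ x, f x ≠ 0) : IsReg (fun x => (f x)⁻¹) := by
  obtain ⟨P, Q, h1, h2⟩ := hf
  refine ⟨Q, P, fun x h => h0 x (by rw [h2, h, zero_div]), fun x => by simp only [h2, inv_div]⟩
theorem IsReg.div {f g : (σ → ℝ) → ℝ} (hf : IsReg f) (hg : IsReg g) (h0 : ∀ x, g x ≠ 0) : IsReg (fun x => f x / g x) := by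
  simpa [div_eq_mul_inv] using hf.mul (hg.inv h0)
theorem IsReg.sum {κ : Type*} (s : Finset κ) {f : κ → (σ → ℝ) → ℝ} (hf : ∀ k, IsReg (f k)) : IsReg (fun x => ∑ k ∈ s, f k x) := by
  classical
  induction s using Finset.induction_on with
  | empty => simpa using IsReg.const 0
  | insert a s ha ih => simpa [Finset.sum_insert ha] using (hf a).add ih
theorem IsReg.prod {κ : Type*} (s : Finset κ) {f : κ → (σ → ℝ) → ℝ} (hf : ∀ k, IsReg (f k)) : IsReg (fun x => ∏ k ∈ s, f k x) := by
  classical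
  induction s using Finset.induction_on with
  | empty => simpa using IsReg.const 1
  | insert a s ha ih => simpa [Finset.prod_insert ha] using (hf a).mul ih
theorem IsReg.pow {f : (σ → ℝ) → ℝ} (hf : IsReg f) (n : ℕ) : IsReg (fun x => f x ^ n) := by
  induction n with
  | zero => simpa using IsReg.const 1
  | succ n ih => simpa [pow_succ] using ih.mul hf
theorem IsReg.comp {f : (σ → ℝ) → ℝ} (hf : IsReg f) {g : (τ → ℝ) → (σ → ℝ)} (hg : ∀ i, IsReg (fun x => g x i)) :
    IsReg (fun x => f (g x)) := by
  have key : ∀ P : MvPolynomial σ ℝ, IsReg (fun x => MvPolynomial.eval (g x) P) := by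
    intro P
    induction P using MvPolynomial.induction_on with
    | C r => simpa using IsReg.const r
    | add p q hp hq => simpa using hp.add hq
    | mul_X p n hp => simpa using hp.mul (hg n)
  obtain ⟨P, Q, h1, h2⟩ := hf
  simp only [h2]
  exact (key P).div (key Q) fun x => h1 _
theorem IsReg.det {M : (σ → ℝ) → Matrix ν ν ℝ} (hM : ∀ i j, IsReg (fun x => M x i j)) : IsReg (fun x => (M x).det) := by
  simp only [Matrix.det_apply']
  exact IsReg.sum _ fun s => (IsReg.const _).mul (IsReg.prod _ fun i => hM _ _)
theorem IsReg.minv {M : (σ → ℝ) → Matrix ν ν ℝ} (hM : ∀ i j, IsReg (fun x => M x i j)) (h0 : ∀ x, (M x).det ≠ 0) (i j : ν) :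
    IsReg (fun x => (M x)⁻¹ i j) := by
  simp only [Matrix.inv_def, Ring.inverse_eq_inv', Matrix.smul_apply, smul_eq_mul, Matrix.adjugate_apply]
  refine ((IsReg.det hM).inv h0).mul (IsReg.det fun a b => ?_)
  by_cases h : a = j
  · subst h; simpa using IsReg.const _
  · simpa [Matrix.updateRow_ne h] using hM a b
theorem poly_contDiff (P : MvPolynomial σ ℝ) {n : WithTop ℕ∞} : ContDiff ℝ n (fun x => MvPolynomial.eval x P) := by
  induction P using MvPolynomial.induction_on with
  | C r => simpa using contDiff_const
  | add p q hp hq => simpa using hp.add hq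
  | mul_X p n hp => simpa using hp.mul (contDiff_apply ℝ ℝ n)
theorem IsReg.contDiff {f : (σ → ℝ) → ℝ} (hf : IsReg f) {n : WithTop ℕ∞} : ContDiff ℝ n f := by
  obtain ⟨P, Q, h1, h2⟩ := hf
  have : f = fun x => MvPolynomial.eval x P / MvPolynomial.eval x Q := funext h2
  rw [this]
  exact (poly_contDiff P).div (poly_contDiff Q) h1
theorem poly_partial (P : MvPolynomial σ ℝ) (x v : σ → ℝ) :
    fderiv ℝ (fun x => MvPolynomial.eval x P) x v = ∑ j, MvPolynomial.eval x (MvPolynomial.pderiv j P) * v j := by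
  have := (eval2_hasFDerivAt (RingHom.id ℝ) P x).fderiv
  simp only [MvPolynomial.eval₂_id] at this
  rw [this]; simp
theorem IsReg.pd {f : (σ → ℝ) → ℝ} (hf : IsReg f) (j : σ) : IsReg (fun x => fderiv ℝ f x (Pi.single j 1)) := by
  obtain ⟨P, Q, h1, h2⟩ := hf
  have hf : f = fun x => MvPolynomial.eval x P / MvPolynomial.eval x Q := funext h2
  refine ⟨MvPolynomial.pderiv j P * Q - P * MvPolynomial.pderiv j Q, Q ^ 2, fun x => by simp [h1], fun x => ?_⟩
  have dP : DifferentiableAt ℝ (fun x => MvPolynomial.eval x P) x := (poly_contDiff P (n := 1)).differentiable (by norm_num) x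
  have dQ : DifferentiableAt ℝ (fun x => MvPolynomial.eval x Q) x := (poly_contDiff Q (n := 1)).differentiable (by norm_num) x
  have df : DifferentiableAt ℝ f x := by
    rw [hf]; exact ((poly_contDiff P (n := 1)).div (poly_contDiff Q) h1).differentiable (by norm_num) x
  have hm : (fun x => f x * MvPolynomial.eval x Q) = fun x => MvPolynomial.eval x P := by
    funext x; rw [h2, div_mul_cancel₀ _ (h1 x)]
  have hd := congrArg (fun L => L (Pi.single j 1)) (fderiv_fun_mul df dQ)
  rw [hm] at hd
  simp only [ContinuousLinearMap.smul_apply, ContinuousLinearMap.add_apply, poly_partial, smul_eq_mul] at hd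
  have e : ∀ R : MvPolynomial σ ℝ, ∑ i, MvPolynomial.eval x (MvPolynomial.pderiv i R) * (Pi.single j 1 : σ → ℝ) i = MvPolynomial.eval x (MvPolynomial.pderiv j R) := by
    intro R; simp [Pi.single_apply]
  simp only [e, h2 x] at hd
  simp only [map_sub, map_mul, map_pow]
  have hx := h1 x
  rw [eq_div_iff (pow_ne_zero 2 hx), hd]
  field_simp
  ring

theorem clm_det (L : (ν → ℝ) →L[ℝ] (ν → ℝ)) : L.det = (Matrix.of fun i j => L (Pi.single j 1) i).det := by
  rw [ContinuousLinearMap.det, ← LinearMap.det_toMatrix']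
  congr 1
end reg
end partC5

section partC6
open Filter Topology

section pl3
variable {ι ν σ τ : Type} [Fintype ι] [Fintype ν] [DecidableEq ι] [DecidableEq ν]

def Kp (K : ν → (ν ⊕ ι → ℝ) → ℝ) (p : ι → ℝ) : (ν → ℝ) → (ν → ℝ) := fun x i => K i (Sum.elim x p)

theorem Kp_contDiff (K : ν → (ν ⊕ ι → ℝ) → ℝ) (hK : ∀ i, IsReg (K i)) (p : ι → ℝ) {n : WithTop ℕ∞} : ContDiff ℝ n (Kp K p) := by
  refine contDiff_pi.2 fun i => (hK i).contDiff.comp ?_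
  refine contDiff_pi.2 fun o => ?_
  cases o with
  | inl a => exact contDiff_apply ℝ ℝ a
  | inr b => exact contDiff_const

theorem PL' (K : ν → (ν ⊕ ι → ℝ) → ℝ) (hK : ∀ i, IsReg (K i)) :
    ∃ h : MvPolynomial ι ℝ, h ≠ 0 ∧ ∃ D : ℕ, ∀ p, MvPolynomial.eval p h ≠ 0 →
      {x : ν → ℝ | Kp K p x = 0 ∧ (fderiv ℝ (Kp K p) x).det ≠ 0}.Finite ∧
      {x : ν → ℝ | Kp K p x = 0 ∧ (fderiv ℝ (Kp K p) x).det ≠ 0}.ncard ≡ D [MOD 2] ∧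
      ∃ C : ℝ, ∀ᶠ p' in 𝓝 p, ∀ x : ν → ℝ, Kp K p' x = 0 → (fderiv ℝ (Kp K p') x).det ≠ 0 →
        ‖x‖ ≤ C ∧ 1 ≤ C * |(fderiv ℝ (Kp K p') x).det| := by
  have hK' := hK
  choose P Q hQ hPQ using hK
  set P' : ν → MvPolynomial ν (MvPolynomial ι ℝ) := fun i => MvPolynomial.sumRingEquiv ℝ ν ι (P i) with hP'
  have hev : ∀ p x (R : MvPolynomial (ν ⊕ ι) ℝ), ev2 p x (MvPolynomial.sumRingEquiv ℝ ν ι R) = MvPolynomial.eval (Sum.elim x p) R := by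
    intro p x R
    have : (ev2 p x).comp (MvPolynomial.sumRingEquiv ℝ ν ι).toRingHom = MvPolynomial.eval (Sum.elim x p) := by
      apply MvPolynomial.ringHom_ext
      · intro r; simp [ev2]
      · intro o; cases o <;> simp [ev2]
    rw [← this]; rfl
  have hz : ∀ p x, (∀ i, ev2 p x (P' i) = 0) ↔ Kp K p x = 0 := by
    intro p x
    rw [funext_iff]
    refine forall_congr' fun i => ?_
    simp only [hP', hev, Kp, Pi.zero_apply, hPQ]
    rw [div_eq_zero_iff]
    simp [hQ]
  set q : (ι → ℝ) → (ν → ℝ) → ℝ := fun p x => ∏ i, MvPolynomial.eval (Sum.elim x p) (Q i) with hq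
  have hq0 : ∀ p x, q p x ≠ 0 := fun p x => Finset.prod_ne_zero_iff.2 fun i _ => hQ i _
  have hdet : ∀ p x, Kp K p x = 0 → ev2 p x (Matrix.of fun i j => MvPolynomial.pderiv j (P' i)).det =
      q p x * (fderiv ℝ (Kp K p) x).det := by
    intro p x hx
    rw [clm_det, RingHom.map_det, hq]
    simp only
    rw [← Matrix.det_mul_column]
    congr 1
    ext i j
    have hd := Kp_contDiff K hK' p (n := 1)
    have h1 : HasFDerivAt (fun x => Kp K p x i) ((ContinuousLinearMap.proj i).comp (fderiv ℝ (Kp K p) x)) x :=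
      hasFDerivAt_pi'.1 (hd.differentiable (by norm_num) x).hasFDerivAt i
    have h2 : HasFDerivAt (fun x => MvPolynomial.eval (Sum.elim x p) (Q i))
      (∑ j, ev2 p x (MvPolynomial.pderiv j (MvPolynomial.sumRingEquiv ℝ ν ι (Q i))) • (ContinuousLinearMap.proj j : (ν → ℝ) →L[ℝ] ℝ)) x := by
      have := eval2_hasFDerivAt (MvPolynomial.eval p) (MvPolynomial.sumRingEquiv ℝ ν ι (Q i)) x
      have e : (fun x => MvPolynomial.eval (Sum.elim x p) (Q i)) = fun x => MvPolynomial.eval₂ (MvPolynomial.eval p) x (MvPolynomial.sumRingEquiv ℝ ν ι (Q i)) :=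
        funext fun x => (hev p x (Q i)).symm
      rw [e]; exact this
    have h3 : HasFDerivAt (fun x => Kp K p x i * MvPolynomial.eval (Sum.elim x p) (Q i))
      (∑ j, ev2 p x (MvPolynomial.pderiv j (P' i)) • (ContinuousLinearMap.proj j : (ν → ℝ) →L[ℝ] ℝ)) x := by
      have := eval2_hasFDerivAt (MvPolynomial.eval p) (P' i) x
      have e : (fun x => Kp K p x i * MvPolynomial.eval (Sum.elim x p) (Q i)) = fun x => MvPolynomial.eval₂ (MvPolynomial.eval p) x (P' i) :=
        funext fun x => by
          rw [Kp, hPQ, div_mul_cancel₀ _ (hQ i _)]; exact (hev p x (P i)).symm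
      rw [e]; exact this
    have h4 := congrArg (fun L => L (Pi.single j 1)) (h3.unique (h1.mul h2))
    simp [hx, Pi.single_apply] at h4
    simpa using h4
  obtain ⟨h, hh, D, hD⟩ := PL P'
  have hset : ∀ p, {x : ν → ℝ | (∀ i, ev2 p x (P' i) = 0) ∧ ev2 p x (Matrix.of fun i j => MvPolynomial.pderiv j (P' i)).det ≠ 0} =
      {x : ν → ℝ | Kp K p x = 0 ∧ (fderiv ℝ (Kp K p) x).det ≠ 0} := by
    intro p
    ext x
    simp only [Set.mem_ofPred_eq, hz]
    refine and_congr_right fun hx => ?_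
    rw [hdet p x hx]
    simp [hq0]
  refine ⟨h, hh, D, fun p hp => ?_⟩
  obtain ⟨h1, h2, C, hC⟩ := hD p hp
  rw [hset p] at h1 h2
  refine ⟨h1, h2, ?_⟩
  have hqc : Continuous (fun z : (ι → ℝ) × (ν → ℝ) => q z.1 z.2) := by
    refine continuous_finsetProd _ fun i _ => (MvPolynomial.continuous_eval (Q i)).comp ?_
    refine continuous_pi fun o => ?_
    cases o <;> simp <;> fun_prop
  have hcomp : IsCompact (Metric.closedBall p 1 ×ˢ Metric.closedBall (0 : ν → ℝ) |C|) :=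
    (isCompact_closedBall _ _).prod (isCompact_closedBall _ _)
  obtain ⟨B, hB⟩ := hcomp.exists_bound_of_continuousOn hqc.continuousOn
  refine ⟨|C| + |C| * |B|, ?_⟩
  filter_upwards [hC, Metric.closedBall_mem_nhds p one_pos] with p' hp' hpb x hx hxd
  have hJ0 : ev2 p' x (Matrix.of fun i j => MvPolynomial.pderiv j (P' i)).det ≠ 0 := by
    rw [hdet p' x hx]; exact mul_ne_zero (hq0 _ _) hxd
  obtain ⟨a, b⟩ := hp' x ((hz p' x).2 hx) hJ0
  have hxC : ‖x‖ ≤ |C| := (pi_norm_le_iff_of_nonneg (abs_nonneg _)).2 fun i => (a i).trans (le_abs_self _)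
  have hBB := hB (p', x) ⟨hpb, by simpa using hxC⟩
  have hBp := abs_nonneg B
  have hCp := abs_nonneg C
  refine ⟨hxC.trans (by nlinarith), ?_⟩
  rw [inv_le_iff_one_le_mul₀ (abs_pos.2 hJ0), hdet p' x hx, abs_mul] at b
  have hdp := abs_pos.2 hxd
  rw [Real.norm_eq_abs] at hBB
  simp only at hBB
  have hqB : |q p' x| ≤ |B| := hBB.trans (le_abs_self _)
  have h5 : C * (|q p' x| * |(fderiv ℝ (Kp K p') x).det|) ≤ |C| * (|B| * |(fderiv ℝ (Kp K p') x).det|) := by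
    refine mul_le_mul (le_abs_self C) (mul_le_mul_of_nonneg_right hqB hdp.le) (by positivity) hCp
  nlinarith [mul_nonneg hCp hdp.le]
end pl3
end partC6

section partC7
open Filter Topology

section ple
variable {σ μ π : Type} [Fintype σ] [Fintype μ] [DecidableEq σ] [DecidableEq μ] [Fintype π] [DecidableEq π]

theorem clm_det_ne_iff {ν : Type} [Fintype ν] [DecidableEq ν] (L : (ν → ℝ) →L[ℝ] (ν → ℝ)) :
    L.det ≠ 0 ↔ ∀ v, L v = 0 → v = 0 := by
  rw [ContinuousLinearMap.det, ← isUnit_iff_ne_zero, ← LinearMap.isUnit_iff_isUnit_det, LinearMap.isUnit_iff_ker_eq_bot,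
    LinearMap.ker_eq_bot']
  rfl

theorem loc_inv (F : (μ → ℝ) → (μ → ℝ)) (hF : ContDiff ℝ 2 F) (x0 : μ → ℝ) (hd : (fderiv ℝ F x0).det ≠ 0) :
    ∃ G : (μ → ℝ) → (μ → ℝ), ContDiffAt ℝ 2 G (F x0) ∧ G (F x0) = x0 ∧ (∀ᶠ y in 𝓝 (F x0), F (G y) = y) ∧
      ∀ᶠ x in 𝓝 x0, G (F x) = x := by
  let e : (μ → ℝ) ≃L[ℝ] (μ → ℝ) := ContinuousLinearEquiv.ofBijective (fderiv ℝ F x0)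
    (LinearMap.ker_eq_bot'.2 ((clm_det_ne_iff _).1 hd)) (LinearMap.range_eq_top.2 (LinearMap.surjective_of_injective
      (LinearMap.ker_eq_bot.1 (LinearMap.ker_eq_bot'.2 ((clm_det_ne_iff _).1 hd)))))
  have he : (e : (μ → ℝ) →L[ℝ] (μ → ℝ)) = fderiv ℝ F x0 := by ext; rfl
  have h1 : HasFDerivAt F (e : (μ → ℝ) →L[ℝ] (μ → ℝ)) x0 := by
    rw [he]; exact (hF.differentiable (by norm_num) x0).hasFDerivAt
  have h2 : HasStrictFDerivAt F (e : (μ → ℝ) →L[ℝ] (μ → ℝ)) x0 := hF.contDiffAt.hasStrictFDerivAt' h1 (by norm_num)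
  refine ⟨hF.contDiffAt.localInverse h1 (by norm_num), hF.contDiffAt.to_localInverse h1 (by norm_num), ?_, ?_, ?_⟩
  · exact h2.localInverse_apply_image
  · exact h2.eventually_right_inverse
  · exact h2.eventually_left_inverse

noncomputable def Jm (F : (μ → ℝ) → (μ → ℝ)) (x : μ → ℝ) : Matrix μ μ ℝ :=
  Matrix.of fun i j => fderiv ℝ (fun x => F x i) x (Pi.single j 1)

noncomputable def KE (F : (μ → ℝ) → (μ → ℝ)) (al : μ → (σ ⊕ π → ℝ) → ℝ) :
    (σ ⊕ μ) → ((σ ⊕ μ) ⊕ (π ⊕ (Unit ⊕ σ)) → ℝ) → ℝ := fun o y =>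
  let x : μ → ℝ := fun i => y (Sum.inl (Sum.inr i))
  let sp : σ ⊕ π → ℝ := Sum.elim (fun k => y (Sum.inl (Sum.inl k))) (fun a => y (Sum.inr (Sum.inl a)))
  match o with
  | Sum.inl k => ∑ i, x i * (∑ a, (Jm F x)⁻¹ i a * fderiv ℝ (al a) sp (Pi.single (Sum.inl k) 1)) +
      y (Sum.inr (Sum.inr (Sum.inl ()))) * y (Sum.inl (Sum.inl k)) + y (Sum.inr (Sum.inr (Sum.inr k)))
  | Sum.inr i => F x i - al i sp

def Al (al : μ → (σ ⊕ π → ℝ) → ℝ) (p : π ⊕ (Unit ⊕ σ) → ℝ) (s : σ → ℝ) : μ → ℝ :=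
  fun i => al i (Sum.elim s (fun a => p (Sum.inl a)))

theorem Jm_det (F : (μ → ℝ) → (μ → ℝ)) (hF : ContDiff ℝ 2 F) (x : μ → ℝ) : (Jm F x).det = (fderiv ℝ F x).det := by
  rw [clm_det]
  congr 1
  ext i j
  have := hasFDerivAt_pi'.1 (hF.differentiable (by norm_num) x).hasFDerivAt i
  simp only [Jm, Matrix.of_apply]
  rw [this.fderiv]; rfl

theorem KE_reg (F : (μ → ℝ) → (μ → ℝ)) (hF : ∀ i, IsReg (fun x => F x i)) (hd : ∀ x, (fderiv ℝ F x).det ≠ 0)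
    (al : μ → (σ ⊕ π → ℝ) → ℝ) (hal : ∀ i, IsReg (al i)) : ∀ o, IsReg (KE F al o) := by
  have hFc : ContDiff ℝ 2 F := contDiff_pi.2 fun i => (hF i).contDiff
  have hx : ∀ i, IsReg (fun y : (σ ⊕ μ) ⊕ (π ⊕ (Unit ⊕ σ)) → ℝ => y (Sum.inl (Sum.inr i))) := fun i => IsReg.coord _
  have hsp : ∀ o : σ ⊕ π, IsReg (fun y : (σ ⊕ μ) ⊕ (π ⊕ (Unit ⊕ σ)) → ℝ =>
      (Sum.elim (fun k => y (Sum.inl (Sum.inl k))) (fun a => y (Sum.inr (Sum.inl a))) : σ ⊕ π → ℝ) o) := by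
    intro o; cases o <;> exact IsReg.coord _
  intro o
  cases o with
  | inl k =>
    refine ((IsReg.sum _ fun i => (hx i).mul (IsReg.sum _ fun a => IsReg.mul ?_ ?_)).add ((IsReg.coord _).mul (IsReg.coord _))).add (IsReg.coord _)
    · exact IsReg.comp (f := fun x => (Jm F x)⁻¹ i a) (IsReg.minv (M := Jm F) (fun b c => (hF b).pd c) (fun x => by rw [Jm_det F hFc]; exact hd x) i a) hx
    · exact IsReg.comp ((hal a).pd (Sum.inl k)) hsp
  | inr i =>
    exact ((hF i).comp hx).sub ((hal i).comp hsp)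

theorem KE_inr (F : (μ → ℝ) → (μ → ℝ)) (al : μ → (σ ⊕ π → ℝ) → ℝ) (p : π ⊕ (Unit ⊕ σ) → ℝ) (s : σ → ℝ) (x : μ → ℝ) (i : μ) :
    Kp (KE F al) p (Sum.elim s x) (Sum.inr i) = F x i - Al al p s i := rfl

theorem KE_inl (F : (μ → ℝ) → (μ → ℝ)) (al : μ → (σ ⊕ π → ℝ) → ℝ) (p : π ⊕ (Unit ⊕ σ) → ℝ) (s : σ → ℝ) (x : μ → ℝ) (k : σ) :
    Kp (KE F al) p (Sum.elim s x) (Sum.inl k) =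
      ∑ i, x i * (∑ a, (Jm F x)⁻¹ i a * fderiv ℝ (al a) (Sum.elim s (fun a => p (Sum.inl a))) (Pi.single (Sum.inl k) 1)) +
      p (Sum.inr (Sum.inl ())) * s k + p (Sum.inr (Sum.inr k)) := rfl

noncomputable def Vf (F : (μ → ℝ) → (μ → ℝ)) (al : μ → (σ ⊕ π → ℝ) → ℝ) (p : π ⊕ (Unit ⊕ σ) → ℝ) (X : (σ → ℝ) → (μ → ℝ))
    (s : σ → ℝ) : σ → ℝ := fun k => Kp (KE F al) p (Sum.elim s (X s)) (Sum.inl k)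

theorem link_core (F : (μ → ℝ) → (μ → ℝ)) (hF : ∀ i, IsReg (fun x => F x i)) (hd : ∀ x, (fderiv ℝ F x).det ≠ 0)
    (al : μ → (σ ⊕ π → ℝ) → ℝ) (hal : ∀ i, IsReg (al i)) (p : π ⊕ (Unit ⊕ σ) → ℝ) (X : (σ → ℝ) → (μ → ℝ)) (s0 : σ → ℝ)
    (hX : DifferentiableAt ℝ X s0) (hFX : ∀ᶠ s in 𝓝 s0, F (X s) = Al al p s) :
    ∀ v, fderiv ℝ (Kp (KE F al) p) (Sum.elim s0 (X s0)) (Sum.elim v (fderiv ℝ X s0 v)) = Sum.elim (fderiv ℝ (Vf F al p X) s0 v) 0 := by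
  have hK : ContDiff ℝ 1 (Kp (KE F al) p) := Kp_contDiff _ (KE_reg F hF hd al hal) p
  let L : (σ → ℝ) →L[ℝ] (σ ⊕ μ → ℝ) := ContinuousLinearMap.pi fun o => match o with
    | Sum.inl k => ContinuousLinearMap.proj k
    | Sum.inr i => (ContinuousLinearMap.proj i).comp (fderiv ℝ X s0)
  have hL : ∀ v, L v = Sum.elim v (fderiv ℝ X s0 v) := by
    intro v; ext o; cases o <;> rfl
  have hW : HasFDerivAt (fun s => (Sum.elim s (X s) : σ ⊕ μ → ℝ)) L s0 := by
    refine hasFDerivAt_pi.2 fun o => ?_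
    cases o with
    | inl k => exact hasFDerivAt_apply k s0
    | inr i => exact hasFDerivAt_pi'.1 hX.hasFDerivAt i
  have hc : HasFDerivAt (fun s => Kp (KE F al) p (Sum.elim s (X s))) ((fderiv ℝ (Kp (KE F al) p) (Sum.elim s0 (X s0))).comp L) s0 :=
    ((hK.differentiable (by norm_num) _).hasFDerivAt).comp s0 hW
  intro v
  ext o
  cases o with
  | inl k =>
    have h1 : HasFDerivAt (Vf F al p X) (ContinuousLinearMap.pi fun k => (ContinuousLinearMap.proj (Sum.inl k)).comp
        ((fderiv ℝ (Kp (KE F al) p) (Sum.elim s0 (X s0))).comp L)) s0 :=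
      hasFDerivAt_pi.2 fun k => hasFDerivAt_pi'.1 hc (Sum.inl k)
    rw [h1.fderiv]
    simp [hL]
  | inr i =>
    have h1 := hasFDerivAt_pi'.1 hc (Sum.inr i)
    have h2 : (fun s => Kp (KE F al) p (Sum.elim s (X s)) (Sum.inr i)) =ᶠ[𝓝 s0] fun _ => 0 := by
      filter_upwards [hFX] with s hs
      rw [KE_inr, hs, sub_self]
    have h3 := (h1.congr_of_eventuallyEq h2.symm).unique (hasFDerivAt_const 0 s0)
    have h4 := congrArg (fun L => L v) h3
    simpa [hL] using h4
end ple
end partC7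

section partC8
open Filter Topology

section ple2
variable {σ μ π : Type} [Fintype σ] [Fintype μ] [DecidableEq σ] [DecidableEq μ] [Fintype π] [DecidableEq π]

def CR (F : (μ → ℝ) → (μ → ℝ)) (al : μ → (σ ⊕ π → ℝ) → ℝ) (p : π ⊕ (Unit ⊕ σ) → ℝ) : Set (σ ⊕ μ → ℝ) :=
  {z | Kp (KE F al) p z = 0}

theorem Al_contDiff (al : μ → (σ ⊕ π → ℝ) → ℝ) (hal : ∀ i, IsReg (al i)) (p : π ⊕ (Unit ⊕ σ) → ℝ) {n : WithTop ℕ∞} :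
    ContDiff ℝ n (Al al p) := by
  refine contDiff_pi.2 fun i => (hal i).contDiff.comp ?_
  refine contDiff_pi.2 fun o => ?_
  cases o with
  | inl a => exact contDiff_apply ℝ ℝ a
  | inr b => exact contDiff_const

theorem KE_row (F : (μ → ℝ) → (μ → ℝ)) (hF : ∀ i, IsReg (fun x => F x i)) (hd : ∀ x, (fderiv ℝ F x).det ≠ 0)
    (al : μ → (σ ⊕ π → ℝ) → ℝ) (hal : ∀ i, IsReg (al i)) (p : π ⊕ (Unit ⊕ σ) → ℝ) (s0 : σ → ℝ) (x0 : μ → ℝ)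
    (v : σ → ℝ) (u : μ → ℝ) (i : μ) :
    fderiv ℝ (Kp (KE F al) p) (Sum.elim s0 x0) (Sum.elim v u) (Sum.inr i) = fderiv ℝ F x0 u i - fderiv ℝ (Al al p) s0 v i := by
  have hreg := KE_reg F hF hd al hal
  have hFc : ContDiff ℝ 2 F := contDiff_pi.2 fun i => (hF i).contDiff
  have hAc := Al_contDiff al hal p (n := 2)
  let P1 : (σ ⊕ μ → ℝ) →L[ℝ] (σ → ℝ) := ContinuousLinearMap.pi fun k => ContinuousLinearMap.proj (Sum.inl k)
  let P2 : (σ ⊕ μ → ℝ) →L[ℝ] (μ → ℝ) := ContinuousLinearMap.pi fun k => ContinuousLinearMap.proj (Sum.inr k)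
  have e1 : ∀ v u, P1 (Sum.elim v u) = v := fun v u => rfl
  have e2 : ∀ v u, P2 (Sum.elim v u) = u := fun v u => rfl
  have a1 : HasFDerivAt F (fderiv ℝ F x0) (P2 (Sum.elim s0 x0)) := by
    rw [e2]; exact (hFc.differentiable (by norm_num) x0).hasFDerivAt
  have a2 : HasFDerivAt (Al al p) (fderiv ℝ (Al al p) s0) (P1 (Sum.elim s0 x0)) := by
    rw [e1]; exact (hAc.differentiable (by norm_num) s0).hasFDerivAt
  have a3 : HasFDerivAt (fun z => F (P2 z) - Al al p (P1 z)) ((fderiv ℝ F x0).comp P2 - (fderiv ℝ (Al al p) s0).comp P1) (Sum.elim s0 x0) :=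
    (a1.comp _ P2.hasFDerivAt).sub (a2.comp _ P1.hasFDerivAt)
  have a4 := hasFDerivAt_pi'.1 a3 i
  have h1 : HasFDerivAt (Kp (KE F al) p) (fderiv ℝ (Kp (KE F al) p) (Sum.elim s0 x0)) (Sum.elim s0 x0) :=
    ((Kp_contDiff _ hreg p (n := 1)).differentiable (by norm_num) _).hasFDerivAt
  have h2 := hasFDerivAt_pi'.1 h1 (Sum.inr i)
  have e3 : (fun z => Kp (KE F al) p z (Sum.inr i)) = fun z => (F (P2 z) - Al al p (P1 z)) i := by
    funext z
    obtain ⟨s, x, rfl⟩ : ∃ s x, z = Sum.elim s x := ⟨z ∘ Sum.inl, z ∘ Sum.inr, (Sum.elim_comp_inl_inr z).symm⟩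
    rw [KE_inr, e1, e2, Pi.sub_apply]
  rw [e3] at h2
  have h3 := congrArg (fun L => L (Sum.elim v u)) (h2.unique a4)
  simp only [ContinuousLinearMap.comp_apply, ContinuousLinearMap.sub_apply, e1, e2, ContinuousLinearMap.proj_apply, Pi.sub_apply] at h3
  exact h3

theorem ev_fin (S : Set ℝ) (hS : S.Finite) : ∀ᶠ ε in 𝓝[≠] (0:ℝ), -ε ∉ S := by
  have h1 : (S \ {0})ᶜ ∈ 𝓝 (-(0:ℝ)) := by
    refine (hS.subset Set.diff_subset).isClosed.isOpen_compl.mem_nhds ?_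
    simp
  have h2 : Tendsto (fun ε : ℝ => -ε) (𝓝[≠] 0) (𝓝 (-0)) := (continuous_neg.tendsto 0).mono_left nhdsWithin_le_nhds
  filter_upwards [h2 h1, self_mem_nhdsWithin] with ε h3 h4 h5
  refine h3 ⟨h5, ?_⟩
  rw [Set.mem_singleton_iff, neg_eq_zero]
  exact h4

theorem KE_pe (F : (μ → ℝ) → (μ → ℝ)) (al : μ → (σ ⊕ π → ℝ) → ℝ) (p : π ⊕ (Unit ⊕ σ) → ℝ) (s0 s : σ → ℝ) (x : μ → ℝ) (ε : ℝ) :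
    Kp (KE F al) (fun o => p o + ε * (Sum.elim 0 (Sum.elim 1 (-s0)) : π ⊕ (Unit ⊕ σ) → ℝ) o) (Sum.elim s x) =
      Kp (KE F al) p (Sum.elim s x) + ε • ((Sum.elim s 0 : σ ⊕ μ → ℝ) - Sum.elim s0 0) := by
  have e : (fun a : π => p (Sum.inl a) + ε * (Sum.elim 0 (Sum.elim 1 (-s0)) : π ⊕ (Unit ⊕ σ) → ℝ) (Sum.inl a)) = fun a => p (Sum.inl a) := by
    funext a; simp
  ext o
  cases o with
  | inl k =>
    rw [Pi.add_apply, KE_inl, KE_inl, e]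
    generalize (∑ i, x i * (∑ a, (Jm F x)⁻¹ i a * fderiv ℝ (al a) (Sum.elim s (fun a => p (Sum.inl a))) (Pi.single (Sum.inl k) 1))) = T
    simp only [Pi.smul_apply, Pi.sub_apply, Sum.elim_inl, smul_eq_mul, Sum.elim_inr, Pi.one_apply, Pi.neg_apply]
    ring
  | inr i =>
    rw [Pi.add_apply, KE_inr, KE_inr, Al, Al, e]
    simp

theorem PLE (F : (μ → ℝ) → (μ → ℝ)) (hF : ∀ i, IsReg (fun x => F x i)) (hd : ∀ x, (fderiv ℝ F x).det ≠ 0)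
    (al : μ → (σ ⊕ π → ℝ) → ℝ) (hal : ∀ i, IsReg (al i)) :
    ∃ h : MvPolynomial (π ⊕ (Unit ⊕ σ)) ℝ, h ≠ 0 ∧ ∃ D : ℕ, ∀ p, MvPolynomial.eval p h ≠ 0 →
      (CR F al p).Finite ∧ (CR F al p).ncard ≡ D [MOD 2] ∧
      (∀ z ∈ CR F al p, (fderiv ℝ (Kp (KE F al) p) z).det ≠ 0) ∧
      ∃ C : ℝ, ∀ᶠ p' in 𝓝 p, ∀ z ∈ CR F al p', ‖z‖ ≤ C := by
  have hreg := KE_reg F hF hd al hal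
  have hFc : ContDiff ℝ 2 F := contDiff_pi.2 fun i => (hF i).contDiff
  obtain ⟨h, hh, D, hD⟩ := PL' (KE F al) hreg
  have nd : ∀ p, MvPolynomial.eval p h ≠ 0 → ∀ z ∈ CR F al p, (fderiv ℝ (Kp (KE F al) p) z).det ≠ 0 := by
    intro p hp z0 hz0 hdet
    obtain ⟨-, -, C, hC⟩ := hD p hp
    have hz0' : Kp (KE F al) p z0 = 0 := hz0
    obtain ⟨s0, x0, rfl⟩ : ∃ s0 x0, z0 = Sum.elim s0 x0 := ⟨z0 ∘ Sum.inl, z0 ∘ Sum.inr, (Sum.elim_comp_inl_inr z0).symm⟩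
    have hA0 : F x0 = Al al p s0 := by
      ext i
      have := congrFun hz0' (Sum.inr i)
      rw [KE_inr] at this
      exact sub_eq_zero.1 this
    obtain ⟨G, hG, hG0, hG1, -⟩ := loc_inv F hFc x0 (hd x0)
    rw [hA0] at hG hG0 hG1
    have hAc := Al_contDiff al hal p (n := 2)
    set X : (σ → ℝ) → (μ → ℝ) := fun s => G (Al al p s) with hXd
    have hX0 : X s0 = x0 := hG0
    have hX : DifferentiableAt ℝ X s0 := (hG.differentiableAt (by norm_num)).comp s0 (hAc.differentiable (by norm_num) s0)
    have hFX : ∀ᶠ s in 𝓝 s0, F (X s) = Al al p s := hAc.continuous.continuousAt.eventually hG1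
    have hcore := link_core F hF hd al hal p X s0 hX hFX
    rw [hX0] at hcore
    set L := fderiv ℝ (Kp (KE F al) p) (Sum.elim s0 x0) with hLd
    set H := fderiv ℝ (Vf F al p X) s0 with hH
    let Pi' : (σ ⊕ μ → ℝ) →L[ℝ] (σ ⊕ μ → ℝ) := ContinuousLinearMap.pi fun o => match o with
      | Sum.inl k => ContinuousLinearMap.proj (Sum.inl k)
      | Sum.inr i => 0
    have hPi : ∀ v u, Pi' (Sum.elim v u) = Sum.elim v 0 := by
      intro v u; ext o; cases o <;> rfl
    let pe : ℝ → (π ⊕ (Unit ⊕ σ) → ℝ) := fun ε o => p o + ε * (Sum.elim 0 (Sum.elim 1 (-s0)) : π ⊕ (Unit ⊕ σ) → ℝ) o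
    have hpe : Tendsto pe (𝓝 0) (𝓝 p) := by
      have : Continuous pe := by fun_prop
      have := this.tendsto 0
      simpa [pe] using this
    have hKe : ∀ ε z, Kp (KE F al) (pe ε) z = Kp (KE F al) p z + ε • (Pi' z - Sum.elim s0 0) := by
      intro ε z
      obtain ⟨s, x, rfl⟩ : ∃ s x, z = Sum.elim s x := ⟨z ∘ Sum.inl, z ∘ Sum.inr, (Sum.elim_comp_inl_inr z).symm⟩
      rw [hPi]
      exact KE_pe F al p s0 s x ε
    have hfe : ∀ ε, fderiv ℝ (Kp (KE F al) (pe ε)) (Sum.elim s0 x0) = L + ε • Pi' := by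
      intro ε
      have h1 : HasFDerivAt (Kp (KE F al) p) L (Sum.elim s0 x0) :=
        ((Kp_contDiff _ hreg p (n := 1)).differentiable (by norm_num) _).hasFDerivAt
      have h2 : HasFDerivAt (fun z => Kp (KE F al) p z + ε • (Pi' z - Sum.elim s0 0)) (L + ε • Pi') (Sum.elim s0 x0) :=
        h1.add ((Pi'.hasFDerivAt.sub_const _).const_smul ε)
      rw [← h2.fderiv]
      congr 1
      exact funext (hKe ε)
    have hfin : {c : ℝ | Module.End.HasEigenvalue (H : (σ → ℝ) →ₗ[ℝ] (σ → ℝ)) c}.Finite :=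
      Module.End.finite_hasEigenvalue _
    have hev := ev_fin _ hfin
    have hinj : ∀ ε, ¬ Module.End.HasEigenvalue (H : (σ → ℝ) →ₗ[ℝ] (σ → ℝ)) (-ε) → (L + ε • Pi').det ≠ 0 := by
      intro ε hε
      rw [clm_det_ne_iff]
      intro w hw
      obtain ⟨v, u, rfl⟩ : ∃ s x, w = Sum.elim s x := ⟨w ∘ Sum.inl, w ∘ Sum.inr, (Sum.elim_comp_inl_inr w).symm⟩
      have hLr : ∀ v u i, L (Sum.elim v u) (Sum.inr i) = fderiv ℝ F x0 u i - fderiv ℝ (Al al p) s0 v i := KE_row F hF hd al hal p s0 x0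
      have hu : fderiv ℝ F x0 (u - fderiv ℝ X s0 v) = 0 := by
        ext i
        have b1 := congrFun hw (Sum.inr i)
        have b2 := congrFun (hcore v) (Sum.inr i)
        rw [hLr] at b2
        simp only [ContinuousLinearMap.add_apply, Pi.add_apply, hLr, ContinuousLinearMap.smul_apply, hPi, Pi.smul_apply,
          Sum.elim_inr, Pi.zero_apply, smul_zero, add_zero] at b1 b2
        rw [map_sub, Pi.sub_apply, Pi.zero_apply]
        linarith
      have hu' : u = fderiv ℝ X s0 v := sub_eq_zero.1 ((clm_det_ne_iff _).1 (hd x0) _ hu)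
      rw [hu', ContinuousLinearMap.add_apply, hcore, ContinuousLinearMap.smul_apply, hPi] at hw
      have hHv : H v = (-ε) • v := by
        ext k
        have := congrFun hw (Sum.inl k)
        simp at this ⊢
        linarith
      have hv0 : v = 0 := by
        by_contra hv
        exact hε (Module.End.hasEigenvalue_of_hasEigenvector (x := v) ⟨Module.End.mem_eigenspace_iff.2 hHv, hv⟩)
      rw [hu', hv0]
      ext o; cases o <;> simp
    have hlim : ∀ᶠ ε in 𝓝[≠] (0:ℝ), 1 ≤ C * |(L + ε • Pi').det| := by
      filter_upwards [(hpe.mono_left nhdsWithin_le_nhds).eventually hC, hev] with ε h1 h2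
      have h3 := hinj ε h2
      rw [← hfe]
      refine (h1 (Sum.elim s0 x0) ?_ ?_).2
      · rw [hKe, hz0', hPi]; simp
      · rw [hfe]; exact h3
    have hcont : Tendsto (fun ε : ℝ => C * |(L + ε • Pi').det|) (𝓝[≠] 0) (𝓝 (C * |(L + (0:ℝ) • Pi').det|)) := by
      have : Continuous fun ε : ℝ => C * |(L + ε • Pi').det| := by
        have h1 : Continuous fun ε : ℝ => L + ε • Pi' := by fun_prop
        exact continuous_const.mul (ContinuousLinearMap.continuous_det.comp h1).abs
      exact (this.tendsto 0).mono_left nhdsWithin_le_nhds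
    have := ge_of_tendsto hcont hlim
    rw [zero_smul, add_zero, hdet] at this
    norm_num at this
  refine ⟨h, hh, D, fun p hp => ?_⟩
  obtain ⟨h1, h2, C, hC⟩ := hD p hp
  have hset : {x | Kp (KE F al) p x = 0 ∧ (fderiv ℝ (Kp (KE F al) p) x).det ≠ 0} = CR F al p := by
    ext z; exact ⟨fun h => h.1, fun h => ⟨h, nd p hp z h⟩⟩
  rw [hset] at h1 h2
  refine ⟨h1, h2, nd p hp, C, ?_⟩
  have hop : ∀ᶠ p' in 𝓝 p, MvPolynomial.eval p' h ≠ 0 :=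
    (MvPolynomial.continuous_eval h).continuousAt.eventually_ne hp
  filter_upwards [hC, hop] with p' a b z hz
  exact (a z hz (nd p' b z hz)).1
end ple2
end partC8

section partC9
open Filter Topology

section link
variable {σ μ π : Type} [Fintype σ] [Fintype μ] [DecidableEq σ] [DecidableEq μ] [Fintype π] [DecidableEq π]

noncomputable def En (p : π ⊕ (Unit ⊕ σ) → ℝ) (X : (σ → ℝ) → (μ → ℝ)) (s : σ → ℝ) : ℝ :=
  (∑ i, X s i ^ 2) / 2 + p (Sum.inr (Sum.inl ())) * ((∑ k, s k ^ 2) / 2) + ∑ k, p (Sum.inr (Sum.inr k)) * s k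

theorem En_contDiffAt (p : π ⊕ (Unit ⊕ σ) → ℝ) (X : (σ → ℝ) → (μ → ℝ)) (s : σ → ℝ) {n : WithTop ℕ∞} (hX : ContDiffAt ℝ n X s) :
    ContDiffAt ℝ n (En p X) s := by
  have h1 : ∀ i, ContDiffAt ℝ n (fun s => X s i) s := fun i => contDiffAt_pi.1 hX i
  have h2 : ∀ k : σ, ContDiffAt ℝ n (fun s : σ → ℝ => s k) s := fun k => (contDiff_apply ℝ ℝ k).contDiffAt
  unfold En
  refine (ContDiffAt.add (ContDiffAt.add ?_ ?_) ?_)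
  · exact (ContDiffAt.sum fun i _ => (h1 i).pow 2).div_const 2
  · exact contDiffAt_const.mul ((ContDiffAt.sum fun i _ => (h2 i).pow 2).div_const 2)
  · exact ContDiffAt.sum fun i _ => contDiffAt_const.mul (h2 i)

theorem grad_En (F : (μ → ℝ) → (μ → ℝ)) (hF : ∀ i, IsReg (fun x => F x i)) (hd : ∀ x, (fderiv ℝ F x).det ≠ 0)
    (al : μ → (σ ⊕ π → ℝ) → ℝ) (hal : ∀ i, IsReg (al i)) (p : π ⊕ (Unit ⊕ σ) → ℝ) (X : (σ → ℝ) → (μ → ℝ)) (s : σ → ℝ)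
    (hX : DifferentiableAt ℝ X s) (hFX : ∀ᶠ s' in 𝓝 s, F (X s') = Al al p s') :
    grad (En p X) s = Vf F al p X s := by
  have hFc : ContDiff ℝ 2 F := contDiff_pi.2 fun i => (hF i).contDiff
  have hAc := Al_contDiff al hal p (n := 2)
  funext k
  set w : μ → ℝ := fderiv ℝ X s (Pi.single k 1) with hw
  have h1 : ∀ i, HasFDerivAt (fun s => X s i) ((ContinuousLinearMap.proj i).comp (fderiv ℝ X s)) s :=
    fun i => hasFDerivAt_pi'.1 hX.hasFDerivAt i
  have h2 : ∀ k : σ, HasFDerivAt (fun s : σ → ℝ => s k) (ContinuousLinearMap.proj k : (σ → ℝ) →L[ℝ] ℝ) s := fun k => hasFDerivAt_apply k s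
  have hEd : HasFDerivAt (En p X) ((2:ℝ)⁻¹ • (∑ i, ((2:ℕ) • X s i ^ (2-1)) • ((ContinuousLinearMap.proj i).comp (fderiv ℝ X s)))
      + p (Sum.inr (Sum.inl ())) • ((2:ℝ)⁻¹ • (∑ k, ((2:ℕ) • s k ^ (2-1)) • (ContinuousLinearMap.proj k : (σ → ℝ) →L[ℝ] ℝ)))
      + ∑ k, p (Sum.inr (Sum.inr k)) • (ContinuousLinearMap.proj k : (σ → ℝ) →L[ℝ] ℝ)) s := by
    have e : En p X = fun s => (2:ℝ)⁻¹ * (∑ i, X s i ^ 2) + p (Sum.inr (Sum.inl ())) * ((2:ℝ)⁻¹ * (∑ k, s k ^ 2)) + ∑ k, p (Sum.inr (Sum.inr k)) * s k := by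
      funext s; unfold En; ring
    rw [e]
    refine HasFDerivAt.add (HasFDerivAt.add ?_ ?_) ?_
    · exact (HasFDerivAt.fun_sum fun i _ => (h1 i).pow 2).const_mul _
    · exact ((HasFDerivAt.fun_sum fun i _ => (h2 i).pow 2).const_mul _).const_mul _
    · exact HasFDerivAt.fun_sum fun i _ => (h2 i).const_mul _
  have hg : grad (En p X) s k = ∑ i, X s i * w i + p (Sum.inr (Sum.inl ())) * s k + p (Sum.inr (Sum.inr k)) := by
    rw [grad, hEd.fderiv]
    simp only [ContinuousLinearMap.add_apply, ContinuousLinearMap.smul_apply, ContinuousLinearMap.sum_apply, smul_eq_mul,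
      ContinuousLinearMap.comp_apply, ContinuousLinearMap.proj_apply, ← hw]
    simp only [Pi.single_apply, mul_ite, mul_one, mul_zero, Finset.sum_ite_eq', Finset.sum_ite_eq, Finset.mem_univ, if_true, nsmul_eq_mul]
    rw [Finset.mul_sum]
    congr 2
    · refine Finset.sum_congr rfl fun i _ => ?_
      norm_num; ring
    · norm_num
      left; ring
  rw [hg, Vf, KE_inl]
  congr 2
  refine Finset.sum_congr rfl fun i _ => ?_
  congr 1
  -- DF(X s) w = ∂_k Al
  have hal' : ∀ a, fderiv ℝ (al a) (Sum.elim s (fun a => p (Sum.inl a))) (Pi.single (Sum.inl k) 1) = fderiv ℝ (Al al p) s (Pi.single k 1) a := by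
    intro a
    let L : (σ → ℝ) →L[ℝ] (σ ⊕ π → ℝ) := ContinuousLinearMap.pi fun o => match o with
      | Sum.inl k => ContinuousLinearMap.proj k
      | Sum.inr i => 0
    have hW : HasFDerivAt (fun s => (Sum.elim s (fun a => p (Sum.inl a)) : σ ⊕ π → ℝ)) L s := by
      refine hasFDerivAt_pi.2 fun o => ?_
      cases o with
      | inl k => exact hasFDerivAt_apply k s
      | inr i => exact hasFDerivAt_const _ _
    have hL : L (Pi.single k 1) = Pi.single (Sum.inl k) 1 := by
      ext o
      cases o with
      | inl j => simp [L, Pi.single_apply]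
      | inr j => simp [L, Pi.single_apply]
    have b1 : HasFDerivAt (al a) (fderiv ℝ (al a) (Sum.elim s (fun a => p (Sum.inl a)))) (Sum.elim s (fun a => p (Sum.inl a))) :=
      (((hal a).contDiff (n := 1)).differentiable (by norm_num) _).hasFDerivAt
    have b2 : HasFDerivAt (fun s => Al al p s a) ((fderiv ℝ (al a) (Sum.elim s (fun a => p (Sum.inl a)))).comp L) s := b1.comp s hW
    have b3 := hasFDerivAt_pi'.1 (hAc.differentiable (by norm_num) s).hasFDerivAt a
    have b4 := congrArg (fun L => L (Pi.single k 1)) (b2.unique b3)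
    simp only [ContinuousLinearMap.comp_apply, hL] at b4
    exact b4
  have hmul : (Jm F (X s)).mulVec w = fun a => fderiv ℝ (Al al p) s (Pi.single k 1) a := by
    have c1 : HasFDerivAt (fun s => F (X s)) ((fderiv ℝ F (X s)).comp (fderiv ℝ X s)) s :=
      (hFc.differentiable (by norm_num) (X s)).hasFDerivAt.comp s hX.hasFDerivAt
    have c2 := (c1.congr_of_eventuallyEq (EventuallyEq.symm hFX)).unique (hAc.differentiable (by norm_num) s).hasFDerivAt
    have c3 : fderiv ℝ F (X s) w = fderiv ℝ (Al al p) s (Pi.single k 1) := congrArg (fun L => L (Pi.single k 1)) c2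
    funext a
    rw [← c3]
    have c4 := hasFDerivAt_pi'.1 (hFc.differentiable (by norm_num) (X s)).hasFDerivAt a
    have c5 : fderiv ℝ F (X s) w a = fderiv ℝ (fun x => F x a) (X s) w := by rw [c4.fderiv]; rfl
    rw [c5, fderiv_eq_grad]
    rfl
  have hdet : IsUnit (Jm F (X s)).det := by rw [Jm_det F hFc]; exact isUnit_iff_ne_zero.2 (hd _)
  have : w = (Jm F (X s))⁻¹.mulVec fun a => fderiv ℝ (Al al p) s (Pi.single k 1) a := by
    rw [← hmul, Matrix.mulVec_mulVec, Matrix.nonsing_inv_mul _ hdet, Matrix.one_mulVec]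
  rw [this]
  simp only [hal', Matrix.mulVec, dotProduct]

theorem LINK (F : (μ → ℝ) → (μ → ℝ)) (hF : ∀ i, IsReg (fun x => F x i)) (hd : ∀ x, (fderiv ℝ F x).det ≠ 0)
    (al : μ → (σ ⊕ π → ℝ) → ℝ) (hal : ∀ i, IsReg (al i)) (p : π ⊕ (Unit ⊕ σ) → ℝ) (X : (σ → ℝ) → (μ → ℝ)) (s0 : σ → ℝ)
    (hX : ContDiffAt ℝ 2 X s0) (hFX : ∀ᶠ s in 𝓝 s0, F (X s) = Al al p s) (E : (σ → ℝ) → ℝ) (hE : E =ᶠ[𝓝 s0] En p X) :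
    ContDiffAt ℝ 2 E s0 ∧ (grad E s0 = 0 ↔ Sum.elim s0 (X s0) ∈ CR F al p) ∧
      ((fderiv ℝ (Kp (KE F al) p) (Sum.elim s0 (X s0))).det ≠ 0 → (fderiv ℝ (grad E) s0).det ≠ 0) := by
  have hEc : ContDiffAt ℝ 2 E s0 := (En_contDiffAt p X s0 hX).congr_of_eventuallyEq hE
  have hgr : grad E =ᶠ[𝓝 s0] Vf F al p X := by
    filter_upwards [hX.eventually (by norm_num), eventually_eventually_nhds.2 hFX, eventually_eventually_nhds.2 hE] with s h1 h2 h3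
    rw [grad_congr h3, grad_En F hF hd al hal p X s (h1.differentiableAt (by norm_num)) h2]
  refine ⟨hEc, ?_, ?_⟩
  · rw [hgr.self_of_nhds]
    constructor
    · intro h
      show Kp (KE F al) p (Sum.elim s0 (X s0)) = 0
      ext o
      cases o with
      | inl k => exact congrFun h k
      | inr i => rw [KE_inr, hFX.self_of_nhds, sub_self]; rfl
    · intro h
      have h' : Kp (KE F al) p (Sum.elim s0 (X s0)) = 0 := h
      ext k
      exact congrFun h' (Sum.inl k)
  · intro hK
    rw [hgr.fderiv_eq, clm_det_ne_iff]
    intro v hv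
    have h1 := link_core F hF hd al hal p X s0 (hX.differentiableAt (by norm_num)) hFX v
    rw [hv] at h1
    have h2 := (clm_det_ne_iff _).1 hK _ (h1.trans (by ext o; cases o <;> rfl))
    ext k
    exact congrFun h2 (Sum.inl k)
end link
end partC9

section partD1
open Filter Topology

section fib
variable {μ : Type} [Fintype μ] [DecidableEq μ]

theorem poly_dense {ι : Type} [Fintype ι] [DecidableEq ι] (h : MvPolynomial ι ℝ) (hh : h ≠ 0) (O : Set (ι → ℝ)) (p0 : ι → ℝ)
    (hO : O ∈ 𝓝 p0) : ∃ p ∈ O, MvPolynomial.eval p h ≠ 0 := by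
  obtain ⟨ε, hε, hb⟩ := Metric.mem_nhds_iff.1 hO
  by_contra hcon
  push Not at hcon
  apply hh
  refine MvPolynomial.funext_set (fun i => Metric.ball (p0 i) ε) (fun i => ?_) ?_
  · rw [Real.ball_eq_Ioo]
    exact Set.Ioo_infinite (by linarith)
  · intro p hp
    rw [map_zero]
    apply hcon p (hb _)
    rw [Metric.mem_ball, dist_pi_lt_iff hε]
    intro i
    exact hp i (Set.mem_univ i)

theorem fib_local (F : (μ → ℝ) → (μ → ℝ)) (hF : ContDiff ℝ 2 F) (hd : ∀ x, (fderiv ℝ F x).det ≠ 0) (y0 : μ → ℝ)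
    (K : Set (μ → ℝ)) (hK : K ∈ 𝓝 y0) (hFK : IsCompact (F ⁻¹' K)) :
    (F ⁻¹' {y0}).Finite ∧ ∃ X : Fin (F ⁻¹' {y0}).ncard → (μ → ℝ) → (μ → ℝ), (∀ a, ContDiffAt ℝ 2 (X a) y0) ∧
      ∀ᶠ y in 𝓝 y0, Function.Injective (fun a => X a y) ∧ Set.range (fun a => X a y) = F ⁻¹' {y} := by
  choose G hG1 hG2 hG3 hG4 using fun x => loc_inv F hF x (hd x)
  have hy0K : y0 ∈ K := mem_of_mem_nhds hK
  have hSc : IsCompact (F ⁻¹' {y0}) := hFK.of_isClosed_subset (isClosed_singleton.preimage hF.continuous)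
    (Set.preimage_mono (by simpa using hy0K))
  have hfin : (F ⁻¹' {y0}).Finite := by
    obtain ⟨t, ht1, ht2⟩ := hSc.elim_nhds_subcover (fun x => {x' | G x (F x') = x'}) (fun x _ => hG4 x)
    refine t.finite_toSet.subset fun x' hx' => ?_
    obtain ⟨x, hx, hxx⟩ := Set.mem_iUnion₂.1 (ht2 hx')
    have h1 : G x (F x') = x' := hxx
    have h2 : F x = y0 := ht1 x hx
    have h3 : F x' = y0 := hx'
    rw [h3, ← h2, hG2] at h1
    rw [← h1]; exact hx
  refine ⟨hfin, ?_⟩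
  haveI : Fintype (F ⁻¹' {y0}) := hfin.fintype
  let e : Fin (F ⁻¹' {y0}).ncard ≃ (F ⁻¹' {y0}) :=
    (Fintype.equivFinOfCardEq (by rw [← Nat.card_eq_fintype_card, Nat.card_coe_set_eq])).symm
  have he : ∀ a, F (e a) = y0 := fun a => (e a).2
  refine ⟨fun a => G (e a), fun a => by have := hG1 (e a); rwa [he a] at this, ?_⟩
  have hcont : ∀ a, ContinuousAt (G (e a)) y0 := fun a => by
    have := (hG1 (e a)).continuousAt; rwa [he a] at this
  have hval : ∀ a, G (e a) y0 = e a := fun a => by have := hG2 (e a); rwa [he a] at this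
  have hinj : ∀ᶠ y in 𝓝 y0, ∀ a b, a ≠ b → G (e a) y ≠ G (e b) y := by
    refine eventually_all.2 fun a => eventually_all.2 fun b => ?_
    by_cases hab : a = b
    · exact Eventually.of_forall fun y h => absurd hab h
    · have h1 : G (e a) y0 ≠ G (e b) y0 := by
        rw [hval, hval]; intro h; exact hab (e.injective (Subtype.ext h))
      filter_upwards [((hcont a).prodMk (hcont b)).eventually (isOpen_ne_fun continuous_fst continuous_snd |>.mem_nhds h1)] with y hy _
      exact hy
  have hright : ∀ᶠ y in 𝓝 y0, ∀ a, F (G (e a) y) = y := by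
    refine eventually_all.2 fun a => ?_
    have := hG3 (e a); rwa [he a] at this
  let N : Set (μ → ℝ) := ⋃ a, interior {x' | G (e a) (F x') = x'}
  have hNo : IsOpen N := isOpen_iUnion fun a => isOpen_interior
  have hC : IsCompact (F '' (F ⁻¹' K \ N)) := (hFK.diff hNo).image hF.continuous
  have hy0C : y0 ∉ F '' (F ⁻¹' K \ N) := by
    rintro ⟨x, ⟨-, hxN⟩, hx⟩
    apply hxN
    refine Set.mem_iUnion.2 ⟨e.symm ⟨x, hx⟩, ?_⟩
    rw [mem_interior_iff_mem_nhds, Equiv.apply_symm_apply]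
    exact hG4 x
  filter_upwards [hinj, hright, hK, hC.isClosed.isOpen_compl.mem_nhds hy0C] with y h1 h2 h3 h4
  refine ⟨fun a b hab => by_contra fun hne => h1 a b hne hab, ?_⟩
  ext x
  constructor
  · rintro ⟨a, rfl⟩; exact h2 a
  · intro hx
    have hx' : F x = y := hx
    have hxN : x ∈ N := by
      by_contra hxN
      exact h4 ⟨x, ⟨by rw [Set.mem_preimage, hx']; exact h3, hxN⟩, hx'⟩
    obtain ⟨a, ha⟩ := Set.mem_iUnion.1 hxN
    have h50 : x ∈ {x' | G (e a) (F x') = x'} := interior_subset ha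
    have h5 : G (e a) (F x) = x := h50
    rw [hx'] at h5
    exact ⟨a, h5⟩

theorem fib_const (F : (μ → ℝ) → (μ → ℝ)) (hF : ContDiff ℝ 2 F) (hd : ∀ x, (fderiv ℝ F x).det ≠ 0)
    (hp : ∀ y ∈ Set.range F, ∃ K ∈ 𝓝 y, IsCompact (F ⁻¹' K)) :
    ∃ d : ℕ, ∀ x, (F ⁻¹' {F x}).Finite ∧ (F ⁻¹' {F x}).ncard = d ∧ ∃ X : Fin d → (μ → ℝ) → (μ → ℝ), (∀ a, ContDiffAt ℝ 2 (X a) (F x)) ∧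
      ∀ᶠ y in 𝓝 (F x), Function.Injective (fun a => X a y) ∧ Set.range (fun a => X a y) = F ⁻¹' {y} := by
  have hlc : IsLocallyConstant fun x => (F ⁻¹' {F x}).ncard := by
    rw [IsLocallyConstant.iff_eventually_eq]
    intro x
    obtain ⟨K, hK, hFK⟩ := hp (F x) ⟨x, rfl⟩
    obtain ⟨hf, X, -, hX⟩ := fib_local F hF hd (F x) K hK hFK
    filter_upwards [hF.continuous.continuousAt.eventually hX] with x' hx'
    rw [← hx'.2, ← Set.image_univ, Set.ncard_image_of_injective _ hx'.1, Set.ncard_univ, Nat.card_fin]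
  refine ⟨(F ⁻¹' {F 0}).ncard, fun x => ?_⟩
  have h0 : (F ⁻¹' {F x}).ncard = (F ⁻¹' {F 0}).ncard := hlc.apply_eq_of_preconnectedSpace x 0
  obtain ⟨K, hK, hFK⟩ := hp (F x) ⟨x, rfl⟩
  obtain ⟨hf, X, hX⟩ := fib_local F hF hd (F x) K hK hFK
  refine ⟨hf, h0, ?_⟩
  rw [← h0]
  exact ⟨X, hX⟩
end fib
end partD1

section partD2
open Filter Topology

section pullb
variable {μ : Type} [Fintype μ] [DecidableEq μ]

theorem grad_comp' (E : (μ → ℝ) → ℝ) (F : (μ → ℝ) → (μ → ℝ)) (hF : ContDiff ℝ 2 F) (x : μ → ℝ) (hE : DifferentiableAt ℝ E (F x)) :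
    grad (E ∘ F) x = fun j => ∑ i, Jm F x i j * grad E (F x) i := by
  funext j
  have hFx := (hF.differentiable (by norm_num) x)
  have h1 : fderiv ℝ (E ∘ F) x = (fderiv ℝ E (F x)).comp (fderiv ℝ F x) := fderiv_comp x hE hFx
  unfold grad
  rw [h1, ContinuousLinearMap.comp_apply, fderiv_eq_grad]
  refine Finset.sum_congr rfl fun i _ => ?_
  rw [mul_comm]
  congr 1
  have := (hasFDerivAt_pi'.1 hFx.hasFDerivAt i).fderiv
  simp only [Jm, Matrix.of_apply]
  rw [this]; rfl

theorem hess_comp (E : (μ → ℝ) → ℝ) (F : (μ → ℝ) → (μ → ℝ)) (hF : ContDiff ℝ 2 F) (x : μ → ℝ) (hE : ContDiffAt ℝ 2 E (F x))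
    (h0 : grad E (F x) = 0) :
    (fderiv ℝ (grad (E ∘ F)) x).det = (fderiv ℝ F x).det ^ 2 * (fderiv ℝ (grad E) (F x)).det := by
  have hFx := (hF.differentiable (by norm_num) x)
  have hev : grad (E ∘ F) =ᶠ[𝓝 x] fun x' j => ∑ i, Jm F x' i j * grad E (F x') i := by
    have h1 : ∀ᶠ y in 𝓝 (F x), ContDiffAt ℝ 2 E y := hE.eventually (by norm_num)
    filter_upwards [hFx.continuousAt.eventually h1] with x' hx'
    exact grad_comp' E F hF x' (hx'.differentiableAt (by norm_num))
  have hG : HasFDerivAt (grad E) (fderiv ℝ (grad E) (F x)) (F x) :=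
    ((grad_contDiffAt E (F x) hE).differentiableAt (by norm_num)).hasFDerivAt
  have hGF := hG.comp x hFx.hasFDerivAt
  have hJ : ∀ i j, DifferentiableAt ℝ (fun x' => Jm F x' i j) x := by
    intro i j
    have h1 : ContDiffAt ℝ 1 (grad (fun x => F x i)) x := grad_contDiffAt _ _ (contDiff_pi.1 hF i).contDiffAt
    exact (contDiffAt_pi.1 h1 j).differentiableAt (by norm_num)
  let A : (μ → ℝ) →L[ℝ] (μ → ℝ) := LinearMap.toContinuousLinearMap (Matrix.toLin' (Jm F x).transpose)
  have hA : ∀ v j, A v j = ∑ i, Jm F x i j * v i := by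
    intro v j
    simp [A, Matrix.toLin'_apply, Matrix.mulVec, dotProduct]
  have hder : HasFDerivAt (fun x' j => ∑ i, Jm F x' i j * grad E (F x') i)
      (A.comp ((fderiv ℝ (grad E) (F x)).comp (fderiv ℝ F x))) x := by
    refine hasFDerivAt_pi'.2 fun j => ?_
    have h1 := HasFDerivAt.fun_sum (u := Finset.univ) fun i _ => (hJ i j).hasFDerivAt.mul (hasFDerivAt_pi'.1 hGF i)
    refine h1.congr_fderiv ?_
    ext v
    have h00 : ∀ i, grad E (F x) i = 0 := fun i => by rw [h0]; rfl
    simp [hA, h00]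
  rw [(hder.congr_of_eventuallyEq hev).fderiv]
  have hdA : A.det = (fderiv ℝ F x).det := by
    rw [← Jm_det F hF, ← Matrix.det_transpose]
    simp [A, ContinuousLinearMap.det]
  have h2 : (A.comp ((fderiv ℝ (grad E) (F x)).comp (fderiv ℝ F x))).det = A.det * ((fderiv ℝ (grad E) (F x)).det * (fderiv ℝ F x).det) := by
    simp only [ContinuousLinearMap.det, ContinuousLinearMap.toLinearMap_comp, LinearMap.det_comp]
  rw [h2, hdA]; ring
end pullb
end partD2

section partD3
open Filter Topology

section inj
variable {μ : Type} [Fintype μ] [DecidableEq μ]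

theorem sign_int (r : ℝ) : ∃ m : ℤ, Real.sign r = m := by
  rcases Real.sign_apply_eq r with h | h | h <;> rw [h]
  · exact ⟨-1, by norm_num⟩
  · exact ⟨0, by norm_num⟩
  · exact ⟨1, by norm_num⟩

theorem sign_sq_mul (a b : ℝ) (ha : a ≠ 0) : Real.sign (a ^ 2 * b) = Real.sign b := by
  have : 0 < a ^ 2 := by positivity
  rcases lt_trichotomy b 0 with h | h | h
  · rw [Real.sign_of_neg h, Real.sign_of_neg (mul_neg_of_pos_of_neg this h)]
  · simp [h]
  · rw [Real.sign_of_pos h, Real.sign_of_pos (mul_pos this h)]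

theorem norm_sq_le_sum (x : μ → ℝ) : ‖x‖ ^ 2 ≤ ∑ i, x i ^ 2 := by
  have h : ‖x‖ ≤ Real.sqrt (∑ i, x i ^ 2) := by
    rw [pi_norm_le_iff_of_nonneg (Real.sqrt_nonneg _)]
    intro i
    rw [Real.norm_eq_abs]
    apply Real.abs_le_sqrt
    exact Finset.single_le_sum (f := fun i => x i ^ 2) (fun i _ => sq_nonneg _) (Finset.mem_univ i)
  calc ‖x‖ ^ 2 ≤ Real.sqrt (∑ i, x i ^ 2) ^ 2 := by gcongr
    _ = _ := Real.sq_sqrt (Finset.sum_nonneg fun i _ => sq_nonneg _)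

theorem quad_low (κ : ℝ) (hκ : 0 < κ) (q y : μ → ℝ) : -(∑ k, q k ^ 2) / (2 * κ) ≤ κ * ((∑ k, y k ^ 2) / 2) + ∑ k, q k * y k := by
  rw [neg_div, Finset.sum_div, Finset.sum_div, Finset.mul_sum, ← Finset.sum_add_distrib, ← Finset.sum_neg_distrib]
  refine Finset.sum_le_sum fun k _ => ?_
  have h : κ * (y k ^ 2 / 2) + q k * y k - -(q k ^ 2 / (2 * κ)) = (κ * y k + q k) ^ 2 / (2 * κ) := by field_simp; ring
  have : 0 ≤ (κ * y k + q k) ^ 2 / (2 * κ) := by positivity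
  linarith

theorem coer_of_sq (M : (μ → ℝ) → ℝ) (C : ℝ) (h : ∀ x, (∑ i, x i ^ 2) / 2 - C ≤ M x) : Tendsto M (cocompact _) atTop := by
  refine tendsto_atTop_mono (f := fun x => ‖x‖ ^ 2 / 2 - C) (fun x => ?_) ?_
  · have := norm_sq_le_sum x
    have := h x
    linarith
  · refine tendsto_atTop_add_const_right _ _ ?_
    refine Tendsto.atTop_div_const (by norm_num) ?_
    exact (tendsto_pow_atTop (by norm_num)).comp (tendsto_norm_cocompact_atTop)

def Fpow (F : (μ → ℝ) → (μ → ℝ)) (d : ℕ) : (Fin d × μ → ℝ) → (Fin d × μ → ℝ) := fun x ai => F (fun j => x (ai.1, j)) ai.2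

theorem Fpow_reg (F : (μ → ℝ) → (μ → ℝ)) (hF : ∀ i, IsReg (fun x => F x i)) (d : ℕ) : ∀ i, IsReg (fun x => Fpow F d x i) :=
  fun ai => (hF ai.2).comp (g := fun x j => x (ai.1, j)) (fun j => IsReg.coord _)

theorem Fpow_det (F : (μ → ℝ) → (μ → ℝ)) (hF : ContDiff ℝ 2 F) (hd : ∀ x, (fderiv ℝ F x).det ≠ 0) (d : ℕ) (x) :
    (fderiv ℝ (Fpow F d) x).det ≠ 0 := by
  have h1 : HasFDerivAt (Fpow F d) (ContinuousLinearMap.pi fun ai : Fin d × μ => (ContinuousLinearMap.proj ai.2).comp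
      ((fderiv ℝ F (fun j => x (ai.1, j))).comp (ContinuousLinearMap.pi fun j => ContinuousLinearMap.proj (ai.1, j)))) x := by
    refine hasFDerivAt_pi.2 fun ai => ?_
    have hin : HasFDerivAt (fun (x : Fin d × μ → ℝ) j => x (ai.1, j)) (ContinuousLinearMap.pi fun j => ContinuousLinearMap.proj (R := ℝ) (ai.1, j)) x :=
      hasFDerivAt_pi.2 fun j => hasFDerivAt_apply _ _
    have hFd : HasFDerivAt F (fderiv ℝ F (fun j => x (ai.1, j))) (fun j => x (ai.1, j)) := (hF.differentiable (by norm_num) _).hasFDerivAt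
    exact hasFDerivAt_pi'.1 (hFd.comp x hin) ai.2
  rw [clm_det_ne_iff, h1.fderiv]
  intro v hv
  have h2 : ∀ a, (fun j => v (a, j)) = 0 := by
    intro a
    apply (clm_det_ne_iff _).1 (hd (fun j => x (a, j)))
    funext i
    exact congrFun hv (a, i)
  funext ai
  exact congrFun (h2 ai.1) ai.2

theorem inj_of_proper (F : (μ → ℝ) → (μ → ℝ)) (hF : ∀ i, IsReg (fun x => F x i)) (hd : ∀ x, (fderiv ℝ F x).det ≠ 0)
    (hp : ∀ y ∈ Set.range F, ∃ K ∈ 𝓝 y, IsCompact (F ⁻¹' K)) : Function.Injective F := by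
  have hFc : ContDiff ℝ 2 F := contDiff_pi.2 fun i => (hF i).contDiff
  obtain ⟨d, hfib⟩ := fib_const F hFc hd hp
  let al : Fin d × μ → (μ ⊕ Empty → ℝ) → ℝ := fun ai z => z (Sum.inl ai.2)
  have hal : ∀ ai, IsReg (al ai) := fun ai => IsReg.coord _
  obtain ⟨h, hh, D, hPLE⟩ := PLE (Fpow F d) (Fpow_reg F hF d) (Fpow_det F hFc hd d) al hal
  obtain ⟨p, hpκ, hph⟩ := poly_dense h hh {p | 0 < p (Sum.inr (Sum.inl ()))} (fun _ => 1)
    ((isOpen_lt continuous_const (continuous_apply _)).mem_nhds (by show (0:ℝ) < 1; norm_num))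
  obtain ⟨hCfin, -, hCdet, -⟩ := hPLE p hph
  set κ := p (Sum.inr (Sum.inl ())) with hκ
  have hκ0 : 0 < κ := hpκ
  let q : μ → ℝ := fun k => p (Sum.inr (Sum.inr k))
  let E : (μ → ℝ) → ℝ := fun y => (∑ᶠ x ∈ F ⁻¹' {y}, ∑ i, x i ^ 2) / 2 + κ * ((∑ k, y k ^ 2) / 2) + ∑ k, q k * y k
  have key : ∀ x, ContDiffAt ℝ 2 E (F x) ∧ (grad E (F x) = 0 → F x ∈ (fun z : μ ⊕ (Fin d × μ) → ℝ => fun k => z (Sum.inl k)) '' CR (Fpow F d) al p ∧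
      (fderiv ℝ (grad E) (F x)).det ≠ 0) := by
    intro x
    obtain ⟨-, -, X, hX1, hX2⟩ := hfib x
    let XX : (μ → ℝ) → (Fin d × μ → ℝ) := fun y ai => X ai.1 y ai.2
    have hXX : ContDiffAt ℝ 2 XX (F x) := contDiffAt_pi.2 fun ai => contDiffAt_pi.1 (hX1 ai.1) ai.2
    have hFX : ∀ᶠ y in 𝓝 (F x), Fpow F d (XX y) = Al al p y := by
      filter_upwards [hX2] with y hy
      funext ai
      have h1 : X ai.1 y ∈ F ⁻¹' {y} := by rw [← hy.2]; exact ⟨ai.1, rfl⟩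
      exact congrFun h1 ai.2
    have hE : E =ᶠ[𝓝 (F x)] En p XX := by
      filter_upwards [hX2] with y hy
      show _ = _
      simp only [E, En]
      rw [← hy.2, finsum_mem_range hy.1, finsum_eq_sum_of_fintype, Fintype.sum_prod_type]
    obtain ⟨l1, l2, l3⟩ := LINK (Fpow F d) (Fpow_reg F hF d) (Fpow_det F hFc hd d) al hal p XX (F x) hXX hFX E hE
    refine ⟨l1, fun h0 => ?_⟩
    have h1 := l2.1 h0
    exact ⟨⟨_, h1, rfl⟩, l3 (hCdet _ h1)⟩
  have hMc : ContDiff ℝ 2 (E ∘ F) := contDiff_iff_contDiffAt.2 fun x => (key x).1.comp x hFc.contDiffAt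
  have hgM : ∀ x, grad (E ∘ F) x = 0 ↔ grad E (F x) = 0 := by
    intro x
    rw [grad_comp' E F hFc x ((key x).1.differentiableAt (by norm_num))]
    constructor
    · intro h0
      apply Matrix.eq_zero_of_vecMul_eq_zero (M := Jm F x) (by rw [Jm_det F hFc]; exact hd x)
      funext j
      have := congrFun h0 j
      rw [← this]
      simp [Matrix.vecMul, dotProduct, mul_comm]
    · intro h0; rw [h0]; funext j; simp
  have hfinM : {x | grad (E ∘ F) x = 0}.Finite := by
    have h1 : (F ⁻¹' {y | y ∈ Set.range F ∧ grad E y = 0}).Finite := by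
      refine Set.Finite.preimage' ((hCfin.image (fun z : μ ⊕ (Fin d × μ) → ℝ => fun k => z (Sum.inl k))).subset ?_) ?_
      · rintro _ ⟨⟨x, rfl⟩, h0⟩; exact ((key x).2 h0).1
      · rintro _ ⟨⟨x, rfl⟩, h0⟩; exact (hfib x).1
    refine h1.subset fun x hx => ⟨⟨x, rfl⟩, (hgM x).1 hx⟩
  have hco : Tendsto (E ∘ F) (cocompact _) atTop := by
    refine coer_of_sq _ ((∑ k, q k ^ 2) / (2 * κ)) fun x => ?_
    have h1 := quad_low κ hκ0 q (F x)
    have h2 : ∑ i, x i ^ 2 ≤ ∑ᶠ x' ∈ F ⁻¹' {F x}, ∑ i, x' i ^ 2 := by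
      rw [finsum_mem_eq_finite_toFinset_sum _ (hfib x).1]
      exact Finset.single_le_sum (f := fun x : μ → ℝ => ∑ i, x i ^ 2) (fun x' _ => Finset.sum_nonneg fun i _ => sq_nonneg _)
        ((hfib x).1.mem_toFinset.2 rfl)
    simp only [Function.comp, E]
    rw [neg_div] at h1
    linarith
  have hG := GD1 (E ∘ F) hMc hco hfinM.toFinset (fun s => by simp) (fun z hz => by
    have h0 : grad E (F z) = 0 := (hgM z).1 (by simpa using hz)
    rw [hess_comp E F hFc z (key z).1 h0]
    exact mul_ne_zero (pow_ne_zero _ (hd z)) ((key z).2 h0).2)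
  rw [Finset.sum_congr rfl (g := fun z => Real.sign (fderiv ℝ (grad E) (F z)).det) (fun z hz => by
    have h0 : grad E (F z) = 0 := (hgM z).1 (by simpa using hz)
    rw [hess_comp E F hFc z (key z).1 h0, sign_sq_mul _ _ (hd z)])] at hG
  have hsc := Finset.sum_comp (s := hfinM.toFinset) (fun y => Real.sign (fderiv ℝ (grad E) y).det) F
  rw [hsc, Finset.sum_congr rfl (g := fun y => (d : ℝ) * Real.sign (fderiv ℝ (grad E) y).det)] at hG
  · choose m hm using sign_int
    rw [← Finset.mul_sum, Finset.sum_congr rfl (fun y _ => hm _), ← Int.cast_sum] at hG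
    have h1 : (d : ℤ) * ∑ y ∈ hfinM.toFinset.image F, m (fderiv ℝ (grad E) y).det = 1 := by exact_mod_cast hG
    have h2 := Int.eq_one_or_neg_one_of_mul_eq_one h1
    have h3 : d = 1 := by omega
    intro x x' hxx
    have h4 := (hfib x).2.1
    rw [h3, Set.ncard_eq_one] at h4
    obtain ⟨a, ha⟩ := h4
    have e1 : x ∈ F ⁻¹' {F x} := rfl
    have e2 : x' ∈ F ⁻¹' {F x} := hxx.symm
    rw [ha] at e1 e2
    rw [e1, e2]
  · intro y hy
    obtain ⟨z, hz, rfl⟩ := Finset.mem_image.1 hy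
    have h0 : grad E (F z) = 0 := (hgM z).1 (by simpa using hz)
    rw [nsmul_eq_mul]
    congr 2
    rw [← (hfib z).2.1, ← Set.ncard_coe_finset]
    congr 1
    ext x
    simp only [Finset.coe_filter, Set.Finite.mem_toFinset, Set.mem_ofPred_eq, Set.mem_preimage, Set.mem_singleton_iff]
    refine ⟨fun h => h.2, fun h => ⟨(hgM x).2 (by rw [h]; exact h0), h⟩⟩
end inj
end partD3

section partE1
open Filter Topology

section e1
variable {σ μ π : Type} [Fintype σ] [Fintype μ] [DecidableEq σ] [DecidableEq μ] [Fintype π] [DecidableEq π]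

theorem rg_open (F : (μ → ℝ) → (μ → ℝ)) (hF : ContDiff ℝ 2 F) (hd : ∀ x, (fderiv ℝ F x).det ≠ 0) : IsOpen (Set.range F) := by
  rw [isOpen_iff_mem_nhds]
  rintro _ ⟨x, rfl⟩
  obtain ⟨G, -, -, h, -⟩ := loc_inv F hF x (hd x)
  filter_upwards [h] with y hy
  exact ⟨G y, hy⟩

theorem inv_contDiffAt (F : (μ → ℝ) → (μ → ℝ)) (hF : ContDiff ℝ 2 F) (hd : ∀ x, (fderiv ℝ F x).det ≠ 0) (hi : Function.Injective F)
    (y : μ → ℝ) (hy : y ∈ Set.range F) : ContDiffAt ℝ 2 (Function.invFun F) y := by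
  obtain ⟨x, rfl⟩ := hy
  obtain ⟨G, h1, -, h, -⟩ := loc_inv F hF x (hd x)
  refine h1.congr_of_eventuallyEq ?_
  filter_upwards [h] with y hy
  have := Function.leftInverse_invFun hi (G y)
  rwa [hy] at this

theorem inv_blow (F : (μ → ℝ) → (μ → ℝ)) (hF : Continuous F) (z : μ → ℝ) (hz : z ∉ Set.range F) (R : ℝ) :
    ∀ᶠ y in 𝓝 z, y ∈ Set.range F → R < ‖Function.invFun F y‖ := by
  have h1 : IsCompact (F '' Metric.closedBall 0 R) := (isCompact_closedBall _ _).image hF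
  have h2 : z ∉ F '' Metric.closedBall 0 R := fun ⟨x, _, hx⟩ => hz ⟨x, hx⟩
  filter_upwards [h1.isClosed.isOpen_compl.mem_nhds h2] with y hy hyr
  by_contra hcon
  exact hy ⟨Function.invFun F y, by simpa using hcon, Function.invFun_eq hyr⟩

noncomputable def EG (F : (μ → ℝ) → (μ → ℝ)) (al : μ → (σ ⊕ π → ℝ) → ℝ) (p : π ⊕ (Unit ⊕ σ) → ℝ) : (σ → ℝ) → ℝ :=
  En p (fun s => Function.invFun F (Al al p s))

theorem EG_low (F : (μ → ℝ) → (μ → ℝ)) (al : μ → (σ ⊕ π → ℝ) → ℝ) (p : π ⊕ (Unit ⊕ σ) → ℝ) (s : σ → ℝ)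
    (hκ : 0 < p (Sum.inr (Sum.inl ()))) :
    ‖Function.invFun F (Al al p s)‖ ^ 2 / 2 - (∑ k, p (Sum.inr (Sum.inr k)) ^ 2) / (2 * p (Sum.inr (Sum.inl ()))) ≤ EG F al p s := by
  have h1 := quad_low _ hκ (fun k => p (Sum.inr (Sum.inr k))) s
  have h2 := norm_sq_le_sum (Function.invFun F (Al al p s))
  rw [neg_div] at h1
  unfold EG En
  linarith

theorem EG_link (F : (μ → ℝ) → (μ → ℝ)) (hF : ∀ i, IsReg (fun x => F x i)) (hd : ∀ x, (fderiv ℝ F x).det ≠ 0)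
    (hi : Function.Injective F) (al : μ → (σ ⊕ π → ℝ) → ℝ) (hal : ∀ i, IsReg (al i)) (p : π ⊕ (Unit ⊕ σ) → ℝ) (s : σ → ℝ)
    (hs : Al al p s ∈ Set.range F) : ContDiffAt ℝ 2 (EG F al p) s ∧
      (grad (EG F al p) s = 0 ↔ Sum.elim s (Function.invFun F (Al al p s)) ∈ CR F al p) ∧
      ((fderiv ℝ (Kp (KE F al) p) (Sum.elim s (Function.invFun F (Al al p s)))).det ≠ 0 → (fderiv ℝ (grad (EG F al p)) s).det ≠ 0) := by
  have hFc : ContDiff ℝ 2 F := contDiff_pi.2 fun i => (hF i).contDiff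
  have hA := Al_contDiff al hal p (n := 2)
  refine LINK F hF hd al hal p (fun s => Function.invFun F (Al al p s)) s ?_ ?_ _ (EventuallyEq.refl _ _)
  · exact (inv_contDiffAt F hFc hd hi _ hs).comp s hA.contDiffAt
  · filter_upwards [hA.continuous.continuousAt.eventually ((rg_open F hFc hd).mem_nhds hs)] with s' hs'
    exact Function.invFun_eq hs'

theorem CR_elim (F : (μ → ℝ) → (μ → ℝ)) (hi : Function.Injective F) (al : μ → (σ ⊕ π → ℝ) → ℝ) (p : π ⊕ (Unit ⊕ σ) → ℝ)
    (z : σ ⊕ μ → ℝ) (hz : z ∈ CR F al p) : Al al p (fun k => z (Sum.inl k)) ∈ Set.range F ∧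
      z = Sum.elim (fun k => z (Sum.inl k)) (Function.invFun F (Al al p (fun k => z (Sum.inl k)))) := by
  have e : z = Sum.elim (fun k => z (Sum.inl k)) (fun i => z (Sum.inr i)) := by
    funext o; cases o <;> rfl
  have h1 : F (fun i => z (Sum.inr i)) = Al al p (fun k => z (Sum.inl k)) := by
    funext i
    have h2 : Kp (KE F al) p z = 0 := hz
    have h3 := congrFun h2 (Sum.inr i)
    rw [e, KE_inr] at h3
    exact sub_eq_zero.1 h3
  refine ⟨⟨_, h1⟩, ?_⟩
  rw [← h1, Function.leftInverse_invFun hi]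
  exact e

theorem CR_card (F : (μ → ℝ) → (μ → ℝ)) (hF : ∀ i, IsReg (fun x => F x i)) (hd : ∀ x, (fderiv ℝ F x).det ≠ 0)
    (hi : Function.Injective F) (al : μ → (σ ⊕ π → ℝ) → ℝ) (hal : ∀ i, IsReg (al i)) (p : π ⊕ (Unit ⊕ σ) → ℝ)
    (hfin : (CR F al p).Finite) (hdet : ∀ z ∈ CR F al p, (fderiv ℝ (Kp (KE F al) p) z).det ≠ 0) :
    ∃ S : Finset (σ → ℝ), S.card = (CR F al p).ncard ∧ (∀ s ∈ S, Al al p s ∈ Set.range F ∧ (fderiv ℝ (grad (EG F al p)) s).det ≠ 0) ∧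
      ∀ s, Al al p s ∈ Set.range F → (grad (EG F al p) s = 0 ↔ s ∈ S) := by
  let f : (σ ⊕ μ → ℝ) → (σ → ℝ) := fun z k => z (Sum.inl k)
  have hinj : Set.InjOn f (CR F al p) := by
    intro z hz z' hz' h
    have h' : (fun k => z (Sum.inl k)) = (fun k => z' (Sum.inl k)) := h
    rw [(CR_elim F hi al p z hz).2, (CR_elim F hi al p z' hz').2, h']
  refine ⟨(hfin.image f).toFinset, ?_, ?_, ?_⟩
  · rw [← Set.ncard_eq_toFinset_card _ (hfin.image f), Set.ncard_image_of_injOn hinj]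
  · intro s hs
    obtain ⟨z, hz, rfl⟩ := (hfin.image f).mem_toFinset.1 hs
    have h1 := CR_elim F hi al p z hz
    refine ⟨h1.1, (EG_link F hF hd hi al hal p _ h1.1).2.2 ?_⟩
    have h2 := hdet z hz
    rw [h1.2] at h2
    exact h2
  · intro s hs
    rw [(EG_link F hF hd hi al hal p s hs).2.1, Set.Finite.mem_toFinset]
    constructor
    · intro h; exact ⟨_, h, rfl⟩
    · rintro ⟨z, hz, rfl⟩
      have h1 := CR_elim F hi al p z hz
      have h2 := hz
      rw [h1.2] at h2
      exact h2

theorem odd_of_sum_sign {ι : Type} (S : Finset ι) (f : ι → ℝ) (hf : ∀ s ∈ S, f s ≠ 0) (h : ∑ s ∈ S, Real.sign (f s) = 1) : Odd S.card := by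
  classical
  have key : ∀ S : Finset ι, (∀ s ∈ S, f s ≠ 0) → ∃ m : ℤ, ∑ s ∈ S, Real.sign (f s) = S.card + 2 * m := by
    intro S
    induction S using Finset.induction_on with
    | empty => intro _; exact ⟨0, by simp⟩
    | insert a S ha ih =>
      intro hS
      obtain ⟨m, hm⟩ := ih fun s hs => hS s (Finset.mem_insert_of_mem hs)
      rw [Finset.sum_insert ha, Finset.card_insert_of_notMem ha, hm]
      rcases Real.sign_apply_eq_of_ne_zero _ (hS a (Finset.mem_insert_self _ _)) with h | h <;> rw [h]
      · exact ⟨m - 1, by push_cast; ring⟩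
      · exact ⟨m, by push_cast; ring⟩
  obtain ⟨m, hm⟩ := key S hf
  rw [h] at hm
  have : (1 : ℤ) = S.card + 2 * m := by exact_mod_cast hm
  rw [Nat.odd_iff]; omega

theorem coer_of_bdd {E : (σ → ℝ) → ℝ} (κ : ℝ) (hκ : 0 < κ) (q : σ → ℝ) (h : ∀ s, κ * ((∑ k, s k ^ 2) / 2) + ∑ k, q k * s k ≤ E s) :
    Tendsto E (cocompact _) atTop := by
  have h1 := coer_of_sq (fun s => 2 / κ * E s) (2 / κ * ((∑ k, q k ^ 2) / κ)) fun s => by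
    have h2 := quad_low (κ / 2) (by positivity) q s
    have h3 := h s
    have h4 : κ / 2 * ((∑ i, s i ^ 2) / 2) - (∑ k, q k ^ 2) / κ ≤ E s := by
      have e1 : -(∑ k, q k ^ 2) / (2 * (κ / 2)) = - ((∑ k, q k ^ 2) / κ) := by field_simp
      rw [e1] at h2
      have e2 : κ * ((∑ k, s k ^ 2) / 2) = κ / 2 * ((∑ k, s k ^ 2) / 2) + κ / 2 * ((∑ k, s k ^ 2) / 2) := by ring
      linarith
    calc (∑ i, s i ^ 2) / 2 - 2 / κ * ((∑ k, q k ^ 2) / κ) = 2 / κ * (κ / 2 * ((∑ i, s i ^ 2) / 2) - (∑ k, q k ^ 2) / κ) := by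
          field_simp
      _ ≤ _ := by gcongr
  have h2 : Tendsto (fun s => κ / 2 * (2 / κ * E s)) (cocompact _) atTop := h1.const_mul_atTop (by positivity)
  refine h2.congr fun s => ?_
  field_simp

theorem EG_coer (F : (μ → ℝ) → (μ → ℝ)) (al : μ → (σ ⊕ π → ℝ) → ℝ) (p : π ⊕ (Unit ⊕ σ) → ℝ)
    (hκ : 0 < p (Sum.inr (Sum.inl ()))) : Tendsto (EG F al p) (cocompact _) atTop := by
  refine coer_of_bdd _ hκ (fun k => p (Sum.inr (Sum.inr k))) fun s => ?_
  have : 0 ≤ ∑ i, (Function.invFun F (Al al p s)) i ^ 2 := Finset.sum_nonneg fun i _ => sq_nonneg _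
  unfold EG En
  linarith

theorem par_odd (F : (μ → ℝ) → (μ → ℝ)) (hF : ∀ i, IsReg (fun x => F x i)) (hd : ∀ x, (fderiv ℝ F x).det ≠ 0)
    (hi : Function.Injective F) (al : μ → (σ ⊕ π → ℝ) → ℝ) (hal : ∀ i, IsReg (al i)) (p : π ⊕ (Unit ⊕ σ) → ℝ)
    (hκ : 0 < p (Sum.inr (Sum.inl ())))
    (hfin : (CR F al p).Finite) (hdet : ∀ z ∈ CR F al p, (fderiv ℝ (Kp (KE F al) p) z).det ≠ 0)
    (hT : ∀ s, Al al p s ∈ Set.range F) : Odd (CR F al p).ncard := by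
  obtain ⟨S, h1, h2, h3⟩ := CR_card F hF hd hi al hal p hfin hdet
  rw [← h1]
  refine odd_of_sum_sign S (fun s => (fderiv ℝ (grad (EG F al p)) s).det) (fun s hs => (h2 s hs).2) ?_
  exact GD1 _ (contDiff_iff_contDiffAt.2 fun s => (EG_link F hF hd hi al hal p s (hT s)).1) (EG_coer F al p hκ) S
    (fun s => h3 s (hT s)) (fun s hs => (h2 s hs).2)

theorem par_even (F : (μ → ℝ) → (μ → ℝ)) (hF : ∀ i, IsReg (fun x => F x i)) (hd : ∀ x, (fderiv ℝ F x).det ≠ 0)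
    (hi : Function.Injective F) (al : μ → (σ ⊕ π → ℝ) → ℝ) (hal : ∀ i, IsReg (al i)) (p : π ⊕ (Unit ⊕ σ) → ℝ)
    (hκ : 0 < p (Sum.inr (Sum.inl ())))
    (hfin : (CR F al p).Finite) (hdet : ∀ z ∈ CR F al p, (fderiv ℝ (Kp (KE F al) p) z).det ≠ 0)
    (u : σ → ℝ) (hu : Al al p u ∉ Set.range F) (hT : ∀ s, s ≠ u → Al al p s ∈ Set.range F) : Even (CR F al p).ncard := by
  obtain ⟨S, h1, h2, h3⟩ := CR_card F hF hd hi al hal p hfin hdet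
  have hFc : ContDiff ℝ 2 F := contDiff_pi.2 fun i => (hF i).contDiff
  rw [← h1]
  refine GD2 (EG F al p) u (fun s hs => (EG_link F hF hd hi al hal p s (hT s hs)).1) (EG_coer F al p hκ) ?_ S
    (fun h => hu (h2 u h).1) (fun s hs => h3 s (hT s hs)) (fun s hs => (h2 s hs).2)
  rw [tendsto_atTop]
  intro b
  set C := (∑ k, p (Sum.inr (Sum.inr k)) ^ 2) / (2 * p (Sum.inr (Sum.inl ()))) with hC
  have hA := Al_contDiff al hal p (n := 2)
  have h4 := inv_blow F hFc.continuous _ hu (1 + 2 * |b + C|)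
  have h5 : ∀ᶠ s in 𝓝 u, s ∈ {s | Al al p s ∈ Set.range F → 1 + 2 * |b + C| < ‖Function.invFun F (Al al p s)‖} :=
    hA.continuous.continuousAt.eventually h4
  filter_upwards [mem_nhdsWithin_of_mem_nhds h5, self_mem_nhdsWithin] with s hs hsu
  have h6 := hs (hT s hsu)
  have h7 := EG_low F al p s hκ
  have h8 := abs_nonneg (b + C)
  have h9 := le_abs_self (b + C)
  nlinarith
end e1
end partE1

section partE2
open Filter Topology

section e2
variable {σ μ π : Type} [Fintype σ] [Fintype μ] [DecidableEq σ] [DecidableEq μ] [Fintype π] [DecidableEq π]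

theorem Al_joint (al : μ → (σ ⊕ π → ℝ) → ℝ) (hal : ∀ i, IsReg (al i)) :
    Continuous (fun z : (π ⊕ (Unit ⊕ σ) → ℝ) × (σ → ℝ) => Al al z.1 z.2) := by
  refine continuous_pi fun i => ?_
  have h1 : Continuous (al i) := (hal i).contDiff.continuous (n := 2)
  refine h1.comp (continuous_pi fun o => ?_)
  cases o with
  | inl k => exact (continuous_apply k).comp continuous_snd
  | inr a => exact (continuous_apply _).comp continuous_fst

theorem Q_joint : Continuous (fun z : (π ⊕ (Unit ⊕ σ) → ℝ) × (σ → ℝ) =>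
    z.1 (Sum.inr (Sum.inl ())) * ((∑ k, z.2 k ^ 2) / 2) + ∑ k, z.1 (Sum.inr (Sum.inr k)) * z.2 k) := by
  fun_prop

theorem tube {X Y : Type*} [TopologicalSpace X] [TopologicalSpace Y] {f : X × Y → ℝ} {K : Set Y} (hK : IsCompact K) (x0 : X)
    (hf : ∀ y ∈ K, ContinuousAt f (x0, y)) : ∃ C : ℝ, ∀ᶠ x in 𝓝 x0, ∀ y ∈ K, f (x, y) ≤ C := by
  have h1 : ContinuousOn (fun y => f (x0, y)) K := fun y hy =>
    ((hf y hy).comp (f := fun y => (x0, y)) (by fun_prop)).continuousWithinAt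
  obtain ⟨C, hC⟩ := hK.bddAbove_image h1
  refine ⟨C + 1, ?_⟩
  apply hK.eventually_forall_of_forall_eventually
  intro y hy
  have h2 : f (x0, y) < C + 1 := by
    have := hC ⟨y, hy, rfl⟩
    simp only at this
    linarith
  exact ((hf y hy).eventually_lt continuousAt_const h2).mono fun z hz => le_of_lt hz

theorem persist (F : (μ → ℝ) → (μ → ℝ)) (hF : ∀ i, IsReg (fun x => F x i)) (hd : ∀ x, (fderiv ℝ F x).det ≠ 0)
    (hi : Function.Injective F) (al : μ → (σ ⊕ π → ℝ) → ℝ) (hal : ∀ i, IsReg (al i)) (p0 : π ⊕ (Unit ⊕ σ) → ℝ)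
    (C : ℝ) (hC : ∀ᶠ p' in 𝓝 p0, ∀ z ∈ CR F al p', ‖z‖ ≤ C) (t : σ → ℝ) (ht : Al al p0 t ∉ Set.range F) (ρ : ℝ) (hρ : 0 < ρ)
    (hiso : ∀ s ∈ Metric.closedBall t ρ, s ≠ t → Al al p0 s ∈ Set.range F) :
    ∀ᶠ p' in 𝓝 p0, ∃ u ∈ Metric.closedBall t ρ, Al al p' u ∉ Set.range F := by
  have hFc : ContDiff ℝ 2 F := contDiff_pi.2 fun i => (hF i).contDiff
  have hA := Al_joint al hal
  have hQ := Q_joint (σ := σ) (π := π)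
  obtain ⟨C2, hC2⟩ := tube (isCompact_closedBall t ρ) p0 (fun y _ => hQ.continuousAt)
  obtain ⟨C3, hC3⟩ := tube (isCompact_closedBall t ρ) p0 (fun y _ => hQ.neg.continuousAt)
  obtain ⟨C1, hC1⟩ := tube (f := fun z => EG F al z.1 z.2) (isCompact_sphere t ρ) p0 (fun s hs => by
    have h1 : Al al p0 s ∈ Set.range F := hiso s (Metric.sphere_subset_closedBall hs) (by
      rintro rfl; simp at hs; exact hρ.ne hs)
    have h2 := (inv_contDiffAt F hFc hd hi _ h1).continuousAt
    have h3 : ContinuousAt (fun z : (π ⊕ (Unit ⊕ σ) → ℝ) × (σ → ℝ) => Function.invFun F (Al al z.1 z.2)) (p0, s) :=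
      ContinuousAt.comp (g := Function.invFun F) (f := fun z : (π ⊕ (Unit ⊕ σ) → ℝ) × (σ → ℝ) => Al al z.1 z.2) (by exact h2) hA.continuousAt
    have h4 : ∀ i, ContinuousAt (fun z : (π ⊕ (Unit ⊕ σ) → ℝ) × (σ → ℝ) => Function.invFun F (Al al z.1 z.2) i) (p0, s) :=
      fun i => continuousAt_pi.1 h3 i
    unfold EG En
    fun_prop)
  set B := |C| ^ 2 * Fintype.card μ with hB
  have hA0 : Continuous fun p => Al al p t := hA.comp (by fun_prop : Continuous fun p => (p, t))
  have hbig := hA0.continuousAt.eventually (inv_blow F hFc.continuous _ ht (1 + B + 2 * |C1| + 2 * |C2| + 2 * |C3|))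
  filter_upwards [hC, hC2, hC3, hC1, hbig] with p h1 h2 h3 h4 h5
  by_contra hcon
  push Not at hcon
  have hco : ContinuousOn (EG F al p) (Metric.closedBall t ρ) := fun s hs =>
    (EG_link F hF hd hi al hal p s (hcon s hs)).1.continuousAt.continuousWithinAt
  have htb : t ∈ Metric.closedBall t ρ := Metric.mem_closedBall_self hρ.le
  obtain ⟨s, hs, hmax⟩ := (isCompact_closedBall t ρ).exists_isMaxOn ⟨t, htb⟩ hco
  have hm : EG F al p t ≤ EG F al p s := hmax htb
  have e1 : -C3 + ‖Function.invFun F (Al al p t)‖ ^ 2 / 2 ≤ EG F al p t := by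
    have := norm_sq_le_sum (Function.invFun F (Al al p t))
    have := h3 t htb
    simp only [Pi.neg_apply] at this
    unfold EG En
    linarith
  have e2 := h5 (hcon t htb)
  have b0 : 0 ≤ B := by positivity
  have b1 := abs_nonneg C1
  have b2 := abs_nonneg C2
  have b3 := abs_nonneg C3
  have b1' := le_abs_self C1
  have b2' := le_abs_self C2
  have b3' := le_abs_self C3
  have hns : s ∉ Metric.sphere t ρ := by
    intro hss
    have := h4 s hss
    nlinarith
  have hin : s ∈ Metric.ball t ρ := by
    rw [Metric.mem_ball]
    exact lt_of_le_of_ne hs hns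
  have hloc : IsLocalMax (EG F al p) s := hmax.isLocalMax (mem_of_superset (Metric.isOpen_ball.mem_nhds hin) Metric.ball_subset_closedBall)
  have hg : grad (EG F al p) s = 0 := by
    funext i
    unfold grad
    rw [hloc.fderiv_eq_zero]; rfl
  have hz := h1 _ ((EG_link F hF hd hi al hal p s (hcon s hs)).2.1.1 hg)
  have hx : ∑ i, (Function.invFun F (Al al p s)) i ^ 2 ≤ B := by
    have : ∀ i, (Function.invFun F (Al al p s)) i ^ 2 ≤ |C| ^ 2 := by
      intro i
      have h6 := (norm_le_pi_norm _ (Sum.inr i)).trans (hz.trans (le_abs_self C))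
      rw [Sum.elim_inr, Real.norm_eq_abs] at h6
      rw [← sq_abs]
      gcongr
    calc _ ≤ ∑ i : μ, |C| ^ 2 := Finset.sum_le_sum fun i _ => this i
      _ = B := by simp [hB, mul_comm]
  have e3 : EG F al p s ≤ B / 2 + C2 := by
    have := h2 s hs
    unfold EG En
    linarith
  nlinarith
end e2
end partE2

section partE3
open Filter Topology

section e3
variable {μ : Type} [Fintype μ] [DecidableEq μ]

abbrev FP (μ : Type) (j : ℕ) : Type := (μ ⊕ (μ × Fin j)) ⊕ (Unit ⊕ Fin j)

def afl (j : ℕ) : μ → (Fin j ⊕ (μ ⊕ (μ × Fin j)) → ℝ) → ℝ := fun i y =>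
  y (Sum.inr (Sum.inl i)) + ∑ k, y (Sum.inr (Sum.inr (i, k))) * y (Sum.inl k)

theorem afl_reg (j : ℕ) (i : μ) : IsReg (afl j i) :=
  (IsReg.coord _).add (IsReg.sum _ fun k => (IsReg.coord _).mul (IsReg.coord _))

theorem afl_Al (j : ℕ) (p : FP μ j → ℝ) (s : Fin j → ℝ) (i : μ) :
    Al (afl j) p s i = p (Sum.inl (Sum.inl i)) + ∑ k, p (Sum.inl (Sum.inr (i, k))) * s k := rfl

def SS (F : (μ → ℝ) → (μ → ℝ)) (j : ℕ) : Prop := ∃ h : MvPolynomial (FP μ j) ℝ, h ≠ 0 ∧ ∀ p, MvPolynomial.eval p h ≠ 0 →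
  ∀ s, Al (afl j) p s ∈ Set.range F

theorem SS_zero (F : (μ → ℝ) → (μ → ℝ)) (hF : ∀ i, IsReg (fun x => F x i)) (hd : ∀ x, (fderiv ℝ F x).det ≠ 0)
    (hi : Function.Injective F) : SS F 0 := by
  have hFc : ContDiff ℝ 2 F := contDiff_pi.2 fun i => (hF i).contDiff
  obtain ⟨h, hh, D, hP⟩ := PLE F hF hd (afl (μ := μ) 0) (afl_reg 0)
  have hAl : ∀ p s s', Al (afl (μ := μ) 0) p s = Al (afl 0) p s' := fun p s s' => by rw [Subsingleton.elim s s']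
  obtain ⟨p1, hp1, hp1'⟩ := poly_dense h hh {p | Al (afl 0) p 0 ∈ Set.range F}
    (fun o => match o with | Sum.inl (Sum.inl i) => F 0 i | _ => 1) (by
      refine IsOpen.mem_nhds ?_ ?_
      · exact (rg_open F hFc hd).preimage ((Al_joint (afl 0) (afl_reg 0)).comp (by fun_prop : Continuous fun p => (p, (0 : Fin 0 → ℝ))))
      · refine ⟨0, ?_⟩
        funext i
        rw [afl_Al]; simp)
  refine ⟨h, hh, fun p hp s => ?_⟩
  obtain ⟨a1, a2, a3, -⟩ := hP p hp
  obtain ⟨b1, b2, b3, -⟩ := hP p1 hp1'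
  obtain ⟨S1, c1, c2, c3⟩ := CR_card F hF hd hi _ (afl_reg 0) p1 b1 b3
  obtain ⟨S, d1, d2, d3⟩ := CR_card F hF hd hi _ (afl_reg 0) p a1 a3
  have h1 : S1 = {0} := by
    ext s
    rw [Finset.mem_singleton]
    refine ⟨fun _ => Subsingleton.elim _ _, fun h => ?_⟩
    rw [h]
    exact (c3 0 hp1).1 (by funext i; exact i.elim0)
  have h2 : S.card ≡ 1 [MOD 2] := by
    rw [d1]; refine a2.trans (b2.symm.trans ?_); rw [← c1, h1]; rfl
  have h3 : S.Nonempty := by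
    rw [← Finset.card_pos]
    by_contra h0
    have : S.card = 0 := by omega
    rw [this] at h2; exact absurd h2 (by decide)
  obtain ⟨s', hs'⟩ := h3
  rw [hAl p s s']; exact (d2 s' hs').1

def rsl (j : ℕ) (i : Fin (j + 1)) : FP μ j → FP μ (j + 1)
  | Sum.inl (Sum.inl a) => Sum.inl (Sum.inl a)
  | Sum.inl (Sum.inr ak) => Sum.inl (Sum.inr (ak.1, i.succAbove ak.2))
  | Sum.inr (Sum.inl u) => Sum.inr (Sum.inl u)
  | Sum.inr (Sum.inr k) => Sum.inr (Sum.inr (i.succAbove k))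

theorem rsl_inj (j : ℕ) (i : Fin (j + 1)) : Function.Injective (rsl (μ := μ) j i) := by
  rintro ((a | ⟨a, k⟩) | (u | k)) ((a' | ⟨a', k'⟩) | (u' | k')) h <;> simp_all [rsl]

def rsd (j : ℕ) (i : Fin (j + 1)) (p : FP μ (j + 1) → ℝ) : FP μ j → ℝ
  | Sum.inl (Sum.inl a) => p (Sum.inl (Sum.inr (a, i)))
  | _ => 0

theorem rs_Al (j : ℕ) (i : Fin (j + 1)) (p : FP μ (j + 1) → ℝ) (s : Fin (j + 1) → ℝ) :
    Al (afl (j + 1)) p s = Al (afl j) (fun o => p (rsl j i o) + s i * rsd j i p o) (fun k => s (i.succAbove k)) := by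
  funext a
  rw [afl_Al, afl_Al, Fin.sum_univ_succAbove _ i]
  simp [rsl, rsd]
  ring

theorem T_fin (F : (μ → ℝ) → (μ → ℝ)) (j : ℕ) (h : MvPolynomial (FP μ j) ℝ)
    (hS : ∀ p, MvPolynomial.eval p h ≠ 0 → ∀ s, Al (afl j) p s ∈ Set.range F) :
    ∃ N, ∀ p : FP μ (j + 1) → ℝ, (∀ i, MvPolynomial.eval p (MvPolynomial.rename (rsl j i) h) ≠ 0) →
      {s | Al (afl (j + 1)) p s ∉ Set.range F}.Finite ∧ {s | Al (afl (j + 1)) p s ∉ Set.range F}.ncard ≤ N := by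
  refine ⟨h.totalDegree ^ (j + 1), fun p hp => ?_⟩
  let P : Fin (j + 1) → Polynomial ℝ := fun i => MvPolynomial.aeval (fun o => Polynomial.C (p (rsl j i o)) + Polynomial.X * Polynomial.C (rsd j i p o)) h
  have hPe : ∀ i c, (P i).eval c = MvPolynomial.eval (fun o => p (rsl j i o) + c * rsd j i p o) h := by
    intro i c
    simp only [P]
    rw [← Polynomial.coe_evalRingHom, MvPolynomial.aeval_def, MvPolynomial.eval₂_comp_left (Polynomial.evalRingHom c), MvPolynomial.eval, MvPolynomial.coe_eval₂Hom]
    congr 1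
    · ext; simp
    · funext o; simp; ring
  have hP0 : ∀ i, P i ≠ 0 := by
    intro i h0
    have h1 := hPe i 0
    rw [h0] at h1
    have h2 := hp i
    rw [MvPolynomial.eval_rename] at h2
    apply h2
    simpa [Function.comp_def] using h1.symm
  have hdeg : ∀ i, (P i).natDegree ≤ h.totalDegree := by
    intro i
    have := MvPolynomial.aeval_natDegree_le h le_rfl (fun o => Polynomial.C (p (rsl j i o)) + Polynomial.X * Polynomial.C (rsd j i p o)) (n := 1) (fun o => by
      compute_degree)
    rw [mul_one] at this
    exact this
  have hsub : {s | Al (afl (j + 1)) p s ∉ Set.range F} ⊆ (Fintype.piFinset fun i => (P i).roots.toFinset : Finset (Fin (j + 1) → ℝ)) := by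
    intro s hs
    rw [Finset.mem_coe, Fintype.mem_piFinset]
    intro i
    rw [Multiset.mem_toFinset, Polynomial.mem_roots (hP0 i), Polynomial.IsRoot, hPe]
    by_contra hne
    apply hs
    rw [rs_Al j i p s]
    exact hS _ hne _
  refine ⟨(Finset.finite_toSet _).subset hsub, ?_⟩
  refine (Set.ncard_le_ncard hsub (Finset.finite_toSet _)).trans ?_
  rw [Set.ncard_coe_finset, Fintype.card_piFinset]
  calc ∏ i, (P i).roots.toFinset.card ≤ ∏ i : Fin (j + 1), h.totalDegree := Finset.prod_le_prod' fun i _ =>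
        ((Multiset.toFinset_card_le _).trans (Polynomial.card_roots' _)).trans (hdeg i)
    _ = _ := by simp
end e3
end partE3

section partE4
open Filter Topology

section e4
variable {μ : Type} [Fintype μ] [DecidableEq μ]

theorem not_SS (F : (μ → ℝ) → (μ → ℝ)) (z : μ → ℝ) (hz : z ∉ Set.range F) : ¬ SS F (Fintype.card μ) := by
  rintro ⟨h, hh, hS⟩
  let e := Fintype.equivFin μ
  let M : (FP μ (Fintype.card μ) → ℝ) → Matrix μ μ ℝ := fun p => Matrix.of fun i k => p (Sum.inl (Sum.inr (i, e k)))
  have hM : Continuous M := continuous_matrix fun i k => continuous_apply _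
  obtain ⟨p, hp, hp'⟩ := poly_dense h hh {p | (M p).det ≠ 0}
    (fun o => match o with | Sum.inl (Sum.inr ik) => if e ik.1 = ik.2 then 1 else 0 | _ => 0) (by
      refine IsOpen.mem_nhds (isOpen_ne_fun hM.matrix_det continuous_const) ?_
      have : M (fun o => match o with | Sum.inl (Sum.inr ik) => if e ik.1 = ik.2 then 1 else 0 | _ => 0) = 1 := by
        ext i k
        simp [M, Matrix.one_apply]
      show Matrix.det _ ≠ 0
      rw [this, Matrix.det_one]; norm_num)
  apply hz
  have hb : ∃ v, (M p).mulVec v = z - fun i => p (Sum.inl (Sum.inl i)) :=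
    ⟨(M p)⁻¹.mulVec (z - fun i => p (Sum.inl (Sum.inl i))), by
      rw [Matrix.mulVec_mulVec, Matrix.mul_nonsing_inv _ (isUnit_iff_ne_zero.2 hp), Matrix.one_mulVec]⟩
  obtain ⟨v, hv⟩ := hb
  have h1 := hS p hp' (fun k => v (e.symm k))
  have h2 : Al (afl (Fintype.card μ)) p (fun k => v (e.symm k)) = z := by
    funext i
    rw [afl_Al, ← Equiv.sum_comp e]
    have h3 := congrFun hv i
    simp only [Matrix.mulVec, dotProduct, M, Matrix.of_apply, Pi.sub_apply] at h3
    simp only [Equiv.symm_apply_apply]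
    rw [h3]; ring
  rwa [h2] at h1

theorem AFF (F : (μ → ℝ) → (μ → ℝ)) (hF : ∀ i, IsReg (fun x => F x i)) (hd : ∀ x, (fderiv ℝ F x).det ≠ 0)
    (hi : Function.Injective F) (j : ℕ) (hj : SS F j) (hj' : ¬ SS F (j + 1)) :
    ∃ (p0 : FP μ (j + 1) → ℝ) (t : Fin (j + 1) → ℝ) (r0 : ℝ), 0 < r0 ∧ ∀ ρ, 0 < ρ → ρ ≤ r0 → ∀ᶠ p' in 𝓝 p0,
      ∃ u, u ∈ Metric.closedBall t ρ ∧ Al (afl (j + 1)) p' u ∉ Set.range F ∧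
        ∀ w, w ∈ Metric.closedBall t ρ → Al (afl (j + 1)) p' w ∉ Set.range F → w = u := by
  obtain ⟨h, hh, hS⟩ := hj
  obtain ⟨h1, hh1, D, hP⟩ := PLE F hF hd (afl (μ := μ) (j + 1)) (afl_reg (j + 1))
  obtain ⟨N, hN⟩ := T_fin F j h hS
  set h2 : MvPolynomial (FP μ (j + 1)) ℝ := h1 * ∏ i, MvPolynomial.rename (rsl j i) h with hh2
  have h20 : h2 ≠ 0 := mul_ne_zero hh1 (Finset.prod_ne_zero_iff.2 fun i _ => by
    rw [Ne, map_eq_zero_iff _ (MvPolynomial.rename_injective _ (rsl_inj j i))]; exact hh)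
  have hev : ∀ p, MvPolynomial.eval p h2 ≠ 0 → MvPolynomial.eval p h1 ≠ 0 ∧ ∀ i, MvPolynomial.eval p (MvPolynomial.rename (rsl j i) h) ≠ 0 := by
    intro p hp
    rw [hh2, map_mul, map_prod] at hp
    exact ⟨left_ne_zero_of_mul hp, fun i => Finset.prod_ne_zero_iff.1 (right_ne_zero_of_mul hp) i (Finset.mem_univ i)⟩
  let T : (FP μ (j + 1) → ℝ) → Set (Fin (j + 1) → ℝ) := fun p => {s | Al (afl (j + 1)) p s ∉ Set.range F}
  have hTf : ∀ p, MvPolynomial.eval p h2 ≠ 0 → (T p).Finite ∧ (T p).ncard ≤ N := fun p hp => hN p (hev p hp).2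
  have hne : {p | MvPolynomial.eval p h2 ≠ 0 ∧ (T p).Nonempty}.Nonempty := by
    by_contra hcon
    apply hj'
    refine ⟨h2, h20, fun p hp s => ?_⟩
    by_contra hs
    exact hcon ⟨p, hp, s, hs⟩
  obtain ⟨p0, ⟨hp0, t, ht⟩, hmin⟩ := (measure fun p => N - (T p).ncard).wf.has_min _ hne
  have hmax : ∀ p, MvPolynomial.eval p h2 ≠ 0 → (T p).Nonempty → (T p).ncard ≤ (T p0).ncard := by
    intro p hp hpT
    have h3 : ¬ (N - (T p).ncard < N - (T p0).ncard) := hmin p ⟨hp, hpT⟩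
    have := (hTf p hp).2
    have := (hTf p0 hp0).2
    omega
  have hf0 := (hTf p0 hp0).1
  have hsep : ∀ᶠ r in 𝓝[>] (0:ℝ), ∀ a ∈ T p0, ∀ b ∈ T p0, a ≠ b → 2 * r < dist a b := by
    refine (eventually_all_finite hf0).2 fun a _ => (eventually_all_finite hf0).2 fun b _ => ?_
    by_cases hab : a = b
    · exact Eventually.of_forall fun r h => absurd hab h
    · have : ∀ᶠ r in 𝓝 (0:ℝ), 2 * r < dist a b :=
        (by fun_prop : ContinuousAt (fun r : ℝ => 2 * r) 0).eventually_lt continuousAt_const (by simpa using dist_pos.2 hab)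
      filter_upwards [mem_nhdsWithin_of_mem_nhds this] with r hr _
      exact hr
  obtain ⟨r0, hr0s, hr0⟩ := (hsep.and self_mem_nhdsWithin).exists
  obtain ⟨-, -, -, C, hC⟩ := hP p0 (hev p0 hp0).1
  refine ⟨p0, t, r0, hr0, fun ρ hρ hρr => ?_⟩
  have hper : ∀ᶠ p' in 𝓝 p0, ∀ t' ∈ T p0, ∃ u ∈ Metric.closedBall t' ρ, Al (afl (j + 1)) p' u ∉ Set.range F := by
    refine (eventually_all_finite hf0).2 fun t' ht' => ?_
    refine persist F hF hd hi _ (afl_reg (j + 1)) p0 C hC t' ht' ρ hρ fun s hs hst => ?_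
    by_contra hsT
    have h3 := hr0s s hsT t' ht' hst
    rw [Metric.mem_closedBall] at hs
    linarith
  have hop : ∀ᶠ p' in 𝓝 p0, MvPolynomial.eval p' h2 ≠ 0 :=
    (MvPolynomial.continuous_eval h2).continuousAt.eventually_ne hp0
  filter_upwards [hper, hop] with p' h3 h4
  choose! u hu1 hu2 using h3
  have hinj : Set.InjOn u (T p0) := by
    intro a ha b hb hab
    by_contra hne
    have h5 := hr0s a ha b hb hne
    have h6 := hu1 a ha
    have h7 := hu1 b hb
    rw [← hab] at h7
    rw [Metric.mem_closedBall] at h6 h7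
    have := dist_triangle_left a b (u a)
    linarith
  have hsub : u '' T p0 ⊆ T p' := by
    rintro _ ⟨a, ha, rfl⟩; exact hu2 a ha
  have heq : u '' T p0 = T p' := Set.eq_of_subset_of_ncard_le hsub (by
    rw [Set.ncard_image_of_injOn hinj]; exact hmax p' h4 ⟨u t, hu2 t ht⟩) (hTf p' h4).1
  refine ⟨u t, hu1 t ht, hu2 t ht, fun w hw hwT => ?_⟩
  have h5 : w ∈ u '' T p0 := by rw [heq]; exact hwT
  obtain ⟨t', ht', rfl⟩ := h5
  by_contra hne
  have hne' : t' ≠ t := fun h => hne (by rw [h])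
  have h6 := hr0s t' ht' t ht hne'
  have h7 := hu1 t' ht'
  rw [Metric.mem_closedBall] at hw h7
  have := dist_triangle_left t' t (u t')
  linarith

theorem exists_j (F : (μ → ℝ) → (μ → ℝ)) (hF : ∀ i, IsReg (fun x => F x i)) (hd : ∀ x, (fderiv ℝ F x).det ≠ 0)
    (hi : Function.Injective F) (z : μ → ℝ) (hz : z ∉ Set.range F) : ∃ j, SS F j ∧ ¬ SS F (j + 1) := by
  by_contra hcon
  push Not at hcon
  have : ∀ j, SS F j := fun j => by
    induction j with
    | zero => exact SS_zero F hF hd hi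
    | succ k ih => exact hcon k ih
  exact not_SS F z hz (this _)
end e4
end partE4

section partE5
open Filter Topology

section e5
variable {σ μ : Type} [Fintype σ] [DecidableEq σ] [Fintype μ] [DecidableEq μ]

theorem exists_norm_coord [Nonempty σ] (x : σ → ℝ) : ∃ i, ‖x‖ = |x i| := by
  obtain ⟨i, hi⟩ := Finite.exists_max fun i => ‖x i‖
  exact ⟨i, le_antisymm ((pi_norm_le_iff_of_nonneg (abs_nonneg _)).2 hi) (norm_le_pi_norm x i)⟩

theorem loc2 [Nonempty σ] (a : (σ → ℝ) → (μ → ℝ)) (Z : Set (μ → ℝ)) (r ε : ℝ) (hr : 0 < r) (hε : 0 < ε)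
    (H : ∀ (c w : μ → ℝ) (u : σ → ℝ) (i : σ), ‖c‖ ≤ ε → ‖w‖ ≤ ε → u ∈ Metric.closedBall (0 : σ → ℝ) r →
      ∃ s, s ∈ Metric.closedBall (0 : σ → ℝ) r ∧ a s + c + (s i - u i) • w ∈ Z ∧
        ∀ s', s' ∈ Metric.closedBall (0 : σ → ℝ) r → a s' + c + (s' i - u i) • w ∈ Z → s' = s)
    (δ : (σ → ℝ) → (μ → ℝ)) (h1 : ∀ u ∈ Metric.closedBall (0 : σ → ℝ) r, ‖δ u‖ ≤ ε)
    (h2 : ∀ u ∈ Metric.closedBall (0 : σ → ℝ) r, ∀ u' ∈ Metric.closedBall (0 : σ → ℝ) r, ‖δ u - δ u'‖ ≤ ε / 2 * ‖u - u'‖) :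
    ∃ u, u ∈ Metric.closedBall (0 : σ → ℝ) r ∧ a u + δ u ∈ Z ∧ ∀ w, w ∈ Metric.closedBall (0 : σ → ℝ) r → a w + δ w ∈ Z → w = u := by
  have hz : (0 : σ → ℝ) ∈ Metric.closedBall (0 : σ → ℝ) r := Metric.mem_closedBall_self hr.le
  have H0 : ∀ c : μ → ℝ, ‖c‖ ≤ ε → ∃ s, s ∈ Metric.closedBall (0 : σ → ℝ) r ∧ a s + c ∈ Z ∧
      ∀ s', s' ∈ Metric.closedBall (0 : σ → ℝ) r → a s' + c ∈ Z → s' = s := by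
    intro c hc
    obtain ⟨s, e1, e2, e3⟩ := H c 0 0 (Classical.arbitrary σ) hc (by simpa using hε.le) hz
    simp only [smul_zero, add_zero] at e2 e3
    exact ⟨s, e1, e2, e3⟩
  choose! γ g1 g2 g3 using H0
  have gl : ∀ c c', ‖c‖ ≤ ε → ‖c'‖ ≤ ε → ε * ‖γ c - γ c'‖ ≤ ‖c - c'‖ := by
    intro c c' hc hc'
    by_contra hlt
    push Not at hlt
    obtain ⟨i, hi⟩ := exists_norm_coord (γ c - γ c')
    have hpos : 0 < ‖γ c - γ c'‖ := by
      by_contra h0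
      have h00 : ‖γ c - γ c'‖ = 0 := le_antisymm (not_lt.1 h0) (norm_nonneg _)
      rw [h00, mul_zero] at hlt
      exact absurd (norm_nonneg _) (not_le.2 hlt)
    rw [Pi.sub_apply] at hi
    have hne : γ c' i - γ c i ≠ 0 := by
      intro h0
      rw [hi, abs_sub_comm, h0] at hpos
      simp at hpos
    set w : μ → ℝ := (γ c' i - γ c i)⁻¹ • (c' - c) with hw
    have hwn : ‖w‖ ≤ ε := by
      rw [hw, norm_smul, norm_inv, Real.norm_eq_abs, abs_sub_comm, ← hi, norm_sub_rev c' c, inv_mul_le_iff₀ hpos, mul_comm]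
      exact hlt.le
    obtain ⟨s, -, -, e3⟩ := H c w (γ c) i hc hwn (g1 c hc)
    have k1 := e3 (γ c) (g1 c hc) (by rw [sub_self, zero_smul, add_zero]; exact g2 c hc)
    have k2 := e3 (γ c') (g1 c' hc') (by
      rw [hw, smul_smul, mul_inv_cancel₀ hne, one_smul, add_assoc, add_sub_cancel]; exact g2 c' hc')
    rw [k1, k2, sub_self, norm_zero] at hpos
    exact lt_irrefl _ hpos
  let B := Metric.closedBall (0 : σ → ℝ) r
  let f : B → B := fun u => ⟨γ (δ u), g1 _ (h1 u u.2)⟩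
  have hf : ContractingWith (1/2) f := by
    refine ⟨by rw [← NNReal.coe_lt_coe]; norm_num, LipschitzWith.of_dist_le_mul fun u u' => ?_⟩
    have e1 := gl _ _ (h1 u u.2) (h1 u' u'.2)
    have e2 := h2 u u.2 u' u'.2
    rw [Subtype.dist_eq, Subtype.dist_eq, dist_eq_norm, dist_eq_norm]
    have e3 : ε * ‖γ (δ u) - γ (δ u')‖ ≤ ε * (1 / 2 * ‖(u : σ → ℝ) - u'‖) := by linarith
    simpa using le_of_mul_le_mul_left e3 hε
  haveI : Nonempty B := ⟨⟨0, hz⟩⟩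
  haveI : CompleteSpace B := Metric.isClosed_closedBall.isComplete.completeSpace_coe
  have hfix := hf.fixedPoint_isFixedPt
  set u := ContractingWith.fixedPoint f hf with hu
  have hue : γ (δ u) = u := congrArg Subtype.val hfix
  refine ⟨u, u.2, ?_, fun w hw hwZ => ?_⟩
  · have := g2 _ (h1 u u.2)
    rwa [hue] at this
  · have e1 : f ⟨w, hw⟩ = ⟨w, hw⟩ := Subtype.ext (g3 _ (h1 w hw) w hw hwZ).symm
    exact congrArg Subtype.val (hf.fixedPoint_unique e1)

theorem LOC (F : (μ → ℝ) → (μ → ℝ)) (hF : ∀ i, IsReg (fun x => F x i)) (hd : ∀ x, (fderiv ℝ F x).det ≠ 0)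
    (hi : Function.Injective F) (z : μ → ℝ) (hz : z ∉ Set.range F) :
    ∃ (j : ℕ) (a : (Fin (j + 1) → ℝ) → (μ → ℝ)) (C : ℝ), (∀ i, IsReg (fun s => a s i)) ∧ 0 ≤ C ∧ (∀ s s', ‖a s - a s'‖ ≤ C * ‖s - s'‖) ∧
      ∀ r, 0 < r → r ≤ 1 → ∃ ε, 0 < ε ∧ ∀ δ : (Fin (j + 1) → ℝ) → (μ → ℝ),
        (∀ u ∈ Metric.closedBall (0 : Fin (j + 1) → ℝ) r, ‖δ u‖ ≤ ε) →
        (∀ u ∈ Metric.closedBall (0 : Fin (j + 1) → ℝ) r, ∀ u' ∈ Metric.closedBall (0 : Fin (j + 1) → ℝ) r, ‖δ u - δ u'‖ ≤ ε * ‖u - u'‖) →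
        ∃ u, u ∈ Metric.closedBall (0 : Fin (j + 1) → ℝ) r ∧ a u + δ u ∉ Set.range F ∧
          ∀ w, w ∈ Metric.closedBall (0 : Fin (j + 1) → ℝ) r → a w + δ w ∉ Set.range F → w = u := by
  obtain ⟨j, hj, hj'⟩ := exists_j F hF hd hi z hz
  obtain ⟨p0, t, r0, hr0, hA⟩ := AFF F hF hd hi j hj hj'
  let a : (Fin (j + 1) → ℝ) → (μ → ℝ) := fun s => Al (afl (j + 1)) p0 (t + r0 • s)
  have hae : ∀ s i, a s i = p0 (Sum.inl (Sum.inl i)) + ∑ k, p0 (Sum.inl (Sum.inr (i, k))) * (t k + r0 * s k) := fun s i => rfl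
  refine ⟨j, a, ∑ i, ∑ k, |p0 (Sum.inl (Sum.inr (i, k)))| * r0, ?_, by positivity, ?_, ?_⟩
  · intro i
    simp only [hae]
    exact (IsReg.const _).add (IsReg.sum _ fun k => (IsReg.const _).mul ((IsReg.const _).add ((IsReg.const _).mul (IsReg.coord _))))
  · intro s s'
    rw [pi_norm_le_iff_of_nonneg (by positivity)]
    intro i
    rw [Pi.sub_apply, hae, hae, add_sub_add_left_eq_sub, ← Finset.sum_sub_distrib, Real.norm_eq_abs]
    have e1 : |∑ k, (p0 (Sum.inl (Sum.inr (i, k))) * (t k + r0 * s k) - p0 (Sum.inl (Sum.inr (i, k))) * (t k + r0 * s' k))| ≤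
        ∑ k, |p0 (Sum.inl (Sum.inr (i, k)))| * r0 * ‖s - s'‖ := by
      refine (Finset.abs_sum_le_sum_abs _ _).trans (Finset.sum_le_sum fun k _ => ?_)
      have e2 : |s k - s' k| ≤ ‖s - s'‖ := norm_le_pi_norm (s - s') k
      rw [← mul_sub, add_sub_add_left_eq_sub, ← mul_sub, abs_mul, abs_mul, abs_of_pos hr0, mul_assoc]
      gcongr
    refine e1.trans ?_
    rw [← Finset.sum_mul]
    gcongr
    exact Finset.single_le_sum (f := fun i => ∑ k, |p0 (Sum.inl (Sum.inr (i, k)))| * r0) (fun i _ => by positivity) (Finset.mem_univ i)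
  · intro r hr hr1
    have hρ := hA (r0 * r) (by positivity) (by nlinarith)
    obtain ⟨η, hη, hb⟩ := Metric.eventually_nhds_iff.1 hρ
    set K := 1 + (‖t‖ + r0 + 1) / r0 with hK
    have hK0 : 0 < K := by positivity
    set ε := η / (2 * K) with hεd
    have hε : 0 < ε := by positivity
    have hεK : ε * K < η := by
      have : ε * K = η / 2 := by rw [hεd]; field_simp
      linarith
    refine ⟨ε / 2, by positivity, fun δ h1 h2 => ?_⟩
    refine loc2 a (Set.range F)ᶜ r ε hr hε ?_ δ (fun u hu => (h1 u hu).trans (by linarith)) h2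
    intro c w u i0 hc hw hu
    rw [mem_closedBall_zero_iff] at hu
    let p' : FP μ (j + 1) → ℝ := fun o => match o with
      | Sum.inl (Sum.inl i) => p0 (Sum.inl (Sum.inl i)) + (c i - w i / r0 * (t i0 + r0 * u i0))
      | Sum.inl (Sum.inr (i, k)) => p0 (Sum.inl (Sum.inr (i, k))) + (if k = i0 then w i / r0 else 0)
      | Sum.inr o => p0 (Sum.inr o)
    have hci : ∀ i, |c i| ≤ ε := fun i => (norm_le_pi_norm c i).trans hc
    have hwi : ∀ i, |w i / r0| ≤ ε / r0 := fun i => by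
      rw [abs_div, abs_of_pos hr0]
      gcongr
      exact (norm_le_pi_norm w i).trans hw
    have hti : |t i0 + r0 * u i0| ≤ ‖t‖ + r0 := by
      have e1 : |t i0| ≤ ‖t‖ := norm_le_pi_norm t i0
      have e2 : |u i0| ≤ 1 := (norm_le_pi_norm u i0).trans (hu.trans hr1)
      refine (abs_add_le _ _).trans ?_
      rw [abs_mul, abs_of_pos hr0]
      nlinarith
    have hKe : ε + ε / r0 * (‖t‖ + r0) + ε / r0 = ε * K := by rw [hK]; field_simp; ring
    have hq : 0 ≤ ε / r0 := by positivity
    have hq2 : 0 ≤ ε / r0 * (‖t‖ + r0) := by positivity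
    have hdist : dist p' p0 < η := by
      rw [dist_pi_lt_iff hη]
      rintro ((i | ⟨i, k⟩) | o)
      · simp only [p', Real.dist_eq, add_sub_cancel_left]
        have e1 : |w i / r0 * (t i0 + r0 * u i0)| ≤ ε / r0 * (‖t‖ + r0) := by
          rw [abs_mul]
          exact mul_le_mul (hwi i) hti (abs_nonneg _) hq
        have e2 := abs_sub (c i) (w i / r0 * (t i0 + r0 * u i0))
        have := hci i
        linarith
      · simp only [p', Real.dist_eq, add_sub_cancel_left]
        split_ifs
        · have := hwi i
          linarith
        · simpa using hη
      · simpa [p'] using hη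
    have hAl : ∀ s, Al (afl (j + 1)) p' (t + r0 • s) = a s + c + (s i0 - u i0) • w := by
      intro s
      funext i
      simp only [Pi.add_apply, Pi.smul_apply, hae, smul_eq_mul]
      rw [afl_Al]
      simp only [p', add_mul, Finset.sum_add_distrib, ite_mul, zero_mul, Finset.sum_ite_eq', Finset.mem_univ, if_true, Pi.add_apply, Pi.smul_apply, smul_eq_mul]
      field_simp
      ring
    have hball : ∀ s : Fin (j + 1) → ℝ, t + r0 • s ∈ Metric.closedBall t (r0 * r) ↔ s ∈ Metric.closedBall (0 : Fin (j + 1) → ℝ) r := by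
      intro s
      rw [mem_closedBall_iff_norm, add_sub_cancel_left, norm_smul, Real.norm_eq_abs, abs_of_pos hr0, mem_closedBall_zero_iff]
      exact mul_le_mul_iff_right₀ hr0
    obtain ⟨v, e1, e2, e3⟩ := hb hdist
    have hv : t + r0 • (r0⁻¹ • (v - t)) = v := by
      rw [smul_smul, mul_inv_cancel₀ hr0.ne', one_smul, add_sub_cancel]
    refine ⟨r0⁻¹ • (v - t), (hball _).1 (by rw [hv]; exact e1), ?_, fun s' hs' hs'Z => ?_⟩
    · rw [← hAl, hv]; exact e2
    · rw [← hAl] at hs'Z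
      have := e3 _ ((hball s').2 hs') hs'Z
      rw [← this, add_sub_cancel_left, smul_smul, inv_mul_cancel₀ hr0.ne', one_smul]
end e5
end partE5

section partE6
open Filter Topology

section e6
variable {σ μ : Type} [Fintype σ] [DecidableEq σ] [Fintype μ] [DecidableEq μ]

theorem smooth_lip (m : (σ → ℝ) → (μ → ℝ)) (hm : ContDiff ℝ 1 m) (r : ℝ) : ∃ M : ℝ, 0 ≤ M ∧
    (∀ u ∈ Metric.closedBall (0 : σ → ℝ) r, ‖m u‖ ≤ M) ∧
    ∀ u ∈ Metric.closedBall (0 : σ → ℝ) r, ∀ u' ∈ Metric.closedBall (0 : σ → ℝ) r, ‖m u - m u'‖ ≤ M * ‖u - u'‖ := by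
  obtain ⟨M1, h1⟩ := (isCompact_closedBall (0 : σ → ℝ) r).exists_bound_of_continuousOn hm.continuous.continuousOn
  obtain ⟨M2, h2⟩ := (isCompact_closedBall (0 : σ → ℝ) r).exists_bound_of_continuousOn (hm.continuous_fderiv (by norm_num)).continuousOn
  refine ⟨|M1| + |M2|, by positivity, fun u hu => ?_, fun u hu u' hu' => ?_⟩
  · have := h1 u hu
    have := le_abs_self M1
    have := abs_nonneg M2
    linarith
  · have h3 := (convex_closedBall (0 : σ → ℝ) r).norm_image_sub_le_of_norm_fderiv_le (𝕜 := ℝ) (f := m) (C := M2)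
      (fun x _ => hm.differentiable (by norm_num) x) h2 hu' hu
    refine h3.trans ?_
    gcongr
    have := le_abs_self M2
    have := abs_nonneg M1
    linarith

def nu (s : σ → ℝ) : ℝ := ∑ i, s i ^ 2

theorem nu_nonneg (s : σ → ℝ) : 0 ≤ nu s := Finset.sum_nonneg fun i _ => sq_nonneg _

theorem nu_cont : Continuous (nu (σ := σ)) := by unfold nu; fun_prop

theorem th_lip (x y : ℝ) (hx : 0 ≤ x) (hy : 0 ≤ y) : |x / (1 + x) - y / (1 + y)| ≤ |x - y| := by
  have e : x / (1 + x) - y / (1 + y) = (x - y) / ((1 + x) * (1 + y)) := by field_simp; ring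
  rw [e, abs_div, abs_of_pos (by positivity : 0 < (1 + x) * (1 + y))]
  exact div_le_self (abs_nonneg _) (by nlinarith)

theorem bump (m : (σ → ℝ) → (μ → ℝ)) (hm : ContDiff ℝ 1 m) (r : ℝ) (hr : 0 < r) (hr1 : r ≤ 1)
    (hν : ∀ u ∈ Metric.closedBall (0 : σ → ℝ) r, nu u ≤ 1 / 4) (ε : ℝ) (hε : 0 < ε) :
    ∀ᶠ b : ℕ in atTop, (∀ u ∈ Metric.closedBall (0 : σ → ℝ) r, ‖(nu u ^ b / (1 + nu u ^ b)) • m u‖ ≤ ε) ∧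
      ∀ u ∈ Metric.closedBall (0 : σ → ℝ) r, ∀ u' ∈ Metric.closedBall (0 : σ → ℝ) r,
        ‖(nu u ^ b / (1 + nu u ^ b)) • m u - (nu u' ^ b / (1 + nu u' ^ b)) • m u'‖ ≤ ε * ‖u - u'‖ := by
  obtain ⟨M, hM0, hM1, hM2⟩ := smooth_lip m hm r
  have hνl : ∀ u ∈ Metric.closedBall (0 : σ → ℝ) r, ∀ u' ∈ Metric.closedBall (0 : σ → ℝ) r,
      |nu u - nu u'| ≤ 2 * Fintype.card σ * ‖u - u'‖ := by
    intro u hu u' hu'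
    rw [mem_closedBall_zero_iff] at hu hu'
    unfold nu
    rw [← Finset.sum_sub_distrib]
    refine (Finset.abs_sum_le_sum_abs _ _).trans ?_
    calc ∑ i, |u i ^ 2 - u' i ^ 2| ≤ ∑ i : σ, 2 * ‖u - u'‖ := Finset.sum_le_sum fun i _ => by
          have e1 : |u i| ≤ ‖u‖ := norm_le_pi_norm u i
          have e2 : |u' i| ≤ ‖u'‖ := norm_le_pi_norm u' i
          have e3 : |u i - u' i| ≤ ‖u - u'‖ := norm_le_pi_norm (u - u') i
          have e4 : u i ^ 2 - u' i ^ 2 = (u i + u' i) * (u i - u' i) := by ring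
          rw [e4, abs_mul]
          have e5 := abs_add_le (u i) (u' i)
          exact mul_le_mul (by linarith) e3 (abs_nonneg _) (by norm_num)
      _ = _ := by simp; ring
  have t1 : Tendsto (fun b : ℕ => (1/4:ℝ) ^ b * M + 8 * M * Fintype.card σ * ((b:ℝ) * (1/4) ^ b)) atTop (𝓝 0) := by
    have h1 : Tendsto (fun b : ℕ => (1/4:ℝ) ^ b) atTop (𝓝 0) := tendsto_pow_atTop_nhds_zero_of_lt_one (by norm_num) (by norm_num)
    have h2 : Tendsto (fun b : ℕ => (b:ℝ) * (1/4) ^ b) atTop (𝓝 0) := tendsto_self_mul_const_pow_of_lt_one (by norm_num) (by norm_num)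
    simpa using (h1.mul_const M).add (h2.const_mul (8 * M * Fintype.card σ))
  filter_upwards [t1.eventually_lt_const hε] with b hb
  have hq : ∀ u ∈ Metric.closedBall (0 : σ → ℝ) r, |nu u ^ b / (1 + nu u ^ b)| ≤ (1/4) ^ b := by
    intro u hu
    have h0 := nu_nonneg u
    rw [abs_of_nonneg (by positivity)]
    refine (div_le_self (by positivity) (by have : 0 ≤ nu u ^ b := by positivity
                                            linarith)).trans ?_
    gcongr
    exact hν u hu
  have hp1 : 0 ≤ 8 * M * Fintype.card σ * ((b:ℝ) * (1/4) ^ b) := by positivity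
  constructor
  · intro u hu
    rw [norm_smul, Real.norm_eq_abs]
    have := mul_le_mul (hq u hu) (hM1 u hu) (norm_nonneg _) (by positivity)
    linarith
  · intro u hu u' hu'
    set A := nu u ^ b / (1 + nu u ^ b) with hA
    set A' := nu u' ^ b / (1 + nu u' ^ b) with hA'
    have e1 : A • m u - A' • m u' = A • (m u - m u') + (A - A') • m u' := by
      rw [smul_sub, sub_smul]; abel
    have e2 : ‖A • (m u - m u')‖ ≤ (1/4) ^ b * M * ‖u - u'‖ := by
      rw [norm_smul, mul_assoc]
      exact mul_le_mul (hq u hu) (hM2 u hu u' hu') (norm_nonneg _) (by positivity)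
    have e3 : |A - A'| ≤ 8 * Fintype.card σ * ((b:ℝ) * (1/4) ^ b) * ‖u - u'‖ := by
      have h0 := nu_nonneg u
      have h0' := nu_nonneg u'
      refine (th_lip _ _ (by positivity) (by positivity)).trans ?_
      refine (abs_pow_sub_pow_le _ _ _).trans ?_
      have h5 : max |nu u| |nu u'| ^ (b - 1) ≤ 4 * (1/4) ^ b := by
        have h6 : max |nu u| |nu u'| ≤ 1/4 := by
          rw [abs_of_nonneg h0, abs_of_nonneg h0']
          exact max_le (hν u hu) (hν u' hu')
        have h7 : max |nu u| |nu u'| ^ (b - 1) ≤ (1/4) ^ (b - 1) := by gcongr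
        refine h7.trans ?_
        rcases Nat.eq_zero_or_pos b with h | h
        · rw [h]; norm_num
        · obtain ⟨k, rfl⟩ : ∃ k, b = k + 1 := ⟨b - 1, by omega⟩
          rw [Nat.add_sub_cancel, pow_succ]; linarith
      calc |nu u - nu u'| * b * max |nu u| |nu u'| ^ (b - 1) ≤ (2 * Fintype.card σ * ‖u - u'‖) * b * (4 * (1/4) ^ b) := by
            gcongr
            exact hνl u hu u' hu'
        _ = _ := by ring
    have e4 : ‖(A - A') • m u'‖ ≤ 8 * Fintype.card σ * ((b:ℝ) * (1/4) ^ b) * ‖u - u'‖ * M := by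
      rw [norm_smul]
      exact mul_le_mul e3 (hM1 u' hu') (norm_nonneg _) (by positivity)
    rw [e1]
    refine (norm_add_le _ _).trans ((add_le_add e2 e4).trans ?_)
    have : (1/4) ^ b * M * ‖u - u'‖ + 8 * Fintype.card σ * ((b:ℝ) * (1/4) ^ b) * ‖u - u'‖ * M =
      ((1/4:ℝ) ^ b * M + 8 * M * Fintype.card σ * ((b:ℝ) * (1/4) ^ b)) * ‖u - u'‖ := by ring
    rw [this]
    gcongr
end e6
end partE6

section partE7
open Filter Topology

section e7
variable {σ μ : Type} [Fintype σ] [DecidableEq σ] [Fintype μ] [DecidableEq μ]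

theorem ext_g (F : (μ → ℝ) → (μ → ℝ)) (hF : ∀ i, IsReg (fun x => F x i)) (hd : ∀ x, (fderiv ℝ F x).det ≠ 0)
    (hi : Function.Injective F) (a : (σ → ℝ) → (μ → ℝ)) (ha : Continuous a)
    (h : ∀ s, nu s = 1 → a s ∈ Set.range F) :
    ∃ g : (σ → ℝ) → (μ → ℝ), Continuous g ∧ ∀ s, nu s = 1 → F (g s) = a s := by
  have hFc : ContDiff ℝ 2 F := contDiff_pi.2 fun i => (hF i).contDiff
  have hcl : IsClosed {s : σ → ℝ | nu s = 1} := isClosed_eq nu_cont continuous_const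
  have hc : Continuous (fun s : {s : σ → ℝ | nu s = 1} => Function.invFun F (a s)) := by
    rw [continuous_iff_continuousAt]
    rintro ⟨s, hs⟩
    exact ContinuousAt.comp (f := fun s : {s : σ → ℝ | nu s = 1} => a s) (g := Function.invFun F) (x := ⟨s, hs⟩)
      (inv_contDiffAt F hFc hd hi _ (h s hs)).continuousAt (ha.comp continuous_subtype_val).continuousAt
  obtain ⟨g, hg⟩ := ContinuousMap.exists_restrict_eq hcl ⟨_, hc⟩
  refine ⟨g, g.continuous, fun s hs => ?_⟩
  have := DFunLike.congr_fun hg ⟨s, hs⟩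
  simp only [ContinuousMap.restrict_apply, ContinuousMap.coe_mk] at this
  rw [this]
  exact Function.invFun_eq (h s hs)

theorem nu_norm (s : σ → ℝ) (h : nu s ≤ 1) : ‖s‖ ≤ 1 := by
  refine (pi_norm_le_iff_of_nonneg zero_le_one).2 fun i => ?_
  have h1 : s i ^ 2 ≤ nu s := Finset.single_le_sum (f := fun i => s i ^ 2) (fun i _ => sq_nonneg _) (Finset.mem_univ i)
  rw [Real.norm_eq_abs, abs_le]
  constructor <;> nlinarith

theorem nu_compact (t : ℝ) : IsCompact {s : σ → ℝ | nu s ≤ t} := by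
  refine Metric.isCompact_of_isClosed_isBounded (isClosed_le nu_cont continuous_const) ?_
  refine (Metric.isBounded_closedBall (x := (0 : σ → ℝ)) (r := 1 + |t|)).subset fun s hs => ?_
  rw [mem_closedBall_zero_iff]
  refine (pi_norm_le_iff_of_nonneg (by positivity)).2 fun i => ?_
  have h1 : s i ^ 2 ≤ nu s := Finset.single_le_sum (f := fun i => s i ^ 2) (fun i _ => sq_nonneg _) (Finset.mem_univ i)
  have h2 : nu s ≤ t := hs
  have := le_abs_self t
  have := abs_nonneg t
  rw [Real.norm_eq_abs, abs_le]
  constructor <;> nlinarith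

noncomputable def sg (s : σ → ℝ) : σ → ℝ := fun i => 2 * s i / (1 + nu s)

theorem sg_cont : Continuous (sg (σ := σ)) := by
  refine continuous_pi fun i => ?_
  exact (continuous_const.mul (continuous_apply i)).div (continuous_const.add nu_cont)
    fun s => by have := nu_nonneg s; positivity

theorem sg_norm (s : σ → ℝ) : sg s ∈ Metric.closedBall (0 : σ → ℝ) 1 := by
  rw [mem_closedBall_zero_iff]
  refine (pi_norm_le_iff_of_nonneg zero_le_one).2 fun i => ?_
  have h1 : s i ^ 2 ≤ nu s := Finset.single_le_sum (f := fun i => s i ^ 2) (fun i _ => sq_nonneg _) (Finset.mem_univ i)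
  have h0 := nu_nonneg s
  rw [Real.norm_eq_abs, sg, abs_div, abs_of_pos (by positivity : 0 < 1 + nu s), div_le_one (by positivity), abs_le]
  constructor <;> nlinarith [sq_nonneg (s i + 1), sq_nonneg (s i - 1)]

theorem sg_one (s : σ → ℝ) (h : nu s = 1) : sg s = s := by
  funext i; rw [sg, h]; ring

theorem nu_reg : IsReg (nu (σ := σ)) := IsReg.sum _ fun i => (IsReg.coord i).pow 2

theorem blend (a H H' : (σ → ℝ) → (μ → ℝ)) (ha : Continuous a) (hH' : Continuous H') (c D : ℝ) (hc : 0 < c) (hD : 0 ≤ D)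
    (h1 : ∀ s, ‖H s - H' s‖ ≤ c / 8) (h2 : ∀ s, nu s = 1 → H' s = a s) (h3 : ∀ s, ‖H s - a s‖ ≤ D * (1 + nu s)) :
    ∀ᶠ b : ℕ in atTop, ∀ s, (nu s ≤ 1 → ‖a s + (nu s ^ b / (1 + nu s ^ b)) • (H s - a s) - a s‖ ≤ c / 2) ∧
      (1 ≤ nu s → ‖a s + (nu s ^ b / (1 + nu s ^ b)) • (H s - a s) - H' s‖ ≤ c / 2) := by
  obtain ⟨ω, hω, hω1, hω2⟩ : ∃ ω : ℝ, 0 < ω ∧ ω < 1 ∧ ∀ s : σ → ℝ, |nu s - 1| < ω → ‖H s - a s‖ ≤ c / 4 := by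
    have hW : IsCompact ({s : σ → ℝ | nu s ≤ 2} ∩ {s | c / 8 ≤ ‖H' s - a s‖}) :=
      (nu_compact 2).inter_right (isClosed_le continuous_const (hH'.sub ha).norm)
    have hcl := (hW.image nu_cont).isClosed
    have h1m : (1:ℝ) ∉ nu '' ({s : σ → ℝ | nu s ≤ 2} ∩ {s | c / 8 ≤ ‖H' s - a s‖}) := by
      rintro ⟨s, ⟨-, hs⟩, hs1⟩
      have hs' : c / 8 ≤ ‖H' s - a s‖ := hs
      rw [h2 s hs1, sub_self, norm_zero] at hs'
      linarith
    obtain ⟨ω, hω, hb⟩ := Metric.isOpen_iff.1 hcl.isOpen_compl 1 h1m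
    refine ⟨min ω (1/2), by positivity, (min_le_right _ _).trans_lt (by norm_num), fun s hs => ?_⟩
    have hs1 := hs.trans_le (min_le_left _ _)
    have hs2 := (abs_lt.1 (hs.trans_le (min_le_right _ _))).2
    have hn : nu s ∉ nu '' ({s : σ → ℝ | nu s ≤ 2} ∩ {s | c / 8 ≤ ‖H' s - a s‖}) :=
      hb (by rw [Metric.mem_ball, Real.dist_eq]; exact hs1)
    have h5 : ‖H' s - a s‖ < c / 8 := by
      by_contra hlt
      push Not at hlt
      exact hn ⟨s, ⟨(by linarith : nu s ≤ 2), hlt⟩, rfl⟩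
    have := norm_sub_le_norm_sub_add_norm_sub (H s) (H' s) (a s)
    linarith [h1 s]
  have t1 : Tendsto (fun b : ℕ => (1 - ω) ^ b * (2 * D)) atTop (𝓝 0) := by
    simpa using (tendsto_pow_atTop_nhds_zero_of_lt_one (by linarith : 0 ≤ 1 - ω) (by linarith)).mul_const (2 * D)
  have t2 : Tendsto (fun b : ℕ => (1 + ω)⁻¹ ^ b * (2 * D * (1 + ω))) atTop (𝓝 0) := by
    simpa using (tendsto_pow_atTop_nhds_zero_of_lt_one (by positivity : 0 ≤ (1 + ω)⁻¹)
      (inv_lt_one_of_one_lt₀ (by linarith))).mul_const (2 * D * (1 + ω))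
  filter_upwards [t1.eventually_lt_const (by positivity : 0 < c / 4), t2.eventually_lt_const (by positivity : 0 < c / 4), eventually_ge_atTop 1]
    with b hb1 hb2 hb3 s
  have h0 := nu_nonneg s
  have hp : 0 ≤ nu s ^ b := by positivity
  constructor
  · intro hs
    rw [add_sub_cancel_left, norm_smul, Real.norm_eq_abs, abs_of_nonneg (by positivity)]
    have q : nu s ^ b / (1 + nu s ^ b) ≤ nu s ^ b := div_le_self hp (by linarith)
    rcases lt_or_ge (|nu s - 1|) ω with hh | hh
    · have q1 : nu s ^ b ≤ 1 := pow_le_one₀ h0 hs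
      have := mul_le_mul (q.trans q1) (hω2 s hh) (norm_nonneg _) (by norm_num)
      linarith
    · rw [abs_of_nonpos (by linarith)] at hh
      have q1 : nu s ^ b ≤ (1 - ω) ^ b := by gcongr; linarith
      have q2 : ‖H s - a s‖ ≤ 2 * D := (h3 s).trans (by nlinarith)
      have := mul_le_mul (q.trans q1) q2 (norm_nonneg _) (by have : 0 ≤ 1 - ω := by linarith
                                                             positivity)
      linarith
  · intro hs
    have e : a s + (nu s ^ b / (1 + nu s ^ b)) • (H s - a s) - H' s = (H s - H' s) - (1 / (1 + nu s ^ b)) • (H s - a s) := by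
      have : nu s ^ b / (1 + nu s ^ b) = 1 - 1 / (1 + nu s ^ b) := by field_simp; ring
      rw [this, sub_smul, one_smul]; abel
    rw [e]
    refine (norm_sub_le _ _).trans ?_
    have key : ‖(1 / (1 + nu s ^ b)) • (H s - a s)‖ ≤ c / 4 := by
      rw [norm_smul, Real.norm_eq_abs, abs_of_nonneg (by positivity)]
      rcases lt_or_ge (|nu s - 1|) ω with hh | hh
      · have := mul_le_mul (div_le_self (zero_le_one) (by linarith) : 1 / (1 + nu s ^ b) ≤ 1) (hω2 s hh) (norm_nonneg _) (by norm_num)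
        linarith
      · rw [abs_of_nonneg (by linarith)] at hh
        have q1 : ‖H s - a s‖ ≤ 2 * D * nu s := (h3 s).trans (by nlinarith)
        obtain ⟨k, rfl⟩ : ∃ k, b = k + 1 := ⟨b - 1, by omega⟩
        have q2 : (1 + ω) ^ k * nu s ≤ 1 + nu s ^ (k + 1) := by
          have : (1 + ω) ^ k ≤ nu s ^ k := by gcongr; linarith
          rw [pow_succ]; nlinarith
        have q3 : 0 < (1 + ω) ^ k := by positivity
        have q4 : (1 + ω)⁻¹ ^ (k + 1) * (2 * D * (1 + ω)) = 2 * D / (1 + ω) ^ k := by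
          rw [inv_pow, pow_succ]; field_simp
        rw [q4] at hb2
        refine le_trans ?_ hb2.le
        rw [one_div_mul_eq_div, div_le_div_iff₀ (by positivity) q3]
        nlinarith [mul_le_mul_of_nonneg_right q1 q3.le, mul_le_mul_of_nonneg_left q2 hD]
    linarith [h1 s]
end e7
end partE7

section partE8
open Filter Topology

section e8
variable {σ μ : Type} [Fintype σ] [DecidableEq σ] [Fintype μ] [DecidableEq μ]

theorem approx_F (F : (μ → ℝ) → (μ → ℝ)) (hF : Continuous F) (g : (σ → ℝ) → (μ → ℝ)) (hg : Continuous g)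
    (K : Set (σ → ℝ)) (hK : IsCompact K) (e : ℝ) (he : 0 < e) :
    ∃ P : μ → MvPolynomial σ ℝ, ∀ s ∈ K, ‖F (fun i => MvPolynomial.eval s (P i)) - F (g s)‖ ≤ e := by
  have hu := (hK.image hg).uniformContinuousAt_of_continuousAt F (fun a _ => hF.continuousAt) (Metric.dist_mem_uniformity he)
  obtain ⟨d, hd, hd'⟩ := Metric.mem_uniformity_dist.1 hu
  have := fun i => sw_approx (fun s => g s i) ((continuous_apply i).comp hg) K hK (d / 2) (by positivity)
  choose P hP using this
  refine ⟨P, fun s hs => ?_⟩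
  have h1 : dist (g s) (fun i => MvPolynomial.eval s (P i)) < d := by
    rw [dist_eq_norm]
    refine lt_of_le_of_lt ((pi_norm_le_iff_of_nonneg (by positivity : 0 ≤ d / 2)).2 fun i => ?_) (by linarith)
    rw [Pi.sub_apply, norm_sub_rev]
    exact (hP i s hs).le
  have h2 : dist (F (g s)) (F (fun i => MvPolynomial.eval s (P i))) < e := hd' h1 ⟨s, hs, rfl⟩
  rw [dist_comm, dist_eq_norm] at h2
  exact h2.le

theorem phi_exists (F : (μ → ℝ) → (μ → ℝ)) (hF : ∀ i, IsReg (fun x => F x i)) (hd : ∀ x, (fderiv ℝ F x).det ≠ 0)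
    (hi : Function.Injective F) (a : (σ → ℝ) → (μ → ℝ)) (har : ∀ i, IsReg (fun s => a s i)) (C : ℝ) (hC : 0 ≤ C)
    (hl : ∀ s s', ‖a s - a s'‖ ≤ C * ‖s - s'‖) (r : ℝ) (hr : 0 < r) (hr1 : r ≤ 1)
    (hν : ∀ u ∈ Metric.closedBall (0 : σ → ℝ) r, nu u ≤ 1 / 4)
    (hU : ∀ s, nu s ≤ 1 → r ≤ ‖s‖ → a s ∈ Set.range F) (ε : ℝ) (hε : 0 < ε) :
    ∃ φ : (σ → ℝ) → (μ → ℝ), (∀ i, IsReg (fun s => φ s i)) ∧ ∃ c : ℝ, 0 < c ∧ ∃ B : ℝ, (∀ s, ‖φ s‖ ≤ B) ∧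
      (∀ s, r ≤ ‖s‖ → ∀ y, ‖y - φ s‖ ≤ c → y ∈ Set.range F) ∧
      (∀ u ∈ Metric.closedBall (0 : σ → ℝ) r, ‖φ u - a u‖ ≤ ε) ∧
      ∀ u ∈ Metric.closedBall (0 : σ → ℝ) r, ∀ u' ∈ Metric.closedBall (0 : σ → ℝ) r,
        ‖(φ u - a u) - (φ u' - a u')‖ ≤ ε * ‖u - u'‖ := by
  have hFc : ContDiff ℝ 2 F := contDiff_pi.2 fun i => (hF i).contDiff
  have hac : ContDiff ℝ 1 a := contDiff_pi.2 fun i => (har i).contDiff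
  have hn1 : ∀ s : σ → ℝ, 1 ≤ nu s → r ≤ ‖s‖ := by
    intro s hs
    by_contra hlt
    push Not at hlt
    have := hν s (by rw [mem_closedBall_zero_iff]; exact hlt.le)
    linarith
  obtain ⟨g, hg, hg1⟩ := ext_g F hF hd hi a hac.continuous (fun s hs => hU s hs.le (hn1 s hs.ge))
  let H' : (σ → ℝ) → (μ → ℝ) := fun s => F (g (sg s))
  have hH' : Continuous H' := hFc.continuous.comp (hg.comp sg_cont)
  have cK1 : IsCompact (a '' ({s : σ → ℝ | nu s ≤ 1} ∩ {s | r ≤ ‖s‖})) :=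
    ((nu_compact 1).inter_right (isClosed_le continuous_const continuous_norm)).image hac.continuous
  have cK2 : IsCompact ((fun s => F (g s)) '' Metric.closedBall (0 : σ → ℝ) 1) :=
    (isCompact_closedBall _ _).image (hFc.continuous.comp hg)
  obtain ⟨c, hc, hcU⟩ := (cK1.union cK2).exists_cthickening_subset_open (rg_open F hFc hd) (by
    rintro _ (⟨s, ⟨h1, h2⟩, rfl⟩ | ⟨s, -, rfl⟩)
    · exact hU s h1 h2
    · exact ⟨_, rfl⟩)
  obtain ⟨P, hP⟩ := approx_F F hFc.continuous g hg _ (isCompact_closedBall (0 : σ → ℝ) 1) (c / 8) (by positivity)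
  let H : (σ → ℝ) → (μ → ℝ) := fun s => F (fun i => MvPolynomial.eval (sg s) (P i))
  have hsr : ∀ k : σ, IsReg (fun s : σ → ℝ => sg s k) := fun k =>
    ((IsReg.const 2).mul (IsReg.coord k)).div ((IsReg.const 1).add nu_reg) fun s => by have := nu_nonneg s; positivity
  have hHr : ∀ i, IsReg (fun s => H s i) := fun i =>
    (hF i).comp (g := fun s i => MvPolynomial.eval (sg s) (P i)) fun k => (IsReg.poly (P k)).comp hsr
  have hHc : ContDiff ℝ 1 H := contDiff_pi.2 fun i => (hHr i).contDiff
  have hHH : ∀ s, ‖H s - H' s‖ ≤ c / 8 := fun s => hP _ (sg_norm s)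
  obtain ⟨B2, hB2⟩ := cK2.isBounded.exists_norm_le
  obtain ⟨B1, hB1⟩ := ((nu_compact (σ := σ) 1).image hac.continuous).isBounded.exists_norm_le
  have hH'B : ∀ s, ‖H' s‖ ≤ B2 := fun s => hB2 _ ⟨sg s, sg_norm s, rfl⟩
  have hB20 : 0 ≤ B2 := (norm_nonneg _).trans (hH'B 0)
  have hD : ∀ s, ‖H s - a s‖ ≤ (B2 + c / 8 + ‖a 0‖ + C) * (1 + nu s) := by
    intro s
    have e1 : ‖s‖ ^ 2 ≤ nu s := norm_sq_le_sum s
    have e0 := nu_nonneg s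
    have e2 : ‖s‖ ≤ 1 + nu s := by nlinarith [norm_nonneg s, sq_nonneg (‖s‖ - 1)]
    have e3 : ‖a s - a 0‖ ≤ C * ‖s‖ := by simpa using hl s 0
    have e4 : H s - a s = (H s - H' s) + H' s - (a s - a 0) - a 0 := by abel
    rw [e4]
    have e5 := norm_sub_le ((H s - H' s) + H' s - (a s - a 0)) (a 0)
    have e6 := norm_sub_le ((H s - H' s) + H' s) (a s - a 0)
    have e7 := norm_add_le (H s - H' s) (H' s)
    have e8 := mul_le_mul_of_nonneg_left e2 hC
    have e9 := hHH s
    have e10 := hH'B s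
    have : 0 ≤ (B2 + c / 8 + ‖a 0‖) * nu s := by positivity
    nlinarith
  have hb := blend a H H' hac.continuous hH' c (B2 + c / 8 + ‖a 0‖ + C) hc (by positivity) hHH
    (fun s hs => by simp only [H', sg_one s hs]; exact hg1 s hs) hD
  obtain ⟨b, hb1, hb2, hb3⟩ := (hb.and (bump (fun s => H s - a s) (hHc.sub hac) r hr hr1 hν ε hε)).exists
  let φ : (σ → ℝ) → (μ → ℝ) := fun s => a s + (nu s ^ b / (1 + nu s ^ b)) • (H s - a s)
  have hφa : ∀ s, φ s - a s = (nu s ^ b / (1 + nu s ^ b)) • (H s - a s) := fun s => add_sub_cancel_left _ _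
  refine ⟨φ, fun i => ?_, c / 2, by positivity, |B1| + B2 + c / 2, fun s => ?_, fun s hs y hy => ?_, fun u hu => ?_, fun u hu u' hu' => ?_⟩
  · exact (har i).add (((nu_reg.pow b).div ((IsReg.const 1).add (nu_reg.pow b))
      fun s => by have := nu_nonneg s; positivity).mul ((hHr i).sub (har i)))
  · have q1 := le_abs_self B1
    have q2 := abs_nonneg B1
    rcases le_total (nu s) 1 with h | h
    · have e1 : ‖φ s - a s‖ ≤ c / 2 := (hb1 s).1 h
      have e2 := hB1 _ ⟨s, h, rfl⟩
      have := norm_le_norm_add_norm_sub' (φ s) (a s)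
      linarith
    · have e1 : ‖φ s - H' s‖ ≤ c / 2 := (hb1 s).2 h
      have := norm_le_norm_add_norm_sub' (φ s) (H' s)
      linarith [hH'B s]
  · have key : ∃ k ∈ (a '' ({s : σ → ℝ | nu s ≤ 1} ∩ {s | r ≤ ‖s‖})) ∪ ((fun s => F (g s)) '' Metric.closedBall (0 : σ → ℝ) 1), ‖φ s - k‖ ≤ c / 2 := by
      rcases le_total (nu s) 1 with h | h
      · exact ⟨a s, Or.inl ⟨s, ⟨h, hs⟩, rfl⟩, (hb1 s).1 h⟩
      · exact ⟨H' s, Or.inr ⟨sg s, sg_norm s, rfl⟩, (hb1 s).2 h⟩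
    obtain ⟨k, hk, hks⟩ := key
    refine hcU (Metric.mem_cthickening_of_dist_le y k c _ hk ?_)
    rw [dist_eq_norm]
    have := norm_sub_le_norm_sub_add_norm_sub y (φ s) k
    linarith
  · rw [hφa]; exact hb2 u hu
  · rw [hφa, hφa]; exact hb3 u hu u' hu'
end e8
end partE8

section partE9
open Filter Topology

section e9
variable {μ : Type} [Fintype μ] [DecidableEq μ]

theorem ev_lt {X : Type} [TopologicalSpace X] {f : X → ℝ} {x : X} {u : ℝ} (h : f x < u) (hf : ContinuousAt f x) :
    ∀ᶠ y in 𝓝 x, f y < u := hf.eventually (gt_mem_nhds h)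

theorem surj_of_inj (F : (μ → ℝ) → (μ → ℝ)) (hF : ∀ i, IsReg (fun x => F x i)) (hd : ∀ x, (fderiv ℝ F x).det ≠ 0)
    (hi : Function.Injective F) : Function.Surjective F := by
  by_contra hns
  rw [Function.Surjective] at hns
  push Not at hns
  obtain ⟨z, hz⟩ := hns
  have hz' : z ∉ Set.range F := by rintro ⟨x, hx⟩; exact hz x hx
  have hFc : ContDiff ℝ 2 F := contDiff_pi.2 fun i => (hF i).contDiff
  obtain ⟨j, a, C, har, hC, hl, hloc⟩ := LOC F hF hd hi z hz'
  obtain ⟨r, hr, hr1, hν⟩ : ∃ r : ℝ, 0 < r ∧ r ≤ 1 ∧ ∀ u ∈ Metric.closedBall (0 : Fin (j+1) → ℝ) r, nu u ≤ 1 / 4 := by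
    have hj : (0:ℝ) ≤ j := by positivity
    refine ⟨1 / (2 * (j + 1)), by positivity, ?_, fun u hu => ?_⟩
    · rw [div_le_one (by positivity)]; linarith
    · rw [mem_closedBall_zero_iff] at hu
      have h1 : nu u ≤ ∑ i : Fin (j+1), (1 / (2 * ((j:ℝ) + 1))) ^ 2 := Finset.sum_le_sum fun i _ => by
        have := (norm_le_pi_norm u i).trans hu
        rw [Real.norm_eq_abs] at this
        rw [← sq_abs]
        gcongr
      refine h1.trans ?_
      simp only [Finset.sum_const, Finset.card_univ, Fintype.card_fin, nsmul_eq_mul, Nat.cast_add, Nat.cast_one]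
      rw [div_pow, one_pow, mul_one_div, div_le_div_iff₀ (by positivity) (by norm_num)]
      nlinarith
  have hsm : ∀ s : Fin (j+1) → ℝ, ‖s‖ ≤ 1 → a s ∉ Set.range F → ‖s‖ ≤ r / 2 := by
    intro s hs1 hs
    obtain ⟨e1, he1, k1⟩ := hloc 1 (by norm_num) le_rfl
    obtain ⟨e2, he2, k2⟩ := hloc (r / 2) (by positivity) (by linarith)
    obtain ⟨u1, -, -, hu1⟩ := k1 (fun _ => 0) (fun u _ => by simpa using he1.le) (fun u _ u' _ => by simp only [sub_self, norm_zero]; positivity)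
    obtain ⟨u2, hu2, hu2', -⟩ := k2 (fun _ => 0) (fun u _ => by simpa using he2.le) (fun u _ u' _ => by simp only [sub_self, norm_zero]; positivity)
    rw [mem_closedBall_zero_iff] at hu2
    have q1 := hu1 u2 (by rw [mem_closedBall_zero_iff]; linarith) hu2'
    have q2 := hu1 s (by rwa [mem_closedBall_zero_iff]) (by simpa using hs)
    rw [q2, ← q1]; exact hu2
  have hU : ∀ s : Fin (j+1) → ℝ, nu s ≤ 1 → r ≤ ‖s‖ → a s ∈ Set.range F := by
    intro s h1 h2
    by_contra h3
    have := hsm s (nu_norm s h1) h3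
    linarith
  obtain ⟨ε, hε, hLr⟩ := hloc r hr hr1
  obtain ⟨φ, hφr, c, hc, B, hB, hφ1, hφ2, hφ3⟩ := phi_exists F hF hd hi a har C hC hl r hr hr1 hν hU (ε / 4) (by positivity)
  let al : μ → (Fin (j+1) ⊕ (Unit ⊕ μ) → ℝ) → ℝ := fun i y => y (Sum.inr (Sum.inr i)) + y (Sum.inr (Sum.inl ())) * φ (fun k => y (Sum.inl k)) i
  have hal : ∀ i, IsReg (al i) := fun i => (IsReg.coord _).add ((IsReg.coord _).mul
    ((hφr i).comp (g := fun (y : Fin (j+1) ⊕ (Unit ⊕ μ) → ℝ) k => y (Sum.inl k)) fun k => IsReg.coord _))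
  obtain ⟨h, hh, D, hD⟩ := PLE F hF hd al hal
  let Y : ((Unit ⊕ μ) ⊕ (Unit ⊕ Fin (j+1)) → ℝ) → (μ → ℝ) := fun p i => p (Sum.inl (Sum.inr i))
  let T : ((Unit ⊕ μ) ⊕ (Unit ⊕ Fin (j+1)) → ℝ) → ℝ := fun p => p (Sum.inl (Sum.inl ()))
  have hYc : Continuous Y := by fun_prop
  have hTc : Continuous T := by fun_prop
  have hkc : Continuous (fun p : (Unit ⊕ μ) ⊕ (Unit ⊕ Fin (j+1)) → ℝ => p (Sum.inr (Sum.inl ()))) := by fun_prop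
  have hAl : ∀ p s, Al al p s = Y p + T p • φ s := fun p s => rfl
  have hodd : Odd D := by
    obtain ⟨d, hd0, hdU⟩ := Metric.isOpen_iff.1 (rg_open F hFc hd) (F 0) ⟨0, rfl⟩
    let p0 : (Unit ⊕ μ) ⊕ (Unit ⊕ Fin (j+1)) → ℝ := Sum.elim (Sum.elim (fun _ => 0) (F 0)) (Sum.elim (fun _ => 1) (fun _ => 0))
    have e1 : ∀ᶠ p in 𝓝 p0, ‖Y p - F 0‖ + |T p| * B < d := by
      refine ev_lt ?_ ?_ (f := fun p => ‖Y p - F 0‖ + |T p| * B)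
      · have : Y p0 = F 0 := rfl
        have : T p0 = 0 := rfl
        simp [*]
      · exact Continuous.continuousAt (by fun_prop)
    have e2 : ∀ᶠ p in 𝓝 p0, 0 < p (Sum.inr (Sum.inl ())) := hkc.continuousAt.eventually_const_lt (by simp [p0])
    obtain ⟨p, ⟨hp1, hp2⟩, hph⟩ := poly_dense h hh _ p0 (e1.and e2)
    obtain ⟨hfin, hmod, hdet, -⟩ := hD p hph
    have := par_odd F hF hd hi al hal p hp2 hfin hdet fun s => by
      refine hdU ?_
      rw [Metric.mem_ball, dist_eq_norm, hAl]
      have q1 : Y p + T p • φ s - F 0 = (Y p - F 0) + T p • φ s := by abel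
      rw [q1]
      refine (norm_add_le _ _).trans_lt ?_
      rw [norm_smul, Real.norm_eq_abs]
      have := mul_le_mul_of_nonneg_left (hB s) (abs_nonneg (T p))
      linarith
    rw [Nat.odd_iff] at this ⊢
    rw [← this]; exact hmod.symm
  have heven : Even D := by
    let p0 : (Unit ⊕ μ) ⊕ (Unit ⊕ Fin (j+1)) → ℝ := Sum.elim (Sum.elim (fun _ => 1) (fun _ => 0)) (Sum.elim (fun _ => 1) (fun _ => 0))
    have hY0 : Y p0 = 0 := rfl
    have hT0 : T p0 = 1 := rfl
    have e1 : ∀ᶠ p in 𝓝 p0, ‖Y p‖ + |T p - 1| * B < c := by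
      refine ev_lt ?_ ?_ (f := fun p => ‖Y p‖ + |T p - 1| * B)
      · simp [*]
      · exact Continuous.continuousAt (by fun_prop)
    have e2 : ∀ᶠ p in 𝓝 p0, 0 < p (Sum.inr (Sum.inl ())) := hkc.continuousAt.eventually_const_lt (by simp [p0])
    have e3 : ∀ᶠ p in 𝓝 p0, ‖Y p‖ + |T p - 1| * (‖a 0‖ + C) + |T p| * (ε / 4) < ε := by
      refine ev_lt ?_ ?_ (f := fun p => ‖Y p‖ + |T p - 1| * (‖a 0‖ + C) + |T p| * (ε / 4))
      · simp [*]; linarith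
      · exact Continuous.continuousAt (by fun_prop)
    have e4 : ∀ᶠ p in 𝓝 p0, |T p - 1| * C + |T p| * (ε / 4) < ε := by
      refine ev_lt ?_ ?_ (f := fun p => |T p - 1| * C + |T p| * (ε / 4))
      · simp [*]; linarith
      · exact Continuous.continuousAt (by fun_prop)
    obtain ⟨p, ⟨hp1, hp2, hp3, hp4⟩, hph⟩ := poly_dense h hh _ p0 (e1.and (e2.and (e3.and e4)))
    obtain ⟨hfin, hmod, hdet, -⟩ := hD p hph
    obtain ⟨u, hu1, hu2, hu3⟩ := hLr (fun u => Y p + (T p - 1) • a u + T p • (φ u - a u))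
      (fun u hu => by
        have q1 := norm_add_le (Y p + (T p - 1) • a u) (T p • (φ u - a u))
        have q2 := norm_add_le (Y p) ((T p - 1) • a u)
        rw [norm_smul, Real.norm_eq_abs] at q1 q2
        have q3 : ‖a u‖ ≤ ‖a 0‖ + C := by
          have w1 : ‖a u - a 0‖ ≤ C * ‖u‖ := by simpa using hl u 0
          rw [mem_closedBall_zero_iff] at hu
          have w2 : C * ‖u‖ ≤ C * 1 := mul_le_mul_of_nonneg_left (hu.trans hr1) hC
          have := norm_le_norm_add_norm_sub' (a u) (a 0)
          linarith
        have q4 := mul_le_mul_of_nonneg_left q3 (abs_nonneg (T p - 1))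
        have q5 := mul_le_mul_of_nonneg_left (hφ2 u hu) (abs_nonneg (T p))
        linarith)
      (fun u hu u' hu' => by
        have q0 : Y p + (T p - 1) • a u + T p • (φ u - a u) - (Y p + (T p - 1) • a u' + T p • (φ u' - a u')) =
          (T p - 1) • (a u - a u') + T p • ((φ u - a u) - (φ u' - a u')) := by
          rw [smul_sub (T p - 1), smul_sub (T p) (φ u - a u)]; abel
        rw [q0]
        have q1 := norm_add_le ((T p - 1) • (a u - a u')) (T p • ((φ u - a u) - (φ u' - a u')))
        rw [norm_smul, norm_smul, Real.norm_eq_abs, Real.norm_eq_abs] at q1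
        have q4 := mul_le_mul_of_nonneg_left (hl u u') (abs_nonneg (T p - 1))
        have q5 := mul_le_mul_of_nonneg_left (hφ3 u hu u' hu') (abs_nonneg (T p))
        have q6 := mul_le_mul_of_nonneg_right hp4.le (norm_nonneg (u - u'))
        nlinarith)
    have hAl' : ∀ s, a s + (Y p + (T p - 1) • a s + T p • (φ s - a s)) = Al al p s := by
      intro s
      rw [hAl, sub_smul, one_smul, smul_sub]; abel
    simp only [hAl'] at hu2 hu3
    have := par_even F hF hd hi al hal p hp2 hfin hdet u hu2 fun s hs => by
      by_contra hns
      rcases le_total ‖s‖ r with h1 | h1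
      · exact hs (hu3 s (by rwa [mem_closedBall_zero_iff]) hns)
      · refine hns (hφ1 s h1 _ ?_)
        have q1 : Al al p s - φ s = Y p + (T p - 1) • φ s := by
          rw [hAl, sub_smul, one_smul]; abel
        rw [q1]
        refine (norm_add_le _ _).trans ?_
        rw [norm_smul, Real.norm_eq_abs]
        have := mul_le_mul_of_nonneg_left (hB s) (abs_nonneg (T p - 1))
        linarith
    rw [Nat.even_iff] at this ⊢
    rw [← this]; exact hmod.symm
  exact (Nat.not_even_iff_odd.2 hodd) heven
end e9
end partE9

theorem invFun_analyticAt {μ : Type} [Fintype μ] [DecidableEq μ] (F : (μ → ℝ) → (μ → ℝ)) (hF : ContDiff ℝ ⊤ F) (hi : Function.Injective F)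
    (x0 : μ → ℝ) (hd : (fderiv ℝ F x0).det ≠ 0) : AnalyticAt ℝ (Function.invFun F) (F x0) := by
  let e : (μ → ℝ) ≃L[ℝ] (μ → ℝ) := ContinuousLinearEquiv.ofBijective (fderiv ℝ F x0)
    (LinearMap.ker_eq_bot'.2 ((clm_det_ne_iff _).1 hd)) (LinearMap.range_eq_top.2 (LinearMap.surjective_of_injective
      (LinearMap.ker_eq_bot.1 (LinearMap.ker_eq_bot'.2 ((clm_det_ne_iff _).1 hd)))))
  have he : (e : (μ → ℝ) →L[ℝ] (μ → ℝ)) = fderiv ℝ F x0 := by ext; rfl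
  have h1 : HasFDerivAt F (e : (μ → ℝ) →L[ℝ] (μ → ℝ)) x0 := by
    rw [he]; exact (hF.differentiable (by simp) x0).hasFDerivAt
  have h2 : HasStrictFDerivAt F (e : (μ → ℝ) →L[ℝ] (μ → ℝ)) x0 := hF.contDiffAt.hasStrictFDerivAt' h1 (by simp)
  have h3 : ContDiffAt ℝ ⊤ (hF.contDiffAt.localInverse h1 (by simp)) (F x0) := hF.contDiffAt.to_localInverse h1 (by simp)
  refine ContDiffAt.analyticAt (h3.congr_of_eventuallyEq ?_)
  filter_upwards [h2.eventually_right_inverse] with y hy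
  have := Function.leftInverse_invFun hi (hF.contDiffAt.localInverse h1 (by simp) y)
  have hy' : F (hF.contDiffAt.localInverse h1 (by simp) y) = y := hy
  rwa [hy'] at this

/-- For an everywhere defined real rational map `F : ℝⁿ → ℝⁿ` with nowhere
vanishing Jacobian determinant, with `A(F)` the set of points at which `F` is not proper,
the following are equivalent: (1) `F` is a bijection with real analytic inverse;
(2) `A(F) = ∅`; (3) `A(F) ∩ F(ℝⁿ) = ∅`; (4) `A(F)` is the boundary of `F(ℝⁿ)`. -/
theorem promoted_SRJC_cases
    (n : ℕ) (F : (Fin n → ℝ) → (Fin n → ℝ))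
    (hF : IsEverywhereDefRatMap n F)
    (hjac : ∀ x : Fin n → ℝ, (fderiv ℝ F x).det ≠ 0)
    (AF : Set (Fin n → ℝ)) (hAF : AF = {y | ¬ ProperAt n F y}) :
    List.TFAE
      [ Function.Bijective F ∧
          ∃ G : (Fin n → ℝ) → (Fin n → ℝ),
            (∀ x, G (F x) = x) ∧ (∀ y, F (G y) = y) ∧ AnalyticOnNhd ℝ G Set.univ,
        AF = ∅,
        AF ∩ Set.range F = ∅,
        AF = frontier (Set.range F) ] := by
  have hR : ∀ i, IsReg (fun x => F x i) := hF
  have hFc : ContDiff ℝ ⊤ F := contDiff_pi.2 fun i => (hR i).contDiff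
  have hop : IsOpen (Set.range F) := rg_open F (hFc.of_le le_top) hjac
  have h12 : (Function.Bijective F ∧ ∃ G : (Fin n → ℝ) → (Fin n → ℝ),
      (∀ x, G (F x) = x) ∧ (∀ y, F (G y) = y) ∧ AnalyticOnNhd ℝ G Set.univ) → AF = ∅ := by
    rintro ⟨-, G, h1, h2, h3⟩
    rw [hAF, Set.eq_empty_iff_forall_notMem]
    intro y hy
    refine hy ⟨Metric.closedBall y 1, Metric.closedBall_mem_nhds y one_pos, isCompact_closedBall _ _, ?_⟩
    have hG : Continuous G := continuousOn_univ.1 h3.continuousOn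
    have e : F ⁻¹' Metric.closedBall y 1 = G '' Metric.closedBall y 1 := by
      ext x
      constructor
      · intro hx; exact ⟨F x, hx, h1 x⟩
      · rintro ⟨w, hw, rfl⟩
        rw [Set.mem_preimage, h2]; exact hw
    rw [e]
    exact (isCompact_closedBall _ _).image hG
  tfae_have 1 → 2 := h12
  tfae_have 2 → 3 := by intro h; rw [h, Set.empty_inter]
  tfae_have 3 → 1 := by
    intro h
    have hi : Function.Injective F := by
      refine inj_of_proper F hR hjac fun y hy => ?_
      have hy' : y ∉ AF := fun hh => by
        have : y ∈ AF ∩ Set.range F := ⟨hh, hy⟩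
        rw [h] at this; exact this
      rw [hAF] at hy'
      have hp : ProperAt n F y := by
        by_contra hh; exact hy' hh
      obtain ⟨K, k1, -, k3⟩ := hp
      exact ⟨K, k1, k3⟩
    have hs : Function.Surjective F := surj_of_inj F hR hjac hi
    refine ⟨⟨hi, hs⟩, Function.invFun F, Function.leftInverse_invFun hi, Function.rightInverse_invFun hs, fun y _ => ?_⟩
    obtain ⟨x, rfl⟩ := hs y
    exact invFun_analyticAt F hFc hi x (hjac x)
  tfae_have 1 → 4 := by
    intro h
    rw [h12 h, h.1.2.range_eq, frontier_univ]
  tfae_have 4 → 3 := by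
    intro h
    rw [h, Set.eq_empty_iff_forall_notMem]
    rintro y ⟨h1, h2⟩
    rw [hop.frontier_eq] at h1
    exact h1.2 h2
  tfae_finish
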